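/- Let N ≥ 2, α ∈ (0,2), β := 2(α−1)/α, Ω ⊂ ℝ^N a bounded open set, and let w : Ω × (0,∞) → [0,∞) be continuous and bounded on the closure of C_Ω := Ω × (0,∞), of class C² on C_Ω with bounded derivatives up to order two, satisfying z^β ∂²_z w + Δ_x w = 0 in C_Ω and w = 0 on ∂Ω × [0,∞). Assume that |{x ∈ Ω : w(x,z) = w*(s,z)}| = 0 for almost every (s,z). Then the function U(s,z) := ∫_0^s w*(σ,z) dσ satisfies the differential inequality z^β ∂²U/∂z² + N² ω_N^{2/N} s^{2−2/N} ∂²U/∂s² ≥ 0 for almost every s ∈ (0,|Ω|) and every z ∈ (0,∞). -/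

import Mathlib

open MeasureTheory Filter Set

noncomputable section

abbrev Euc (N : ℕ) := EuclideanSpace ℝ (Fin N)

/-- Decreasing rearrangement of `g` on `E`:
`g*(s) = sup {t ≥ 0 : |{x ∈ E : |g x| > t}| > s}`. -/
def rearr {N : ℕ} (E : Set (Euc N)) (g : Euc N → ℝ) (s : ℝ) : ℝ :=
  sSup {t : ℝ | 0 ≤ t ∧ ENNReal.ofReal s < volume {x | x ∈ E ∧ t < |g x|}}

/-- Measure of the unit ball of `ℝ^N`. -/
def omegaN (N : ℕ) : ℝ := (volume (Metric.ball (0 : Euc N) 1)).toReal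

/-- Laplacian of `w` with respect to the `x` variables. -/
def lapx {N : ℕ} (w : Euc N → ℝ → ℝ) (x : Euc N) (y : ℝ) : ℝ :=
  ∑ i : Fin N, deriv (deriv fun t : ℝ => w (x + t • EuclideanSpace.single i (1 : ℝ)) y) 0

section

open scoped ContDiff Topology ENNReal NNReal

/-- The rank-zero Sard property in dimension `d`. -/
def SardRankZero (F : Type) [NormedAddCommGroup F] [NormedSpace ℝ F] (d : ℕ) : Prop :=
  ∀ (E : Type) [NormedAddCommGroup E] [NormedSpace ℝ E] [FiniteDimensional ℝ E],
    Module.finrank ℝ E = d → ∀ (V : Set E), IsOpen V → ∀ Φ : E → F, ContDiffOn ℝ ∞ Φ V →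
    ∀ P ⊆ V, (∀ p ∈ P, fderiv ℝ Φ p = 0) → dimH (Φ '' P) = 0

theorem dimH_image_eq_zero_of_locally {F : Type} [NormedAddCommGroup F]
    {E : Type} [NormedAddCommGroup E] [NormedSpace ℝ E]
    [FiniteDimensional ℝ E] {Φ : E → F} {P : Set E}
    (h : ∀ p ∈ P, ∃ W ∈ 𝓝 p, dimH (Φ '' (P ∩ W)) = 0) : dimH (Φ '' P) = 0 := by
  choose! W hW hW0 using h
  have : ProperSpace E := FiniteDimensional.proper_real E
  have : SecondCountableTopology E := secondCountable_of_proper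
  obtain ⟨t, htP, htc, ht⟩ := TopologicalSpace.countable_cover_nhdsWithin
    (f := W) (s := P) fun x hx => mem_nhdsWithin_of_mem_nhds (hW x hx)
  have : Φ '' P ⊆ ⋃ x ∈ t, Φ '' (P ∩ W x) := by
    rintro _ ⟨p, hp, rfl⟩
    obtain ⟨x, hx, hpx⟩ := mem_iUnion₂.1 (ht hp)
    exact mem_iUnion₂.2 ⟨x, hx, p, ⟨hp, hpx⟩, rfl⟩
  refine le_antisymm ((dimH_mono this).trans ?_) bot_le
  rw [dimH_bUnion htc]
  exact iSup₂_le fun x hx => (hW0 x (htP hx)).le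

theorem dimH_image_hypersurface {F : Type} [NormedAddCommGroup F] [NormedSpace ℝ F] {d : ℕ} (ih : SardRankZero F d)
    {E : Type} [NormedAddCommGroup E] [NormedSpace ℝ E] [FiniteDimensional ℝ E]
    (hd : Module.finrank ℝ E = d + 1) {V : Set E} (hV : IsOpen V) {Φ : E → F}
    (hΦ : ContDiffOn ℝ ∞ Φ V) {h : E → ℝ} (hh : ContDiffOn ℝ ∞ h V) {P : Set E}
    (hP0 : ∀ q ∈ P, h q = 0) (hker : ∀ q ∈ P, ∀ v, fderiv ℝ h q v = 0 → fderiv ℝ Φ q v = 0)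
    {p : E} (hp : p ∈ V) (hdp : fderiv ℝ h p ≠ 0) :
    ∃ W ∈ 𝓝 p, dimH (Φ '' (P ∩ W)) = 0 := by
  have : CompleteSpace E := FiniteDimensional.complete ℝ E
  set l : E →L[ℝ] ℝ := fderiv ℝ h p with hl
  obtain ⟨e, he⟩ : ∃ e, l e = 1 := by
    obtain ⟨v, hv⟩ := ContinuousLinearMap.exists_ne_zero hdp
    exact ⟨(l v)⁻¹ • v, by simp [inv_mul_cancel₀ hv]⟩
  let K := LinearMap.ker (l : E →ₗ[ℝ] ℝ)
  let π : E →L[ℝ] K := (ContinuousLinearMap.id ℝ E - l.smulRight e).codRestrict K (by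
    intro x; simp [K, he])
  have hπ : ∀ x, (π x : E) = x - l x • e := fun x => by simp [π]
  let G' : E ≃L[ℝ] ℝ × K := ContinuousLinearEquiv.equivOfInverse (l.prod π)
    ((ContinuousLinearMap.toSpanSingleton ℝ e).coprod K.subtypeL) (by
      intro x; simp [hπ]) (by
      rintro ⟨r, k⟩
      have hk : l (k : E) = 0 := k.2
      ext
      · simp [he, hk]
      · simp [hπ, he, hk])
  let G : E → ℝ × K := fun x => (h x, π x)
  have hcG : ∀ x ∈ V, ContDiffAt ℝ ∞ G x := fun x hx =>
    (hh.contDiffAt (hV.mem_nhds hx)).prodMk π.contDiff.contDiffAt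
  have hdG : ∀ x ∈ V, HasFDerivAt G ((fderiv ℝ h x).prod π) x := fun x hx =>
    (((hh.contDiffAt (hV.mem_nhds hx)).differentiableAt (by simp)).hasFDerivAt).prodMk
      π.hasFDerivAt
  have hGp : HasFDerivAt G (G' : E →L[ℝ] ℝ × K) p := hdG p hp
  let e₀ := (hcG p hp).toOpenPartialHomeomorph G hGp (by simp)
  have he₀ : (e₀ : E → ℝ × K) = G := rfl
  have hpe : p ∈ e₀.source := (hcG p hp).mem_toOpenPartialHomeomorph_source hGp (by simp)
  have hcont : ContinuousAt (fun x => (fderiv ℝ h x).prod π) p := by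
    have h1 : ContinuousAt (fderiv ℝ h) p :=
      ((hh.contDiffAt (hV.mem_nhds hp)).fderiv_right (m := ∞) (by simp)).continuousAt
    exact ((ContinuousLinearMap.prodₗᵢ (𝕜 := ℝ) (E := E) (F := ℝ) (G := K) ℝ).continuous.continuousAt.comp
      (h1.prodMk continuousAt_const) :)
  have hev : ∀ᶠ x in 𝓝 p, ∃ A : E ≃L[ℝ] ℝ × K, (A : E →L[ℝ] ℝ × K) = (fderiv ℝ h x).prod π :=
    hcont (ContinuousLinearEquiv.nhds G')
  obtain ⟨W, hWsub, hWo, hpW⟩ := eventually_nhds_iff.1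
    (hev.and ((hV.eventually_mem hp).and (e₀.open_source.eventually_mem hpe)))
  refine ⟨W, hWo.mem_nhds hpW, ?_⟩
  let ψ : K → E := fun k => e₀.symm (0, k)
  let V' : Set K := {k | ((0 : ℝ), k) ∈ e₀.target ∩ e₀.symm ⁻¹' W}
  have hV' : IsOpen V' := (e₀.isOpen_inter_preimage_symm hWo).preimage (by fun_prop)
  have hψ : ∀ k ∈ V', ContDiffAt ℝ ∞ ψ k := by
    intro k hk
    obtain ⟨⟨A, hA⟩, hxV, _⟩ := hWsub _ hk.2
    have : ContDiffAt ℝ ∞ e₀.symm ((0 : ℝ), k) :=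
      e₀.contDiffAt_symm hk.1 (f₀' := A) (by rw [hA]; exact hdG _ hxV) (hcG _ hxV)
    exact this.comp k (by fun_prop)
  have hψW : ∀ k ∈ V', ψ k ∈ W := fun k hk => hk.2
  have hhψ : ∀ k ∈ V', h (ψ k) = 0 := by
    intro k hk
    have : e₀ (e₀.symm (0, k)) = (0, k) := e₀.right_inv hk.1
    exact congrArg Prod.fst this
  have hsub : Φ '' (P ∩ W) ⊆ (Φ ∘ ψ) '' (V' ∩ ψ ⁻¹' P) := by
    rintro _ ⟨x, ⟨hxP, hxW⟩, rfl⟩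
    have hxs := (hWsub x hxW).2.2
    have hGx : e₀ x = (0, π x) := by
      change (h x, π x) = _
      rw [hP0 x hxP]
    have hx : ψ (π x) = x := by
      change e₀.symm (0, π x) = x
      rw [← hGx]; exact e₀.left_inv hxs
    have hmem : π x ∈ V' := by
      refine ⟨?_, ?_⟩
      · rw [← hGx]; exact e₀.map_source hxs
      · change ψ (π x) ∈ W
        rwa [hx]
    refine ⟨π x, ⟨hmem, ?_⟩, ?_⟩
    · change ψ (π x) ∈ P
      rwa [hx]
    · simp [hx]
  refine le_antisymm ((dimH_mono hsub).trans (le_of_eq ?_)) bot_le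
  have hfr : Module.finrank ℝ K = d := by
    have h1 := G'.toLinearEquiv.finrank_eq
    rw [Module.finrank_prod, Module.finrank_self] at h1
    omega
  refine ih K hfr V' hV' (Φ ∘ ψ) ?_ _ inter_subset_left ?_
  · intro k hk
    exact (((hΦ.contDiffAt (hV.mem_nhds (hWsub _ (hψW k hk)).2.1))).comp k
      (hψ k hk)).contDiffWithinAt
  · rintro k ⟨hk, hkP⟩
    have hkV := (hWsub _ (hψW k hk)).2.1
    have hdψ : DifferentiableAt ℝ ψ k := (hψ k hk).differentiableAt (by simp)
    have hdh : DifferentiableAt ℝ h (ψ k) :=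
      (hh.contDiffAt (hV.mem_nhds hkV)).differentiableAt (by simp)
    have hdΦ : DifferentiableAt ℝ Φ (ψ k) :=
      (hΦ.contDiffAt (hV.mem_nhds hkV)).differentiableAt (by simp)
    rw [fderiv_comp k hdΦ hdψ]
    ext v
    refine hker _ hkP _ ?_
    have h0 : fderiv ℝ (h ∘ ψ) k = 0 := by
      have : h ∘ ψ =ᶠ[𝓝 k] fun _ => (0 : ℝ) := by
        filter_upwards [hV'.mem_nhds hk] with k' hk' using hhψ k' hk'
      rw [this.fderiv_eq]; simp
    rw [fderiv_comp k hdh hdψ] at h0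
    simpa using congrArg (fun A => A v) h0

theorem contDiffAt_iteratedFDeriv {E F : Type} [NormedAddCommGroup E] [NormedSpace ℝ E]
    [NormedAddCommGroup F] [NormedSpace ℝ F] {V : Set E} (hV : IsOpen V) {Φ : E → F}
    (hΦ : ContDiffOn ℝ ∞ Φ V) (k : ℕ) {x : E} (hx : x ∈ V) :
    ContDiffAt ℝ ∞ (iteratedFDeriv ℝ k Φ) x :=
  (hΦ.contDiffAt (hV.mem_nhds hx)).iteratedFDeriv_right (m := ∞) (i := k)
    (by exact_mod_cast (le_top : (⊤ : ℕ∞) + (k : ℕ∞) ≤ ⊤))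

/-- If all derivatives of `Φ` vanish at each point of `P`, then `Φ` is locally Hölder of every
order with respect to base points in `P`. -/
theorem flat_bound {E F : Type} [NormedAddCommGroup E] [NormedSpace ℝ E]
    [FiniteDimensional ℝ E] [NormedAddCommGroup F] [NormedSpace ℝ F] {V : Set E} (hV : IsOpen V)
    {Φ : E → F} (hΦ : ContDiffOn ℝ ∞ Φ V) {p₀ : E} (hp₀ : p₀ ∈ V) (n : ℕ) :
    ∃ r > 0, ∃ C, ∀ p ∈ Metric.ball p₀ r, (∀ k, 1 ≤ k → iteratedFDeriv ℝ k Φ p = 0) →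
      ∀ x ∈ Metric.ball p₀ r, ‖Φ x - Φ p‖ ≤ C * ‖x - p‖ ^ (n + 1) := by
  obtain ⟨r, hr, C, hC⟩ : ∃ r > 0, ∃ C, ∀ x ∈ Metric.ball p₀ r,
      x ∈ V ∧ ‖iteratedFDeriv ℝ (n + 1) Φ x‖ ≤ C := by
    have hc : ContinuousAt (fun x => ‖iteratedFDeriv ℝ (n + 1) Φ x‖) p₀ :=
      (contDiffAt_iteratedFDeriv hV hΦ (n + 1) hp₀).continuousAt.norm
    have h1 := hc.eventually_lt_const (lt_add_one _)
    obtain ⟨r, hr, h⟩ := Metric.eventually_nhds_iff_ball.1 ((hV.eventually_mem hp₀).and h1)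
    exact ⟨r, hr, _, fun x hx => ⟨(h x hx).1, (h x hx).2.le⟩⟩
  have hC0 : 0 ≤ C := (norm_nonneg _).trans (hC p₀ (Metric.mem_ball_self hr)).2
  refine ⟨r, hr, C, fun p hp hflat => ?_⟩
  have hseg : ∀ x ∈ Metric.ball p₀ r, ∀ y ∈ segment ℝ p x, y ∈ Metric.ball p₀ r ∧
      ‖y - p‖ ≤ ‖x - p‖ := by
    intro x hx y hy
    refine ⟨(convex_ball p₀ r).segment_subset hp hx hy, ?_⟩
    obtain ⟨t, ht, rfl⟩ := segment_eq_image' ℝ p x ▸ hy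
    simp only [add_sub_cancel_left, norm_smul, Real.norm_eq_abs, abs_of_nonneg ht.1]
    exact mul_le_of_le_one_left (norm_nonneg _) ht.2
  have key : ∀ j k : ℕ, k + j = n → ∀ x ∈ Metric.ball p₀ r,
      ‖iteratedFDeriv ℝ (k + 1) Φ x‖ ≤ C * ‖x - p‖ ^ j := by
    intro j
    induction j with
    | zero => rintro k rfl x hx; simpa using (hC x hx).2
    | succ j ihj =>
      intro k hk x hx
      have hb : ∀ y ∈ segment ℝ p x,
          ‖fderiv ℝ (iteratedFDeriv ℝ (k + 1) Φ) y‖ ≤ C * ‖x - p‖ ^ j := by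
        intro y hy
        rw [norm_fderiv_iteratedFDeriv]
        refine (ihj (k + 1) (by omega) y (hseg x hx y hy).1).trans ?_
        gcongr
        exact (hseg x hx y hy).2
      have := (convex_segment p x).norm_image_sub_le_of_norm_fderiv_le (𝕜 := ℝ)
        (fun y hy => ((contDiffAt_iteratedFDeriv hV hΦ (k + 1)
          (hC y (hseg x hx y hy).1).1).differentiableAt (by simp))) hb
        (left_mem_segment ℝ p x) (right_mem_segment ℝ p x)
      rw [hflat (k + 1) (by omega), sub_zero] at this
      rw [pow_succ, ← mul_assoc]; exact this
  intro x hx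
  have hb : ∀ y ∈ segment ℝ p x, ‖fderiv ℝ Φ y‖ ≤ C * ‖x - p‖ ^ n := by
    intro y hy
    have h1 := key n 0 (by omega) y (hseg x hx y hy).1
    rw [zero_add] at h1
    rw [norm_iteratedFDeriv_one] at h1
    refine h1.trans ?_
    gcongr
    exact (hseg x hx y hy).2
  have := (convex_segment p x).norm_image_sub_le_of_norm_fderiv_le (𝕜 := ℝ)
    (fun y hy => ((hΦ.contDiffAt (hV.mem_nhds
      (hC y (hseg x hx y hy).1).1)).differentiableAt (by simp))) hb
    (left_mem_segment ℝ p x) (right_mem_segment ℝ p x)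
  rw [pow_succ, ← mul_assoc]; exact this

theorem dimH_image_flat {E F : Type} [NormedAddCommGroup E] [NormedSpace ℝ E]
    [FiniteDimensional ℝ E] [NormedAddCommGroup F] [NormedSpace ℝ F] {V : Set E} (hV : IsOpen V)
    {Φ : E → F} (hΦ : ContDiffOn ℝ ∞ Φ V) {P : Set E} (hP : P ⊆ V)
    (hflat : ∀ p ∈ P, ∀ k, 1 ≤ k → iteratedFDeriv ℝ k Φ p = 0) : dimH (Φ '' P) = 0 := by
  have hle : ∀ n : ℕ, dimH (Φ '' P) ≤ (Module.finrank ℝ E : ℝ≥0∞) / ((n + 1 : ℕ) : ℝ≥0) := by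
    intro n
    have hloc : ∀ p ∈ P, ∃ C : ℝ≥0, ∃ t ∈ 𝓝[P] p, HolderOnWith C ((n + 1 : ℕ) : ℝ≥0) Φ t := by
      intro p hp
      obtain ⟨r, hr, C, hC⟩ := flat_bound hV hΦ (hP hp) n
      refine ⟨C.toNNReal, P ∩ Metric.ball p r,
        inter_mem_nhdsWithin _ (Metric.ball_mem_nhds p hr), ?_⟩
      rintro x ⟨hxP, hx⟩ y ⟨hyP, hy⟩
      have h1 := hC y hy (hflat y hyP) x hx
      have h2 : ‖Φ x - Φ y‖ ≤ C.toNNReal * ‖x - y‖ ^ (n + 1) :=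
        h1.trans (by gcongr; exact Real.le_coe_toNNReal C)
      rw [edist_eq_enorm_sub, edist_eq_enorm_sub]
      have h3 : (((n + 1 : ℕ) : ℝ≥0) : ℝ) = ((n + 1 : ℕ) : ℝ) := by simp
      rw [h3, ENNReal.rpow_natCast, enorm_eq_nnnorm, enorm_eq_nnnorm]
      exact_mod_cast h2
    have hh := dimH_image_le_of_locally_holder_on (r := ((n + 1 : ℕ) : ℝ≥0)) (by positivity) hloc
    refine hh.trans ?_
    gcongr
    have := dimH_mono (subset_univ P)
    rwa [Real.dimH_univ_eq_finrank] at this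
  by_contra h0
  have hlim : Tendsto (fun n : ℕ => (Module.finrank ℝ E : ℝ≥0∞) / ((n + 1 : ℕ) : ℝ≥0)) atTop
      (𝓝 0) := by
    have h1 := (ENNReal.tendsto_inv_nat_nhds_zero).comp (tendsto_add_atTop_nat 1)
    have h2 := ENNReal.Tendsto.const_mul h1 (a := (Module.finrank ℝ E : ℝ≥0∞))
      (Or.inr (ENNReal.natCast_ne_top _))
    simpa [div_eq_mul_inv, Function.comp_def] using h2
  exact h0 (le_antisymm (ge_of_tendsto' hlim hle) bot_le)

theorem sard_rank_zero (F : Type) [NormedAddCommGroup F] [NormedSpace ℝ F]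
    [FiniteDimensional ℝ F] (d : ℕ) : SardRankZero F d := by
  induction d with
  | zero =>
    intro E _ _ _ hd V hV Φ hΦ P hP hcrit
    have : Subsingleton E := Module.finrank_zero_iff.1 hd
    exact dimH_subsingleton ((Set.subsingleton_of_subsingleton (s := P)).image Φ)
  | succ d ih =>
    intro E _ _ _ hd V hV Φ hΦ P hP hcrit
    let S : ℕ → Set E := fun k => {p | p ∈ P ∧ iteratedFDeriv ℝ (k + 1) Φ p = 0 ∧
      iteratedFDeriv ℝ (k + 2) Φ p ≠ 0}
    let S' : Set E := {p | p ∈ P ∧ ∀ k, 1 ≤ k → iteratedFDeriv ℝ k Φ p = 0}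
    have hcov : P ⊆ S' ∪ ⋃ k, S k := by
      intro p hp
      by_cases hf : ∀ k, 1 ≤ k → iteratedFDeriv ℝ k Φ p = 0
      · exact Or.inl ⟨hp, hf⟩
      · right
        by_contra hcon
        simp only [mem_iUnion, S, mem_ofPred_eq, not_exists, not_and, not_not] at hcon
        refine hf fun k hk => ?_
        induction k, hk using Nat.le_induction with
        | base =>
          rw [← norm_eq_zero, norm_iteratedFDeriv_one, hcrit p hp, norm_zero]
        | succ k hk ihk =>
          obtain ⟨j, rfl⟩ := Nat.exists_eq_add_of_le' hk
          exact hcon j hp ihk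
    have hS' : dimH (Φ '' S') = 0 :=
      dimH_image_flat hV hΦ (fun p hp => hP hp.1) fun p hp => hp.2
    have hS : ∀ k, dimH (Φ '' S k) = 0 := by
      intro k
      refine dimH_image_eq_zero_of_locally ?_
      rintro p ⟨hp, hp0, hp1⟩
      have hcd := fun x (hx : x ∈ V) => contDiffAt_iteratedFDeriv hV hΦ (k + 1) hx
      have hf1 : fderiv ℝ (iteratedFDeriv ℝ (k + 1) Φ) p ≠ 0 := by
        intro h0
        have h1 := norm_fderiv_iteratedFDeriv (𝕜 := ℝ) (f := Φ) (n := k + 1) (x := p)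
        exact hp1 (norm_eq_zero.1 (h1.symm.trans ((congrArg norm h0).trans
          ContinuousLinearMap.opNorm_zero)))
      obtain ⟨e, he⟩ := ContinuousLinearMap.exists_ne_zero hf1
      obtain ⟨m, hm⟩ : ∃ m, fderiv ℝ (iteratedFDeriv ℝ (k + 1) Φ) p e m ≠ 0 := by
        by_contra hcon
        push Not at hcon
        exact he (ContinuousMultilinearMap.ext hcon)
      obtain ⟨φ, hφ⟩ := SeparatingDual.exists_ne_zero (R := ℝ) hm
      let A : (E [×(k + 1)]→L[ℝ] F) →L[ℝ] ℝ :=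
        φ.comp (ContinuousMultilinearMap.apply ℝ (fun _ : Fin (k + 1) => E) F m)
      let h : E → ℝ := fun x => A (iteratedFDeriv ℝ (k + 1) Φ x)
      refine dimH_image_hypersurface ih hd hV hΦ (h := h) ?_ ?_ ?_ (hP hp) ?_
      · exact fun x hx => (A.contDiff.contDiffAt.comp x (hcd x hx)).contDiffWithinAt
      · rintro q ⟨-, hq, -⟩
        simp [h, hq]
      · rintro q ⟨hq, -⟩ v -
        simp [hcrit q hq]
      · have : HasFDerivAt h (A.comp (fderiv ℝ (iteratedFDeriv ℝ (k + 1) Φ) p)) p :=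
          A.hasFDerivAt.comp p ((hcd p (hP hp)).differentiableAt (by simp)).hasFDerivAt
        rw [this.fderiv]
        intro h0
        exact hφ (congrArg (fun B : E →L[ℝ] ℝ => B e) h0)
    refine le_antisymm ((dimH_mono (image_mono hcov)).trans (le_of_eq ?_)) bot_le
    rw [image_union, image_iUnion, dimH_union, dimH_iUnion, hS']
    simp [hS]

/-- One-dimensional second derivative test at a local minimum. -/
theorem second_deriv_nonneg_of_isLocalMin {φ φ' : ℝ → ℝ} {x c : ℝ}
    (h1 : ∀ᶠ s in 𝓝 x, HasDerivAt φ (φ' s) s) (h2 : HasDerivAt φ' c x)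
    (hmin : IsLocalMin φ x) : 0 ≤ c := by
  by_contra hc
  push Not at hc
  have h0 : φ' x = 0 := hmin.hasDerivAt_eq_zero h1.self_of_nhds
  have hlt : ∀ᶠ s in 𝓝[>] x, φ' s < 0 := by
    have := (hasDerivAt_iff_tendsto_slope.1 h2).eventually_lt_const hc
    have h3 : ∀ᶠ s in 𝓝[>] x, slope φ' x s < 0 := this.filter_mono
      (nhdsWithin_mono _ fun y hy => ne_of_gt hy)
    filter_upwards [h3, self_mem_nhdsWithin] with s hs hxs
    rw [slope_def_field, h0, sub_zero] at hs
    exact (div_neg_iff.1 hs).elim (fun h => absurd h.2 (by simpa using (le_of_lt hxs)))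
      fun h => h.1
  obtain ⟨b, hb, hbs⟩ := (mem_nhdsGT_iff_exists_Ioo_subset).1 hlt
  obtain ⟨r, hr, hrs⟩ := Metric.eventually_nhds_iff_ball.1 (h1.and hmin)
  set y := x + min (r / 2) ((b - x) / 2) with hy
  have hxb : x < b := hb
  have hpos : 0 < min (r / 2) ((b - x) / 2) := lt_min (by linarith) (by linarith)
  have hyb : y < b := by have := min_le_right (r / 2) ((b - x) / 2); linarith
  have hyr : y < x + r := by have := min_le_left (r / 2) ((b - x) / 2); linarith
  have hxy : x < y := by linarith
  have hin : ∀ s ∈ Icc x y, s ∈ Metric.ball x r := fun s hs => by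
    rw [Metric.mem_ball, Real.dist_eq, abs_lt]; constructor <;> linarith [hs.1, hs.2]
  obtain ⟨s, hs, hs'⟩ := exists_hasDerivAt_eq_slope φ φ' hxy
    (fun s hs => ((hrs s (hin s hs)).1).continuousAt.continuousWithinAt)
    (fun s hs => (hrs s (hin s (Ioo_subset_Icc_self hs))).1)
  have h4 : φ' s < 0 := hbs ⟨hs.1, hs.2.trans hyb⟩
  have h5 := (hrs y (hin y ⟨hxy.le, le_rfl⟩)).2
  rw [hs'] at h4
  have : 0 ≤ (φ y - φ x) / (y - x) := div_nonneg (by linarith) (by linarith)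
  linarith

/-- Directional derivative. -/
def pd {E F : Type} [NormedAddCommGroup E] [NormedSpace ℝ E] [NormedAddCommGroup F]
    [NormedSpace ℝ F] (e : E) (u : E → F) : E → F := fun p => fderiv ℝ u p e

theorem hasDerivAt_line {E F : Type} [NormedAddCommGroup E] [NormedSpace ℝ E]
    [NormedAddCommGroup F] [NormedSpace ℝ F] {u : E → F} {q e : E} {s : ℝ}
    (h : DifferentiableAt ℝ u (q + s • e)) :
    HasDerivAt (fun t : ℝ => u (q + t • e)) (pd e u (q + s • e)) s := by
  have h1 : HasDerivAt (fun t : ℝ => q + t • e) e s := by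
    simpa using ((hasDerivAt_id s).smul_const e).const_add q
  exact h.hasFDerivAt.comp_hasDerivAt s h1

theorem contDiffAt_pd {E F : Type} [NormedAddCommGroup E] [NormedSpace ℝ E]
    [NormedAddCommGroup F] [NormedSpace ℝ F] {u : E → F} {p : E} (e : E) {m n : WithTop ℕ∞}
    (h : ContDiffAt ℝ n u p) (hmn : m + 1 ≤ n) : ContDiffAt ℝ m (pd e u) p :=
  (h.fderiv_right hmn).clm_apply contDiffAt_const

theorem contDiffOn_pd {E F : Type} [NormedAddCommGroup E] [NormedSpace ℝ E]
    [NormedAddCommGroup F] [NormedSpace ℝ F] {u : E → F} {V : Set E} (hV : IsOpen V) (e : E)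
    {m n : WithTop ℕ∞} (h : ContDiffOn ℝ n u V) (hmn : m + 1 ≤ n) : ContDiffOn ℝ m (pd e u) V :=
  fun _ hp => (contDiffAt_pd e (h.contDiffAt (hV.mem_nhds hp)) hmn).contDiffWithinAt

theorem eventually_hasDerivAt_line {E : Type} [NormedAddCommGroup E] [NormedSpace ℝ E]
    {u : E → ℝ} {V : Set E} (hV : IsOpen V) (hu : ContDiffOn ℝ 2 u V) {q e : E} (hq : q ∈ V) :
    (∀ᶠ s : ℝ in 𝓝 0, HasDerivAt (fun t : ℝ => u (q + t • e)) (pd e u (q + s • e)) s) ∧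
      HasDerivAt (fun t : ℝ => pd e u (q + t • e)) (pd e (pd e u) q) 0 := by
  constructor
  · have hc : Tendsto (fun s : ℝ => q + s • e) (𝓝 0) (𝓝 q) := by
      have : Continuous fun s : ℝ => q + s • e := by fun_prop
      simpa using this.tendsto 0
    filter_upwards [hc (hV.mem_nhds hq)] with s hs
    exact hasDerivAt_line ((hu.contDiffAt (hV.mem_nhds hs)).differentiableAt (by simp))
  · have h := hasDerivAt_line (u := pd e u) (q := q) (e := e) (s := 0) (by
      simpa using (contDiffAt_pd (m := 1) e (hu.contDiffAt (hV.mem_nhds hq))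
        (by norm_num [one_add_one_eq_two])).differentiableAt (by simp))
    simpa using h

theorem slice_second_deriv_le {E : Type} [NormedAddCommGroup E] [NormedSpace ℝ E]
    {u : E → ℝ} {V : Set E} (hV : IsOpen V) (hu : ContDiffOn ℝ 2 u V) {q₁ q₂ e₁ e₂ : E}
    (hq₁ : q₁ ∈ V) (hq₂ : q₂ ∈ V) {a b c : ℝ}
    (hmin : IsLocalMin (fun s : ℝ => (a + b * s + c * s ^ 2) -
      (u (q₁ + s • e₁) - u (q₂ + s • e₂)) / 2) 0) :
    (pd e₁ (pd e₁ u) q₁ - pd e₂ (pd e₂ u) q₂) / 2 ≤ 2 * c := by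
  obtain ⟨h1, h1'⟩ := eventually_hasDerivAt_line hV hu (e := e₁) hq₁
  obtain ⟨h2, h2'⟩ := eventually_hasDerivAt_line hV hu (e := e₂) hq₂
  have h3 : ∀ s : ℝ, HasDerivAt (fun s : ℝ => a + b * s + c * s ^ 2) (b + 2 * c * s) s := by
    intro s
    have := (((hasDerivAt_id' s).const_mul b).const_add a).add
      (((hasDerivAt_id' s).fun_pow 2).const_mul c)
    exact this.congr_deriv (by norm_num; ring)
  have h4 : HasDerivAt (fun s : ℝ => b + 2 * c * s) (2 * c) 0 := by
    simpa using (((hasDerivAt_id (0 : ℝ)).const_mul (2 * c)).const_add b)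
  have := second_deriv_nonneg_of_isLocalMin
    (φ' := fun s => (b + 2 * c * s) - (pd e₁ u (q₁ + s • e₁) - pd e₂ u (q₂ + s • e₂)) / 2)
    (h1.mp (h2.mono fun s h2 h1 => (h3 s).sub ((h1.sub h2).div_const 2)))
    (h4.sub ((h1'.sub h2').div_const 2)) hmin
  linarith

/-- The `i`-th horizontal unit vector of `ℝ^N × ℝ`. -/
def eb {N : ℕ} (i : Fin N) : Euc N × ℝ := (EuclideanSpace.single i 1, 0)

/-- The vertical unit vector of `ℝ^N × ℝ`. -/
def ez {N : ℕ} : Euc N × ℝ := (0, 1)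

/-- `C²` solutions of `a(z) ∂²_z u + Δ_x u = 0` on `V`. -/
structure Sol {N : ℕ} (a : ℝ → ℝ) (V : Set (Euc N × ℝ)) (u : Euc N × ℝ → ℝ) : Prop where
  contDiffOn : ContDiffOn ℝ 2 u V
  eqn : ∀ p ∈ V, a p.2 * pd ez (pd ez u) p + ∑ i, pd (eb i) (pd (eb i) u) p = 0

theorem pd_neg_pd_neg {E : Type} [NormedAddCommGroup E] [NormedSpace ℝ E] (e : E) (u : E → ℝ)
    (q : E) : pd (-e) (pd (-e) u) q = pd e (pd e u) q := by
  have : pd (-e) u = fun p => -pd e u p := by funext p; simp [pd]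
  rw [this]
  simp [pd]
  rfl

theorem norm_add_smul_single_sub_sq {N : ℕ} (x y : Euc N) (i : Fin N) (s : ℝ) :
    ‖x + s • EuclideanSpace.single i (1 : ℝ) - y‖ ^ 2 = ‖x - y‖ ^ 2 + 2 * (x i - y i) * s + s ^ 2 := by
  have : x + s • EuclideanSpace.single i (1 : ℝ) - y =
      (x - y) + s • EuclideanSpace.single i (1 : ℝ) := by abel
  rw [this, norm_add_sq_real, norm_smul, inner_smul_right]
  simp [EuclideanSpace.inner_single_right]
  ring

/-- Comparison of the symmetric difference of a solution with a quadratic barrier. -/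
theorem Sol.symm_diff_le {N : ℕ} {a : ℝ → ℝ} {V : Set (Euc N × ℝ)} (hV : IsOpen V)
    {u : Euc N × ℝ → ℝ} (hu : Sol a V u) {p₀ : Euc N × ℝ} {ρ M Λ : ℝ} (hρ : 0 < ρ) (hM : 0 < M)
    (hball : Metric.closedBall p₀ (2 * ρ) ⊆ V) (hb : ∀ p ∈ Metric.closedBall p₀ (2 * ρ), |u p| ≤ M)
    (ha : ∀ p ∈ Metric.closedBall p₀ (2 * ρ), 0 ≤ a p.2 ∧ a p.2 ≤ Λ) (j : Fin N)
    {τ : ℝ} (hτ : τ ∈ Icc 0 ρ) :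
    (u (p₀ + τ • eb j) - u (p₀ - τ • eb j)) / 2 ≤
      M / ρ ^ 2 * ((2 * Λ + 2 * N) * (2 * ρ * τ - τ ^ 2)) := by
  set κ : ℝ := 2 * Λ + 2 * N with hκ
  set c := M / ρ ^ 2 with hc
  have hcpos : 0 < c := by positivity
  have hN : (1 : ℝ) ≤ N := by
    have : 0 < N := j.pos
    exact_mod_cast this
  have hΛ : 0 ≤ Λ := by
    have := ha p₀ (Metric.mem_closedBall_self (by positivity)); linarith
  have hκ1 : 1 ≤ κ := by linarith
  have hshift : ∀ p ∈ Metric.closedBall p₀ ρ, ∀ t : ℝ, |t| ≤ ρ →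
      p + t • eb j ∈ Metric.closedBall p₀ (2 * ρ) := by
    intro p hp t ht
    rw [mem_closedBall_iff_norm] at hp ⊢
    have h1 : ‖t • (eb j : Euc N × ℝ)‖ ≤ ρ := by
      rw [norm_smul]; simpa [eb, Prod.norm_def] using ht
    calc ‖p + t • eb j - p₀‖ = ‖(p - p₀) + t • eb j‖ := by congr 1; abel
      _ ≤ ‖p - p₀‖ + ‖t • (eb j : Euc N × ℝ)‖ := norm_add_le _ _
      _ ≤ 2 * ρ := by linarith
  have hcont := hu.contDiffOn.continuousOn
  let B : (Euc N × ℝ) × ℝ → ℝ := fun P =>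
    c * (‖P.1.1 - p₀.1‖ ^ 2 + (P.1.2 - p₀.2) ^ 2 + κ * (2 * ρ * P.2 - P.2 ^ 2))
  let D : (Euc N × ℝ) × ℝ → ℝ := fun P =>
    B P - (u (P.1 + P.2 • eb j) - u (P.1 + (-P.2) • eb j)) / 2
  let K : Set ((Euc N × ℝ) × ℝ) := Metric.closedBall p₀ ρ ×ˢ Icc 0 ρ
  have habs : ∀ t ∈ Icc 0 ρ, |t| ≤ ρ ∧ |-t| ≤ ρ := fun t ht => by
    rw [abs_neg, abs_of_nonneg ht.1]; exact ⟨ht.2, ht.2⟩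
  have hDc : ContinuousOn D K := by
    have hBc : Continuous B := by fun_prop
    refine hBc.continuousOn.sub ((ContinuousOn.sub ?_ ?_).div_const 2)
    · exact hcont.comp (by fun_prop) fun P hP => hball (hshift _ hP.1 _ (habs _ hP.2).1)
    · exact hcont.comp (by fun_prop) fun P hP => hball (hshift _ hP.1 _ (habs _ hP.2).2)
  have hKc : IsCompact K := (isCompact_closedBall p₀ ρ).prod isCompact_Icc
  have hτK : (p₀, τ) ∈ K := ⟨Metric.mem_closedBall_self hρ.le, hτ⟩
  obtain ⟨⟨p, t⟩, hPK, hPmin⟩ := hKc.exists_isMinOn ⟨_, hτK⟩ hDc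
  have hmain : 0 ≤ D (p, t) := by
    by_contra hneg
    push Not at hneg
    have hp := hPK.1
    have ht : t ∈ Icc 0 ρ := hPK.2
    have hv : (u (p + t • eb j) - u (p + (-t) • eb j)) / 2 ≤ M := by
      have h1 := (abs_le.1 (hb _ (hshift p hp _ (habs _ ht).1))).2
      have h2 := (abs_le.1 (hb _ (hshift p hp _ (habs _ ht).2))).1
      linarith
    have hBlt : B (p, t) < M := by
      have : D (p, t) = B (p, t) - (u (p + t • eb j) - u (p + (-t) • eb j)) / 2 := rfl
      linarith
    have hcM : c * ρ ^ 2 = M := by rw [hc]; field_simp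
    have hBlt' : ‖p.1 - p₀.1‖ ^ 2 + (p.2 - p₀.2) ^ 2 + κ * (2 * ρ * t - t ^ 2) < ρ ^ 2 := by
      have h : c * (‖p.1 - p₀.1‖ ^ 2 + (p.2 - p₀.2) ^ 2 + κ * (2 * ρ * t - t ^ 2)) < c * ρ ^ 2 := by
        rw [hcM]; exact hBlt
      exact lt_of_mul_lt_mul_left h hcpos.le
    have htt : 0 ≤ 2 * ρ * t - t ^ 2 := by nlinarith [ht.1, ht.2]
    have hκtt : 2 * ρ * t - t ^ 2 ≤ κ * (2 * ρ * t - t ^ 2) := le_mul_of_one_le_left htt hκ1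
    have hx : ‖p.1 - p₀.1‖ < ρ := lt_of_pow_lt_pow_left₀ 2 hρ.le (by nlinarith [sq_nonneg (p.2 - p₀.2)])
    have hz : |p.2 - p₀.2| < ρ := by
      refine abs_lt_of_sq_lt_sq ?_ hρ.le
      nlinarith [sq_nonneg ‖p.1 - p₀.1‖]
    have htρ : t < ρ := by
      rcases ht.2.lt_or_eq with h | h
      · exact h
      · subst h; nlinarith [sq_nonneg ‖p.1 - p₀.1‖, sq_nonneg (p.2 - p₀.2)]
    have ht0 : 0 < t := by
      rcases ht.1.lt_or_eq with h | h
      · exact h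
      · exfalso
        subst h
        have h0 : D (p, 0) = c * (‖p.1 - p₀.1‖ ^ 2 + (p.2 - p₀.2) ^ 2) := by
          simp [D, B]
        rw [h0] at hneg
        exact absurd hneg (not_lt.2 (by positivity))
    have hpb : p ∈ Metric.ball p₀ ρ := by
      rw [mem_ball_iff_norm, Prod.norm_def]
      exact max_lt hx hz
    have hKn : K ∈ 𝓝 (p, t) := prod_mem_nhds
      (mem_of_superset (Metric.isOpen_ball.mem_nhds hpb) Metric.ball_subset_closedBall)
      (Icc_mem_nhds ht0 htρ)
    have hloc : IsLocalMin D (p, t) := hPmin.isLocalMin hKn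
    have hq₁ := hshift p hp _ (habs _ ht).1
    have hq₂ := hshift p hp _ (habs _ ht).2
    set q₁ := p + t • eb j with hq₁'
    set q₂ := p + (-t) • eb j with hq₂'
    have hslice : ∀ e : Euc N × ℝ, IsLocalMin (fun s : ℝ => D (p + s • e, t)) 0 := by
      intro e
      have hcts : Continuous fun s : ℝ => ((p + s • e, t) : (Euc N × ℝ) × ℝ) := by fun_prop
      have h0 : ((p + (0 : ℝ) • e, t) : (Euc N × ℝ) × ℝ) = (p, t) := by simp
      have := hcts.tendsto 0
      rw [h0] at this
      have h2 := this.eventually hloc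
      filter_upwards [h2] with s hs
      rw [h0]; exact hs
    have hi : ∀ i, (pd (eb i) (pd (eb i) u) q₁ - pd (eb i) (pd (eb i) u) q₂) / 2 ≤ 2 * c := by
      intro i
      refine slice_second_deriv_le hV hu.contDiffOn (hball hq₁) (hball hq₂)
        (a := B (p, t)) (b := 2 * c * (p.1 i - p₀.1 i)) ?_
      convert hslice (eb i) using 2 with s
      have h1 : p + s • eb i + t • eb j = q₁ + s • eb i := by rw [hq₁']; abel
      have h2 : p + s • eb i + (-t) • eb j = q₂ + s • eb i := by rw [hq₂']; abel
      simp only [D, B]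
      rw [h1, h2]
      have h3 := norm_add_smul_single_sub_sq p.1 p₀.1 i s
      simp only [eb, Prod.fst_add, Prod.smul_fst, Prod.snd_add, Prod.smul_snd, smul_zero,
        add_zero] at h3 ⊢
      rw [h3]; ring
    have hzz : (pd ez (pd ez u) q₁ - pd ez (pd ez u) q₂) / 2 ≤ 2 * c := by
      refine slice_second_deriv_le hV hu.contDiffOn (hball hq₁) (hball hq₂)
        (a := B (p, t)) (b := 2 * c * (p.2 - p₀.2)) ?_
      convert hslice ez using 2 with s
      have h1 : p + s • ez + t • eb j = q₁ + s • ez := by rw [hq₁']; abel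
      have h2 : p + s • ez + (-t) • eb j = q₂ + s • ez := by rw [hq₂']; abel
      simp only [D, B]
      rw [h1, h2]
      simp only [ez, Prod.fst_add, Prod.smul_fst, Prod.snd_add, Prod.smul_snd, smul_zero,
        add_zero, smul_eq_mul, mul_one]
      ring
    have htau : (pd (eb j) (pd (eb j) u) q₁ - pd (eb j) (pd (eb j) u) q₂) / 2 ≤ 2 * (-c * κ) := by
      rw [← pd_neg_pd_neg (eb j) u q₂]
      refine slice_second_deriv_le hV hu.contDiffOn (hball hq₁) (hball hq₂)
        (a := B (p, t)) (b := c * κ * (2 * ρ - 2 * t)) ?_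
      have hcts : Continuous fun s : ℝ => ((p, t + s) : (Euc N × ℝ) × ℝ) := by fun_prop
      have h0 : ((p, t + 0) : (Euc N × ℝ) × ℝ) = (p, t) := by simp
      have := hcts.tendsto 0
      rw [h0] at this
      have h2 : IsLocalMin (fun s : ℝ => D (p, t + s)) 0 := by
        filter_upwards [this.eventually hloc] with s hs
        rw [h0]; exact hs
      convert h2 using 2 with s
      have h1 : p + (t + s) • eb j = q₁ + s • eb j := by rw [hq₁', add_smul]; abel
      have h2 : p + (-(t + s)) • eb j = q₂ + s • (-eb j) := by
        rw [hq₂', smul_neg, neg_add, add_smul, neg_smul s]; abel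
      simp only [D, B]
      rw [h1, h2]
      ring
    have e1 := hu.eqn q₁ (hball hq₁)
    have e2 := hu.eqn q₂ (hball hq₂)
    have hsum := Finset.sum_le_sum fun i (_ : i ∈ Finset.univ.erase j) => hi i
    have hs1 := Finset.add_sum_erase Finset.univ (fun i => pd (eb i) (pd (eb i) u) q₁)
      (Finset.mem_univ j)
    have hs2 := Finset.add_sum_erase Finset.univ (fun i => pd (eb i) (pd (eb i) u) q₂)
      (Finset.mem_univ j)
    rw [← Finset.sum_div, Finset.sum_sub_distrib, Finset.sum_const,
      Finset.card_erase_of_mem (Finset.mem_univ j), Finset.card_univ, Fintype.card_fin,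
      nsmul_eq_mul, Nat.cast_sub (by exact_mod_cast hN)] at hsum
    have hq12 : q₁.2 = p.2 ∧ q₂.2 = p.2 := by simp [hq₁', hq₂', eb]
    rw [hq12.1] at e1
    rw [hq12.2] at e2
    have hap := ha p (Metric.closedBall_subset_closedBall (by linarith) hp)
    have hazz := mul_le_mul_of_nonneg_left hzz hap.1
    have hj := hi j
    have hΛc : a p.2 * (2 * c) ≤ Λ * (2 * c) := mul_le_mul_of_nonneg_right hap.2 (by positivity)
    push_cast at hsum
    have hcκ : c * κ = c * (2 * Λ) + c * (2 * N) := by rw [hκ]; ring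
    nlinarith
  have h1 : D (p, t) ≤ D (p₀, τ) := hPmin hτK
  have h2 : D (p₀, τ) = c * (κ * (2 * ρ * τ - τ ^ 2)) -
      (u (p₀ + τ • eb j) - u (p₀ - τ • eb j)) / 2 := by
    simp [D, B, sub_eq_add_neg]
  linarith

theorem hasDerivAt_nonneg_of_eventually_ge {f : ℝ → ℝ} {f' x : ℝ} (h : HasDerivAt f f' x)
    (hf : ∀ᶠ y in 𝓝[>] x, f x ≤ f y) : 0 ≤ f' := by
  have h1 : Tendsto (slope f x) (𝓝[>] x) (𝓝 f') :=
    (hasDerivAt_iff_tendsto_slope.1 h).mono_left (nhdsWithin_mono _ fun y hy => ne_of_gt hy)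
  refine ge_of_tendsto h1 ?_
  filter_upwards [hf, self_mem_nhdsWithin] with y hy hxy
  rw [slope_def_field]
  have : x < y := hxy
  exact div_nonneg (by linarith) (by linarith)

theorem Sol.neg {N : ℕ} {a : ℝ → ℝ} {V : Set (Euc N × ℝ)} {u : Euc N × ℝ → ℝ} (hu : Sol a V u) :
    Sol a V (-u) := by
  have h : ∀ e (v : Euc N × ℝ → ℝ), pd e (-v) = -pd e v := fun e v => by
    funext p; simp [pd, fderiv_neg]
  refine ⟨hu.contDiffOn.neg, fun p hp => ?_⟩
  have := hu.eqn p hp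
  simp only [h, Pi.neg_apply, Finset.sum_neg_distrib]
  linarith

/-- Interior gradient bound in the horizontal directions. -/
theorem Sol.abs_pd_le {N : ℕ} {a : ℝ → ℝ} {V : Set (Euc N × ℝ)} (hV : IsOpen V)
    {u : Euc N × ℝ → ℝ} (hu : Sol a V u) {p₀ : Euc N × ℝ} {ρ M Λ : ℝ} (hρ : 0 < ρ)
    (hball : Metric.closedBall p₀ (2 * ρ) ⊆ V) (hb : ∀ p ∈ Metric.closedBall p₀ (2 * ρ), |u p| ≤ M)
    (ha : ∀ p ∈ Metric.closedBall p₀ (2 * ρ), 0 ≤ a p.2 ∧ a p.2 ≤ Λ) (j : Fin N) :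
    |pd (eb j) u p₀| ≤ 4 * (Λ + N) / ρ * M := by
  have hp₀ : p₀ ∈ Metric.closedBall p₀ (2 * ρ) := Metric.mem_closedBall_self (by positivity)
  have key : ∀ u : Euc N × ℝ → ℝ, Sol a V u → ∀ M, 0 < M →
      (∀ p ∈ Metric.closedBall p₀ (2 * ρ), |u p| ≤ M) → pd (eb j) u p₀ ≤ 4 * (Λ + N) / ρ * M := by
    intro u hu M hM hb
    have hd : DifferentiableAt ℝ u p₀ :=
      (hu.contDiffOn.contDiffAt (hV.mem_nhds (hball hp₀))).differentiableAt (by simp)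
    have h1 : HasDerivAt (fun t : ℝ => u (p₀ + t • eb j)) (pd (eb j) u p₀) 0 := by
      simpa using hasDerivAt_line (q := p₀) (e := eb j) (s := 0) (by simpa using hd)
    have h2 : HasDerivAt (fun t : ℝ => u (p₀ - t • eb j)) (-pd (eb j) u p₀) 0 := by
      have := hasDerivAt_line (q := p₀) (e := -eb j) (s := 0) (by simpa using hd)
      simp only [zero_smul, smul_neg, ← sub_eq_add_neg] at this
      exact this.congr_deriv (by simp [pd])
    have h3 : HasDerivAt (fun t : ℝ => M / ρ ^ 2 * ((2 * Λ + 2 * N) * (2 * ρ * t - t ^ 2)))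
        (M / ρ ^ 2 * ((2 * Λ + 2 * N) * (2 * ρ))) 0 := by
      have := ((((hasDerivAt_id' (0 : ℝ)).const_mul (2 * ρ)).sub
        ((hasDerivAt_id' (0 : ℝ)).fun_pow 2)).const_mul (2 * Λ + 2 * (N : ℝ))).const_mul (M / ρ ^ 2)
      exact this.congr_deriv (by norm_num)
    have h4 := hasDerivAt_nonneg_of_eventually_ge (h3.sub ((h1.sub h2).div_const 2)) (by
      filter_upwards [Ioc_mem_nhdsGT hρ] with t ht
      have := hu.symm_diff_le hV hρ hM hball hb ha j ⟨ht.1.le, ht.2⟩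
      simpa using this)
    have h5 : M / ρ ^ 2 * ((2 * Λ + 2 * N) * (2 * ρ)) = 4 * (Λ + N) / ρ * M := by
      field_simp; ring
    linarith
  have key' : ∀ M', M < M' → |pd (eb j) u p₀| ≤ 4 * (Λ + N) / ρ * M' := by
    intro M' hM'
    have hM0 : 0 < M' := ((abs_nonneg _).trans (hb p₀ hp₀)).trans_lt hM'
    have h1 := key u hu M' hM0 fun p hp => (hb p hp).trans hM'.le
    have h2 := key (-u) hu.neg M' hM0 fun p hp => by
      rw [Pi.neg_apply, abs_neg]; exact (hb p hp).trans hM'.le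
    have h3 : pd (eb j) (-u) p₀ = -pd (eb j) u p₀ := by simp [pd, fderiv_neg]
    rw [abs_le]
    constructor <;> linarith
  have hcont : Tendsto (fun M' => 4 * (Λ + N) / ρ * M') (𝓝[>] M) (𝓝 (4 * (Λ + N) / ρ * M)) :=
    ((continuous_const.mul continuous_id).tendsto M).mono_left nhdsWithin_le_nhds
  exact ge_of_tendsto hcont (by filter_upwards [self_mem_nhdsWithin] with M' h using key' M' h)

theorem Sol.mono {N : ℕ} {a : ℝ → ℝ} {V V' : Set (Euc N × ℝ)} {u : Euc N × ℝ → ℝ}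
    (hu : Sol a V u) (h : V' ⊆ V) : Sol a V' u :=
  ⟨hu.contDiffOn.mono h, fun p hp => hu.eqn p (h hp)⟩

theorem pd_comp_add {E F : Type} [NormedAddCommGroup E] [NormedSpace ℝ E]
    [NormedAddCommGroup F] [NormedSpace ℝ F] (e : E) (u : E → F) (y : E) :
    pd e (fun p => u (p + y)) = fun p => pd e u (p + y) := by
  funext p
  simp [pd, fderiv_comp_add_right]

theorem Sol.comp_add {N : ℕ} {a : ℝ → ℝ} {V : Set (Euc N × ℝ)} {u : Euc N × ℝ → ℝ}
    (hu : Sol a V u) {y : Euc N × ℝ} (hy : y.2 = 0) :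
    Sol a ((fun p => p + y) ⁻¹' V) (fun p => u (p + y)) := by
  refine ⟨hu.contDiffOn.comp (by fun_prop) fun p hp => hp, fun p hp => ?_⟩
  have := hu.eqn (p + y) hp
  simp only [pd_comp_add]
  simpa [hy] using this

theorem pd_sub_of_differentiableAt {E : Type} [NormedAddCommGroup E] [NormedSpace ℝ E]
    {u v : E → ℝ} {p : E} (e : E) (hu : DifferentiableAt ℝ u p) (hv : DifferentiableAt ℝ v p) :
    pd e (fun q => u q - v q) p = pd e u p - pd e v p := by
  simp [pd, fderiv_fun_sub hu hv]

theorem pd_pd_sub {E : Type} [NormedAddCommGroup E] [NormedSpace ℝ E] {V : Set E} (hV : IsOpen V)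
    {u v : E → ℝ} (hu : ContDiffOn ℝ 2 u V) (hv : ContDiffOn ℝ 2 v V) {p : E} (hp : p ∈ V)
    (e e' : E) :
    pd e' (pd e (fun q => u q - v q)) p = pd e' (pd e u) p - pd e' (pd e v) p := by
  have h1 : ∀ w : E → ℝ, ContDiffOn ℝ 2 w V → ∀ q ∈ V, DifferentiableAt ℝ w q ∧
      DifferentiableAt ℝ (pd e w) q := fun w hw q hq => by
    have h := hw.contDiffAt (hV.mem_nhds hq)
    exact ⟨h.differentiableAt (by simp), (contDiffAt_pd (m := 1) e h
      (by norm_num [one_add_one_eq_two])).differentiableAt (by simp)⟩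
  have h2 : pd e (fun q => u q - v q) =ᶠ[𝓝 p] fun q => pd e u q - pd e v q := by
    filter_upwards [hV.mem_nhds hp] with q hq
    exact pd_sub_of_differentiableAt e (h1 u hu q hq).1 (h1 v hv q hq).1
  have h3 : pd e' (pd e (fun q => u q - v q)) p = pd e' (fun q => pd e u q - pd e v q) p := by
    simp only [pd] at h2 ⊢
    rw [h2.fderiv_eq]
  rw [h3, pd_sub_of_differentiableAt e' (h1 u hu p hp).2 (h1 v hv p hp).2]

theorem Sol.sub {N : ℕ} {a : ℝ → ℝ} {V : Set (Euc N × ℝ)} (hV : IsOpen V)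
    {u v : Euc N × ℝ → ℝ} (hu : Sol a V u) (hv : Sol a V v) :
    Sol a V (fun p => u p - v p) := by
  refine ⟨hu.contDiffOn.sub hv.contDiffOn, fun p hp => ?_⟩
  have h1 := hu.eqn p hp
  have h2 := hv.eqn p hp
  simp only [pd_pd_sub hV hu.contDiffOn hv.contDiffOn hp, Finset.sum_sub_distrib]
  linarith

theorem pd_const_mul {E : Type} [NormedAddCommGroup E] [NormedSpace ℝ E] (c : ℝ) (e : E)
    (u : E → ℝ) : pd e (fun q => c * u q) = fun q => c * pd e u q := by
  funext p
  have : fderiv ℝ (fun q => c • u q) p = c • fderiv ℝ u p :=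
    congrFun (fderiv_const_smul_field (𝕜 := ℝ) (f := u) c) p
  simp only [smul_eq_mul] at this
  simp [pd, this]

theorem Sol.const_mul {N : ℕ} {a : ℝ → ℝ} {V : Set (Euc N × ℝ)}
    {u : Euc N × ℝ → ℝ} (hu : Sol a V u) (c : ℝ) :
    Sol a V (fun p => c * u p) := by
  refine ⟨contDiffOn_const.mul hu.contDiffOn, fun p hp => ?_⟩
  have h1 := hu.eqn p hp
  simp only [pd_const_mul, ← Finset.mul_sum]
  linear_combination c * h1

/-- The difference quotient in a direction `e`. -/
def dq {E : Type} [NormedAddCommGroup E] [NormedSpace ℝ E] (e : E) (h : ℝ) (u : E → ℝ) : E → ℝ :=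
  fun p => h⁻¹ * (u (p + h • e) - u p)

theorem Sol.dq {N : ℕ} {a : ℝ → ℝ} {V V' : Set (Euc N × ℝ)} (hV' : IsOpen V')
    {u : Euc N × ℝ → ℝ} (hu : Sol a V u) {j : Fin N} {h : ℝ} (h1 : V' ⊆ V)
    (h2 : ∀ p ∈ V', p + h • eb j ∈ V) : Sol a V' (dq (eb j) h u) := by
  have h3 : Sol a V' (fun p => u (p + h • eb j)) :=
    (hu.comp_add (y := h • eb j) (by simp [eb])).mono h2
  exact (h3.sub hV' (hu.mono h1)).const_mul h⁻¹

theorem pd_dq {E : Type} [NormedAddCommGroup E] [NormedSpace ℝ E] (e e' : E) (h : ℝ) {u : E → ℝ}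
    {p : E} (h1 : DifferentiableAt ℝ u p) (h2 : DifferentiableAt ℝ u (p + h • e)) :
    pd e' (dq e h u) p = dq e h (pd e' u) p := by
  unfold dq
  rw [pd_const_mul]
  beta_reduce
  rw [pd_sub_of_differentiableAt e' _ h1, pd_comp_add]
  exact (differentiableAt_comp_add_right _).2 h2

theorem tendsto_dq {E : Type} [NormedAddCommGroup E] [NormedSpace ℝ E] (e : E) {u : E → ℝ}
    {p : E} (h1 : DifferentiableAt ℝ u p) :
    Tendsto (fun h => dq e h u p) (𝓝[≠] 0) (𝓝 (pd e u p)) := by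
  have h := hasDerivAt_line (q := p) (e := e) (s := 0) (by simpa using h1)
  have := hasDerivAt_iff_tendsto_slope.1 h
  simp only [zero_smul, add_zero] at this
  refine this.congr fun t => ?_
  simp [slope_def_field, dq, div_eq_inv_mul]

/-- `T u` at the centre of a ball is controlled by the supremum of the solution `u`. -/
def CentreBound (N : ℕ) (a : ℝ → ℝ) (l Λ : ℝ)
    (T : (Euc N × ℝ → ℝ) → Euc N × ℝ → ℝ) : Prop :=
  ∀ R > 0, ∃ C, 0 ≤ C ∧ ∀ (p₀ : Euc N × ℝ) (u : Euc N × ℝ → ℝ) (M : ℝ),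
    Sol a (Metric.ball p₀ R) u → (∀ p ∈ Metric.ball p₀ R, l ≤ a p.2 ∧ a p.2 ≤ Λ) →
    (∀ p ∈ Metric.ball p₀ R, |u p| ≤ M) → |T u p₀| ≤ C * M

theorem centreBound_pd_eb {N : ℕ} {a : ℝ → ℝ} {l Λ : ℝ} (hl : 0 < l) (hΛ : l ≤ Λ) (j : Fin N) :
    CentreBound N a l Λ (pd (eb j)) := by
  intro R hR
  have hΛ0 : 0 < Λ := hl.trans_le hΛ
  refine ⟨4 * (Λ + N) / (R / 4), by positivity, fun p₀ u M hu ha hb => ?_⟩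
  have hsub : Metric.closedBall p₀ (2 * (R / 4)) ⊆ Metric.ball p₀ R :=
    Metric.closedBall_subset_ball (by linarith)
  exact hu.abs_pd_le Metric.isOpen_ball (by positivity) hsub (fun p hp => hb p (hsub hp))
    (fun p hp => ⟨hl.le.trans (ha p (hsub hp)).1, (ha p (hsub hp)).2⟩) j

theorem norm_smul_eb_le {N : ℕ} (j : Fin N) (t : ℝ) : ‖t • (eb j : Euc N × ℝ)‖ ≤ |t| := by
  rw [norm_smul]; simp [eb, Prod.norm_def]

theorem CentreBound.pd_eb_comp {N : ℕ} {a : ℝ → ℝ} {l Λ : ℝ} (hl : 0 < l) (hΛ : l ≤ Λ) (j : Fin N)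
    {e : Euc N × ℝ} (hT : CentreBound N a l Λ (pd e)) :
    CentreBound N a l Λ (fun u => pd (eb j) (pd e u)) := by
  intro R hR
  obtain ⟨C₁, hC₁, h1⟩ := centreBound_pd_eb (a := a) hl hΛ j (R / 4) (by positivity)
  obtain ⟨C₂, hC₂, h2⟩ := hT (R / 2) (by positivity)
  refine ⟨C₂ * C₁, by positivity, fun p₀ u M hu ha hb => ?_⟩
  have hsub : ∀ q ∈ Metric.ball p₀ (3 * R / 4), Metric.ball q (R / 4) ⊆ Metric.ball p₀ R := by
    intro q hq
    refine Metric.ball_subset_ball' ?_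
    rw [Metric.mem_ball] at hq; linarith
  have hpdj : ∀ q ∈ Metric.ball p₀ (3 * R / 4), |pd (eb j) u q| ≤ C₁ * M := fun q hq =>
    h1 q u M (hu.mono (hsub q hq)) (fun p hp => ha p (hsub q hq hp)) fun p hp => hb p (hsub q hq hp)
  have hsub2 : Metric.ball p₀ (R / 2) ⊆ Metric.ball p₀ R := Metric.ball_subset_ball (by linarith)
  have hsub3 : Metric.ball p₀ (3 * R / 4) ⊆ Metric.ball p₀ R := Metric.ball_subset_ball (by linarith)
  have hshift : ∀ p ∈ Metric.ball p₀ (R / 2), ∀ t : ℝ, |t| < R / 4 →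
      p + t • eb j ∈ Metric.ball p₀ (3 * R / 4) := by
    intro p hp t ht
    rw [mem_ball_iff_norm] at hp ⊢
    have h := norm_smul_eb_le j t
    calc ‖p + t • eb j - p₀‖ = ‖(p - p₀) + t • eb j‖ := by congr 1; abel
      _ ≤ ‖p - p₀‖ + ‖t • (eb j : Euc N × ℝ)‖ := norm_add_le _ _
      _ < 3 * R / 4 := by linarith
  have hdiff : ∀ q ∈ Metric.ball p₀ R, DifferentiableAt ℝ u q ∧ DifferentiableAt ℝ (pd e u) q := by
    intro q hq
    have h := hu.contDiffOn.contDiffAt (Metric.isOpen_ball.mem_nhds hq)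
    exact ⟨h.differentiableAt (by simp), (contDiffAt_pd (m := 1) e h
      (by norm_num [one_add_one_eq_two])).differentiableAt (by simp)⟩
  have hp₀ : p₀ ∈ Metric.ball p₀ (R / 2) := Metric.mem_ball_self (by positivity)
  have hbound : ∀ᶠ h in 𝓝[≠] (0 : ℝ), |dq (eb j) h (pd e u) p₀| ≤ C₂ * C₁ * M := by
    have hsmall : ∀ᶠ h in 𝓝[≠] (0 : ℝ), |h| < R / 4 := by
      refine nhdsWithin_le_nhds ?_
      exact (continuous_abs.tendsto' 0 0 abs_zero).eventually_lt_const (by positivity)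
    filter_upwards [hsmall, self_mem_nhdsWithin] with h hh hh0
    rw [← pd_dq _ _ _ (hdiff p₀ (hsub2 hp₀)).1 (hdiff _ (hsub3 (hshift _ hp₀ h hh))).1, mul_assoc]
    refine h2 p₀ _ _ (hu.dq Metric.isOpen_ball hsub2 fun p hp => hsub3 (hshift p hp h hh))
      (fun p hp => ha p (hsub2 hp)) fun p hp => ?_
    have hmv := (convex_segment (0 : ℝ) h).norm_image_sub_le_of_norm_hasDerivWithin_le
      (f := fun t : ℝ => u (p + t • eb j)) (f' := fun t => pd (eb j) u (p + t • eb j))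
      (C := C₁ * M) ?_ ?_ (left_mem_segment ℝ 0 h) (right_mem_segment ℝ 0 h)
    · simp only [zero_smul, add_zero, sub_zero, Real.norm_eq_abs] at hmv
      have hh0' : 0 < |h| := abs_pos.2 hh0
      rw [dq, abs_mul, abs_inv, inv_mul_le_iff₀ hh0', mul_comm |h|]
      exact hmv
    all_goals
      intro t ht
      have ht' : |t| < R / 4 := by
        rw [segment_eq_uIcc] at ht
        have := abs_sub_left_of_mem_uIcc ht
        simp only [sub_zero] at this
        exact this.trans_lt hh
    · exact (hasDerivAt_line (hdiff _ (hsub3 (hshift p hp t ht'))).1).hasDerivWithinAt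
    · exact hpdj _ (hshift p hp t ht')
  exact le_of_tendsto (tendsto_dq (eb j) (hdiff p₀ (hsub2 hp₀)).2).abs hbound

theorem centreBound_pd_ez_pd_ez {N : ℕ} {a : ℝ → ℝ} {l Λ : ℝ} (hl : 0 < l) (hΛ : l ≤ Λ) :
    CentreBound N a l Λ (fun u => pd ez (pd ez u)) := by
  intro R hR
  choose C hC hb using fun j : Fin N =>
    (centreBound_pd_eb (N := N) (a := a) hl hΛ j).pd_eb_comp hl hΛ j R hR
  refine ⟨l⁻¹ * ∑ j, C j, mul_nonneg (by positivity) (Finset.sum_nonneg fun j _ => hC j),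
    fun p₀ u M hu ha hM => ?_⟩
  have hp₀ : p₀ ∈ Metric.ball p₀ R := Metric.mem_ball_self hR
  have h1 := hu.eqn p₀ hp₀
  have hap := (ha p₀ hp₀).1
  have h2 : |∑ j, pd (eb j) (pd (eb j) u) p₀| ≤ (∑ j, C j) * M := by
    rw [Finset.sum_mul]
    exact (Finset.abs_sum_le_sum_abs _ _).trans
      (Finset.sum_le_sum fun j _ => hb j p₀ u M hu ha hM)
  have h3 : a p₀.2 * |pd ez (pd ez u) p₀| = |∑ j, pd (eb j) (pd (eb j) u) p₀| := by
    rw [← abs_of_pos (hl.trans_le hap), ← abs_mul, eq_neg_of_add_eq_zero_left h1, abs_neg]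
  rw [mul_assoc, le_inv_mul_iff₀ hl]
  calc l * |pd ez (pd ez u) p₀| ≤ a p₀.2 * |pd ez (pd ez u) p₀| := by gcongr
    _ ≤ _ := h3 ▸ h2

theorem centreBound_pd_ez {N : ℕ} {a : ℝ → ℝ} {l Λ : ℝ} (hl : 0 < l) (hΛ : l ≤ Λ) :
    CentreBound N a l Λ (pd ez) := by
  intro R hR
  obtain ⟨C, hC, hb⟩ := centreBound_pd_ez_pd_ez (N := N) (a := a) hl hΛ (R / 2) (by positivity)
  refine ⟨2 / (R / 4) + C * (R / 4), by positivity, fun p₀ u M hu ha hM => ?_⟩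
  have hmem : ∀ t ∈ Icc 0 (R / 4), p₀ + t • ez ∈ Metric.ball p₀ (R / 2) := by
    intro t ht
    rw [mem_ball_iff_norm, add_sub_cancel_left, norm_smul]
    have : ‖(ez : Euc N × ℝ)‖ = 1 := by simp [ez, Prod.norm_def]
    rw [this, Real.norm_eq_abs, abs_of_nonneg ht.1]
    linarith [ht.2]
  have hsub2 : Metric.ball p₀ (R / 2) ⊆ Metric.ball p₀ R := Metric.ball_subset_ball (by linarith)
  have hsub : ∀ q ∈ Metric.ball p₀ (R / 2), Metric.ball q (R / 2) ⊆ Metric.ball p₀ R := by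
    intro q hq
    refine Metric.ball_subset_ball' ?_
    rw [Metric.mem_ball] at hq; linarith
  have hdiff : ∀ q ∈ Metric.ball p₀ R, DifferentiableAt ℝ u q ∧ DifferentiableAt ℝ (pd ez u) q := by
    intro q hq
    have h := hu.contDiffOn.contDiffAt (Metric.isOpen_ball.mem_nhds hq)
    exact ⟨h.differentiableAt (by simp), (contDiffAt_pd (m := 1) ez h
      (by norm_num [one_add_one_eq_two])).differentiableAt (by simp)⟩
  have hbb : ∀ q ∈ Metric.ball p₀ (R / 2), |pd ez (pd ez u) q| ≤ C * M := fun q hq =>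
    hb q u M (hu.mono (hsub q hq)) (fun p hp => ha p (hsub q hq hp)) fun p hp => hM p (hsub q hq hp)
  have hr : 0 < R / 4 := by positivity
  have hd1 : ∀ t ∈ Icc 0 (R / 4), HasDerivAt (fun t : ℝ => u (p₀ + t • ez))
      (pd ez u (p₀ + t • ez)) t := fun t ht => hasDerivAt_line (hdiff _ (hsub2 (hmem t ht))).1
  have hd2 : ∀ t ∈ Icc 0 (R / 4), HasDerivAt (fun t : ℝ => pd ez u (p₀ + t • ez))
      (pd ez (pd ez u) (p₀ + t • ez)) t := fun t ht =>
    hasDerivAt_line (hdiff _ (hsub2 (hmem t ht))).2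
  obtain ⟨ξ, hξ, hξ'⟩ := exists_hasDerivAt_eq_slope (fun t : ℝ => u (p₀ + t • ez)) _ hr
    (fun t ht => (hd1 t ht).continuousAt.continuousWithinAt)
    (fun t ht => hd1 t (Ioo_subset_Icc_self ht))
  have hm := (convex_Icc (0 : ℝ) (R / 4)).norm_image_sub_le_of_norm_hasDerivWithin_le
    (fun t ht => (hd2 t ht).hasDerivWithinAt) (fun t ht => hbb _ (hmem t ht))
    (left_mem_Icc.2 hr.le) (Ioo_subset_Icc_self hξ)
  simp only [zero_smul, add_zero, sub_zero, Real.norm_eq_abs] at hm hξ'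
  have hM0 : 0 ≤ M := (abs_nonneg _).trans (hM p₀ (Metric.mem_ball_self hR))
  have h1 : C * M * |ξ| ≤ C * M * (R / 4) := by
    gcongr; rw [abs_of_pos hξ.1]; exact hξ.2.le
  have h2 : |pd ez u (p₀ + ξ • ez)| ≤ 2 / (R / 4) * M := by
    rw [hξ', abs_div, abs_of_pos hr, div_mul_eq_mul_div]
    gcongr
    have h3 := hM _ (hsub2 (hmem (R / 4) (right_mem_Icc.2 hr.le)))
    have h4 := hM p₀ (Metric.mem_ball_self hR)
    calc _ ≤ |u (p₀ + (R / 4) • ez)| + |u p₀| := abs_sub _ _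
      _ ≤ _ := by linarith
  calc |pd ez u p₀| = |pd ez u (p₀ + ξ • ez) - (pd ez u (p₀ + ξ • ez) - pd ez u p₀)| := by
        congr 1; ring
    _ ≤ _ := abs_sub _ _
    _ ≤ _ := by linarith

theorem norm_le_of_apply_basis {N : ℕ} {G : Type} [NormedAddCommGroup G] [NormedSpace ℝ G]
    (L : Euc N × ℝ →L[ℝ] G) : ‖L‖ ≤ ∑ i, ‖L (eb i)‖ + ‖L ez‖ := by
  refine L.opNorm_le_bound (by positivity) fun p => ?_
  have hp : p = ∑ i, p.1 i • (eb i : Euc N × ℝ) + p.2 • ez := by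
    ext i
    · simp [eb, ez, Prod.fst_sum, Pi.single_apply]
    · simp [eb, ez, Prod.snd_sum]
  have h1 : L p = ∑ i, p.1 i • L (eb i) + p.2 • L ez := by
    conv_lhs => rw [hp]
    simp
  have h2 : ∀ i, ‖p.1 i‖ ≤ ‖p‖ := fun i => (PiLp.norm_apply_le p.1 i).trans (norm_fst_le p)
  rw [h1, add_mul, Finset.sum_mul]
  refine (norm_add_le _ _).trans (add_le_add ((norm_sum_le _ _).trans
    (Finset.sum_le_sum fun i _ => ?_)) ?_)
  · rw [norm_smul, mul_comm]; gcongr; exact h2 i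
  · rw [norm_smul, mul_comm]; gcongr; exact norm_snd_le p

theorem pd_pd_eq {E : Type} [NormedAddCommGroup E] [NormedSpace ℝ E] {u : E → ℝ} {p : E}
    (h : ContDiffAt ℝ 2 u p) (e e' : E) :
    pd e' (pd e u) p = fderiv ℝ (fderiv ℝ u) p e' e := by
  have h1 : DifferentiableAt ℝ (fderiv ℝ u) p :=
    (h.fderiv_right (m := 1) (by norm_num [one_add_one_eq_two])).differentiableAt (by simp)
  have h2 : HasFDerivAt (pd e u) _ p := h1.hasFDerivAt.clm_apply (hasFDerivAt_const e p)
  rw [pd, h2.fderiv]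
  simp

theorem pd_pd_comm {E : Type} [NormedAddCommGroup E] [NormedSpace ℝ E] {u : E → ℝ} {p : E}
    (h : ContDiffAt ℝ 2 u p) (e e' : E) : pd e' (pd e u) p = pd e (pd e' u) p := by
  rw [pd_pd_eq h, pd_pd_eq h]
  exact (h.isSymmSndFDerivAt (by simp)) e' e

/-- Interior `C²` estimate. -/
theorem exists_C2_bound {N : ℕ} {a : ℝ → ℝ} {l Λ : ℝ} (hl : 0 < l) (hΛ : l ≤ Λ) {R : ℝ}
    (hR : 0 < R) : ∃ C, 0 ≤ C ∧ ∀ (p₀ : Euc N × ℝ) (u : Euc N × ℝ → ℝ) (M : ℝ),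
      Sol a (Metric.ball p₀ R) u → (∀ p ∈ Metric.ball p₀ R, l ≤ a p.2 ∧ a p.2 ≤ Λ) →
      (∀ p ∈ Metric.ball p₀ R, |u p| ≤ M) →
      ‖fderiv ℝ u p₀‖ ≤ C * M ∧ ‖fderiv ℝ (fderiv ℝ u) p₀‖ ≤ C * M := by
  choose C₁ hC₁ h1 using fun j : Fin N => centreBound_pd_eb (N := N) (a := a) hl hΛ j R hR
  obtain ⟨C₂, hC₂, h2⟩ := centreBound_pd_ez (N := N) (a := a) hl hΛ R hR
  choose C₃ hC₃ h3 using fun i j : Fin N =>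
    (centreBound_pd_eb (N := N) (a := a) hl hΛ j).pd_eb_comp hl hΛ i R hR
  choose C₄ hC₄ h4 using fun i : Fin N =>
    (centreBound_pd_ez (N := N) (a := a) hl hΛ).pd_eb_comp hl hΛ i R hR
  obtain ⟨C₅, hC₅, h5⟩ := centreBound_pd_ez_pd_ez (N := N) (a := a) hl hΛ R hR
  have hA : 0 ≤ ∑ j, C₁ j + C₂ := add_nonneg (Finset.sum_nonneg fun j _ => hC₁ j) hC₂
  have hB : 0 ≤ ∑ i, (∑ j, C₃ i j + C₄ i) + (∑ j, C₄ j + C₅) :=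
    add_nonneg (Finset.sum_nonneg fun i _ => add_nonneg (Finset.sum_nonneg fun j _ => hC₃ i j)
      (hC₄ i)) (add_nonneg (Finset.sum_nonneg fun j _ => hC₄ j) hC₅)
  refine ⟨(∑ j, C₁ j + C₂) + (∑ i, (∑ j, C₃ i j + C₄ i) + (∑ j, C₄ j + C₅)), by linarith,
    fun p₀ u M hu ha hM => ?_⟩
  have hp₀ : p₀ ∈ Metric.ball p₀ R := Metric.mem_ball_self hR
  have hM0 : 0 ≤ M := (abs_nonneg _).trans (hM p₀ hp₀)
  have hc : ContDiffAt ℝ 2 u p₀ := hu.contDiffOn.contDiffAt (Metric.isOpen_ball.mem_nhds hp₀)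
  rw [add_mul]
  have hAM := mul_nonneg hA hM0
  have hBM := mul_nonneg hB hM0
  constructor
  · refine (norm_le_of_apply_basis _).trans (le_trans ?_ (le_add_of_nonneg_right hBM))
    rw [add_mul, Finset.sum_mul]
    exact add_le_add (Finset.sum_le_sum fun j _ => h1 j p₀ u M hu ha hM) (h2 p₀ u M hu ha hM)
  · refine (norm_le_of_apply_basis _).trans (le_trans ?_ (le_add_of_nonneg_left hAM))
    have hz : ∀ i : Fin N, ‖fderiv ℝ (fderiv ℝ u) p₀ (eb i) ez‖ ≤ C₄ i * M := fun i => by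
      rw [← pd_pd_eq hc]; exact h4 i p₀ u M hu ha hM
    rw [add_mul, add_mul, Finset.sum_mul, Finset.sum_mul]
    refine add_le_add (Finset.sum_le_sum fun i _ => ?_) ?_
    · refine (norm_le_of_apply_basis _).trans ?_
      rw [add_mul, Finset.sum_mul]
      refine add_le_add (Finset.sum_le_sum fun j _ => ?_) (hz i)
      rw [← pd_pd_eq hc]; exact h3 i j p₀ u M hu ha hM
    · refine (norm_le_of_apply_basis _).trans ?_
      refine add_le_add (Finset.sum_le_sum fun j _ => ?_) ?_
      · rw [← pd_pd_eq hc, pd_pd_comm hc, pd_pd_eq hc]; exact hz j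
      · rw [← pd_pd_eq hc]; exact h5 p₀ u M hu ha hM

/-- Passing to the limit in `C²`. -/
theorem contDiffOn_two_of_uniformCauchy {E : Type} [NormedAddCommGroup E] [NormedSpace ℝ E]
    {B : Set E} (hB : IsOpen B) {f : ℕ → E → ℝ} {g : E → ℝ}
    (hf : ∀ n, ContDiffOn ℝ 2 (f n) B) (hlim : ∀ p ∈ B, Tendsto (fun n => f n p) atTop (𝓝 (g p)))
    (h1 : UniformCauchySeqOn (fun n => fderiv ℝ (f n)) atTop B)
    (h2 : UniformCauchySeqOn (fun n => fderiv ℝ (fderiv ℝ (f n))) atTop B) :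
    ContDiffOn ℝ 2 g B ∧ ∀ p ∈ B, Tendsto (fun n => fderiv ℝ (fderiv ℝ (f n)) p) atTop
      (𝓝 (fderiv ℝ (fderiv ℝ g) p)) := by
  have hcd : ∀ n, ∀ p ∈ B, ContDiffAt ℝ 2 (f n) p := fun n p hp =>
    (hf n).contDiffAt (hB.mem_nhds hp)
  have hfd : ∀ n, ∀ p ∈ B, ContDiffAt ℝ 1 (fderiv ℝ (f n)) p := fun n p hp =>
    (hcd n p hp).fderiv_right (by norm_num [one_add_one_eq_two])
  have hex1 : ∀ p ∈ B, ∃ G, Tendsto (fun n => fderiv ℝ (f n) p) atTop (𝓝 G) := fun p hp =>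
    cauchySeq_tendsto_of_complete (h1.cauchySeq hp)
  have hex2 : ∀ p ∈ B, ∃ H, Tendsto (fun n => fderiv ℝ (fderiv ℝ (f n)) p) atTop (𝓝 H) :=
    fun p hp => cauchySeq_tendsto_of_complete (h2.cauchySeq hp)
  choose! G hG using hex1
  choose! H hH using hex2
  have hG' := h1.tendstoUniformlyOn_of_tendsto hG
  have hH' := h2.tendstoUniformlyOn_of_tendsto hH
  have hg : ∀ p ∈ B, HasFDerivAt g (G p) p := fun p hp =>
    hasFDerivAt_of_tendstoUniformlyOn hB hG'
      (fun n p hp => ((hcd n p hp).differentiableAt (by simp)).hasFDerivAt) hlim hp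
  have hg2 : ∀ p ∈ B, HasFDerivAt G (H p) p := fun p hp =>
    hasFDerivAt_of_tendstoUniformlyOn hB hH'
      (fun n p hp => ((hfd n p hp).differentiableAt (by simp)).hasFDerivAt) hG hp
  have hHc : ContinuousOn H B := hH'.continuousOn (Frequently.of_forall fun n p hp =>
    (((hfd n p hp).fderiv_right (m := 0) (by simp)).continuousAt).continuousWithinAt)
  have hgG : ∀ p ∈ B, fderiv ℝ g =ᶠ[𝓝 p] G := fun p hp => by
    filter_upwards [hB.mem_nhds hp] with q hq using (hg q hq).fderiv
  have hgH : ∀ p ∈ B, fderiv ℝ (fderiv ℝ g) p = H p := fun p hp => by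
    rw [(hgG p hp).fderiv_eq, (hg2 p hp).fderiv]
  refine ⟨?_, fun p hp => by rw [hgH p hp]; exact hH p hp⟩
  rw [← one_add_one_eq_two, contDiffOn_succ_iff_fderiv_of_isOpen hB]
  refine ⟨fun p hp => (hg p hp).differentiableAt.differentiableWithinAt, by simp, ?_⟩
  rw [← zero_add 1, contDiffOn_succ_iff_fderiv_of_isOpen hB]
  refine ⟨fun p hp => ((hg2 p hp).congr_of_eventuallyEq (hgG p hp)).differentiableAt.differentiableWithinAt,
    by simp, ?_⟩
  rw [contDiffOn_zero]
  exact hHc.congr hgH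

theorem abs_dq_sub_pd_le {E : Type} [NormedAddCommGroup E] [NormedSpace ℝ E] {u : E → ℝ} {e p : E}
    {h M : ℝ} (hh : h ≠ 0) (hM : 0 ≤ M)
    (h1 : ∀ t ∈ uIcc 0 h, DifferentiableAt ℝ u (p + t • e))
    (h2 : ∀ t ∈ uIcc 0 h, DifferentiableAt ℝ (pd e u) (p + t • e))
    (hb : ∀ t ∈ uIcc 0 h, |pd e (pd e u) (p + t • e)| ≤ M) :
    |dq e h u p - pd e u p| ≤ M * |h| := by
  have h0 : (0 : ℝ) ∈ uIcc 0 h := left_mem_uIcc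
  have hh' : h ∈ uIcc 0 h := right_mem_uIcc
  have hc : Convex ℝ (uIcc 0 h) := convex_uIcc 0 h
  have k1 : ∀ t ∈ uIcc 0 h, |pd e u (p + t • e) - pd e u p| ≤ M * |h| := by
    intro t ht
    have := hc.norm_image_sub_le_of_norm_hasDerivWithin_le
      (f := fun t : ℝ => pd e u (p + t • e)) (f' := fun t => pd e (pd e u) (p + t • e)) (C := M)
      (fun s hs => (hasDerivAt_line (h2 s hs)).hasDerivWithinAt) hb h0 ht
    simp only [zero_smul, add_zero, Real.norm_eq_abs, sub_zero] at this
    refine this.trans (mul_le_mul_of_nonneg_left ?_ hM)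
    simpa using abs_sub_left_of_mem_uIcc ht
  have k2 := hc.norm_image_sub_le_of_norm_hasDerivWithin_le
    (f := fun t : ℝ => u (p + t • e) - t * pd e u p)
    (f' := fun t => pd e u (p + t • e) - 1 * pd e u p) (C := M * |h|)
    (fun s hs => ((hasDerivAt_line (h1 s hs)).sub
      ((hasDerivAt_id' s).mul_const _)).hasDerivWithinAt) (by simpa using k1) h0 hh'
  simp only [zero_smul, add_zero, Real.norm_eq_abs, sub_zero, zero_mul] at k2
  have hp : 0 < |h| := abs_pos.2 hh
  have : dq e h u p - pd e u p = h⁻¹ * (u (p + h • e) - h * pd e u p - u p) := by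
    unfold dq; field_simp; ring
  rw [this, abs_mul, abs_inv, inv_mul_le_iff₀ hp, mul_comm |h|]
  exact k2

theorem uniformCauchySeqOn_of_norm_lt {E G : Type} [NormedAddCommGroup G] {f : ℕ → E → G}
    {B : Set E} (h : ∀ ε > 0, ∃ n₀, ∀ m ≥ n₀, ∀ n ≥ n₀, ∀ q ∈ B, ‖f m q - f n q‖ < ε) :
    UniformCauchySeqOn f atTop B :=
  Metric.uniformCauchySeqOn_iff.2 fun ε hε => by simpa [dist_eq_norm] using h ε hε

theorem Sol.exists_sol_of_dq {N : ℕ} {a : ℝ → ℝ} {l Λ : ℝ} (hl : 0 < l) (hΛ : l ≤ Λ) {R : ℝ}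
    (hR : 0 < R) {p₀ : Euc N × ℝ} {u : Euc N × ℝ → ℝ} (hu : Sol a (Metric.ball p₀ (4 * R)) u)
    (ha : ∀ p ∈ Metric.ball p₀ (4 * R), l ≤ a p.2 ∧ a p.2 ≤ Λ) (j : Fin N) :
    Sol a (Metric.ball p₀ R) (pd (eb j) u) := by
  have hdiff : ∀ q ∈ Metric.ball p₀ (4 * R),
      DifferentiableAt ℝ u q ∧ DifferentiableAt ℝ (pd (eb j) u) q := by
    intro q hq
    have h := hu.contDiffOn.contDiffAt (Metric.isOpen_ball.mem_nhds hq)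
    exact ⟨h.differentiableAt (by simp), (contDiffAt_pd (m := 1) _ h
      (by norm_num [one_add_one_eq_two])).differentiableAt (by simp)⟩
  obtain ⟨M, hM⟩ : ∃ M, ∀ q ∈ Metric.closedBall p₀ (3 * R), ‖pd (eb j) (pd (eb j) u) q‖ ≤ M := by
    refine (isCompact_closedBall p₀ (3 * R)).exists_bound_of_continuousOn ?_
    have h1 : ContDiffOn ℝ 0 (pd (eb j) (pd (eb j) u)) (Metric.ball p₀ (4 * R)) :=
      contDiffOn_pd Metric.isOpen_ball _ (m := 0) (n := 1)
        (contDiffOn_pd Metric.isOpen_ball _ hu.contDiffOn (by norm_num [one_add_one_eq_two]))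
        (by simp)
    exact h1.continuousOn.mono (Metric.closedBall_subset_ball (by linarith))
  have hM0 : 0 ≤ M := (norm_nonneg _).trans (hM p₀ (Metric.mem_closedBall_self (by positivity)))
  obtain ⟨C, hC, hbound⟩ := exists_C2_bound (N := N) (a := a) hl hΛ hR
  set hs : ℕ → ℝ := fun n => R / (n + 2) with hhs
  have hs0 : ∀ n, 0 < hs n := fun n => by positivity
  have hs1 : ∀ n, hs n < R := fun n => by
    rw [hhs]; beta_reduce; rw [div_lt_iff₀ (by positivity)]; nlinarith [(n.cast_nonneg : (0 : ℝ) ≤ n)]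
  have hst : Tendsto hs atTop (𝓝 0) := by
    have := (tendsto_natCast_atTop_atTop (R := ℝ)).atTop_add (tendsto_const_nhds (x := (2 : ℝ)))
    exact this.const_div_atTop R
  have hmem : ∀ q ∈ Metric.ball p₀ (2 * R), ∀ t : ℝ, |t| < R →
      q + t • eb j ∈ Metric.ball p₀ (3 * R) := by
    intro q hq t ht
    rw [mem_ball_iff_norm] at hq ⊢
    have h := norm_smul_eb_le j t
    calc ‖q + t • eb j - p₀‖ = ‖(q - p₀) + t • eb j‖ := by congr 1; abel
      _ ≤ ‖q - p₀‖ + ‖t • (eb j : Euc N × ℝ)‖ := norm_add_le _ _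
      _ < 3 * R := by linarith
  have h34 : Metric.ball p₀ (3 * R) ⊆ Metric.ball p₀ (4 * R) := Metric.ball_subset_ball (by linarith)
  have h24 : Metric.ball p₀ (2 * R) ⊆ Metric.ball p₀ (4 * R) := Metric.ball_subset_ball (by linarith)
  have h12 : Metric.ball p₀ R ⊆ Metric.ball p₀ (2 * R) := Metric.ball_subset_ball (by linarith)
  have hf : ∀ n, Sol a (Metric.ball p₀ (2 * R)) (_root_.dq (eb j) (hs n) u) := fun n =>
    hu.dq Metric.isOpen_ball h24 fun q hq => h34 (hmem q hq _ (by rw [abs_of_pos (hs0 n)]; exact hs1 n))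
  have hdq : ∀ n, ∀ q ∈ Metric.ball p₀ (2 * R),
      |_root_.dq (eb j) (hs n) u q - pd (eb j) u q| ≤ M * hs n := by
    intro n q hq
    have hm : ∀ t ∈ uIcc 0 (hs n), q + t • eb j ∈ Metric.ball p₀ (3 * R) := by
      intro t ht
      rw [uIcc_of_le (hs0 n).le] at ht
      exact hmem q hq t (by rw [abs_of_nonneg ht.1]; exact ht.2.trans_lt (hs1 n))
    have := abs_dq_sub_pd_le (hs0 n).ne' hM0 (fun t ht => (hdiff _ (h34 (hm t ht))).1)
      (fun t ht => (hdiff _ (h34 (hm t ht))).2)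
      (fun t ht => hM _ (Metric.ball_subset_closedBall (hm t ht)))
    rwa [abs_of_pos (hs0 n)] at this
  have hcd : ∀ n, ∀ q ∈ Metric.ball p₀ R, ContDiffAt ℝ 2 (_root_.dq (eb j) (hs n) u) q := fun n q hq =>
    (hf n).contDiffOn.contDiffAt (Metric.isOpen_ball.mem_nhds (h12 hq))
  have hest : ∀ m n, ∀ q ∈ Metric.ball p₀ R,
      ‖fderiv ℝ (_root_.dq (eb j) (hs m) u) q - fderiv ℝ (_root_.dq (eb j) (hs n) u) q‖ ≤
        C * (M * hs m + M * hs n) ∧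
      ‖fderiv ℝ (fderiv ℝ (_root_.dq (eb j) (hs m) u)) q - fderiv ℝ (fderiv ℝ (_root_.dq (eb j) (hs n) u)) q‖ ≤
        C * (M * hs m + M * hs n) := by
    intro m n q hq
    have hqs : Metric.ball q R ⊆ Metric.ball p₀ (2 * R) :=
      Metric.ball_subset_ball' (by rw [Metric.mem_ball] at hq; linarith)
    have hb := hbound q (fun p => _root_.dq (eb j) (hs m) u p - _root_.dq (eb j) (hs n) u p)
      (M * hs m + M * hs n) (((hf m).sub Metric.isOpen_ball (hf n)).mono hqs)
      (fun p hp => ha p (h24 (hqs hp))) (fun p hp => by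
        have h1 := hdq m p (hqs hp)
        have h2 := hdq n p (hqs hp)
        rw [abs_le] at h1 h2 ⊢
        constructor <;> linarith)
    have e1 : ∀ p ∈ Metric.ball p₀ R,
        fderiv ℝ (fun p => _root_.dq (eb j) (hs m) u p - _root_.dq (eb j) (hs n) u p) p =
          fderiv ℝ (_root_.dq (eb j) (hs m) u) p - fderiv ℝ (_root_.dq (eb j) (hs n) u) p := fun p hp =>
      fderiv_fun_sub ((hcd m p hp).differentiableAt (by simp))
        ((hcd n p hp).differentiableAt (by simp))
    have e2 : fderiv ℝ (fun p => _root_.dq (eb j) (hs m) u p - _root_.dq (eb j) (hs n) u p) =ᶠ[𝓝 q]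
        fun p => fderiv ℝ (_root_.dq (eb j) (hs m) u) p - fderiv ℝ (_root_.dq (eb j) (hs n) u) p := by
      filter_upwards [Metric.isOpen_ball.mem_nhds hq] with p hp using e1 p hp
    have e3 : ∀ n, DifferentiableAt ℝ (fderiv ℝ (_root_.dq (eb j) (hs n) u)) q := fun n =>
      ((hcd n q hq).fderiv_right (m := 1) (by norm_num [one_add_one_eq_two])).differentiableAt
        (by simp)
    rw [e1 q hq, e2.fderiv_eq, fderiv_fun_sub (e3 m) (e3 n)] at hb
    exact hb
  have hsmall : ∀ ε > 0, ∃ n₀, ∀ m ≥ n₀, ∀ n ≥ n₀, C * (M * hs m + M * hs n) < ε := by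
    intro ε hε
    have : Tendsto (fun n => 2 * C * M * hs n) atTop (𝓝 0) := by simpa using hst.const_mul (2 * C * M)
    obtain ⟨n₀, hn₀⟩ := eventually_atTop.1 (this.eventually_lt_const hε)
    refine ⟨n₀, fun m hm n hn => ?_⟩
    have h1 := hn₀ m hm
    have h2 := hn₀ n hn
    nlinarith
  have hlim := contDiffOn_two_of_uniformCauchy (Metric.isOpen_ball (x := p₀) (ε := R))
    (fun n => (hf n).contDiffOn.mono h12) (g := pd (eb j) u)
    (fun q hq => by
      have := hst.const_mul M
      rw [mul_zero] at this
      refine tendsto_iff_norm_sub_tendsto_zero.2 (squeeze_zero (fun _ => norm_nonneg _)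
        (fun n => hdq n q (h12 hq)) this))
    (uniformCauchySeqOn_of_norm_lt fun ε hε => by
      obtain ⟨n₀, hn₀⟩ := hsmall ε hε
      exact ⟨n₀, fun m hm n hn q hq => ((hest m n q hq).1).trans_lt (hn₀ m hm n hn)⟩)
    (uniformCauchySeqOn_of_norm_lt (G := Euc N × ℝ →L[ℝ] Euc N × ℝ →L[ℝ] ℝ)
      (f := fun n => fderiv ℝ (fderiv ℝ (_root_.dq (eb j) (hs n) u))) fun ε hε => by
      obtain ⟨n₀, hn₀⟩ := hsmall ε hε
      exact ⟨n₀, fun m hm n hn q hq => ((hest m n q hq).2).trans_lt (hn₀ m hm n hn)⟩)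
  refine ⟨hlim.1, fun q hq => ?_⟩
  have hg : ContDiffAt ℝ 2 (pd (eb j) u) q := hlim.1.contDiffAt (Metric.isOpen_ball.mem_nhds hq)
  have ht : ∀ e e' : Euc N × ℝ, Tendsto (fun n => pd e' (pd e (_root_.dq (eb j) (hs n) u)) q) atTop
      (𝓝 (pd e' (pd e (pd (eb j) u)) q)) := by
    intro e e'
    rw [pd_pd_eq hg]
    simp_rw [fun n => pd_pd_eq (hcd n q hq) e e']
    exact ((((ContinuousLinearMap.apply ℝ ℝ e).continuous.tendsto _).comp
      (((ContinuousLinearMap.apply ℝ (Euc N × ℝ →L[ℝ] ℝ) e').continuous.tendsto _).comp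
        (hlim.2 q hq))))
  have hz := ((ht ez ez).const_mul (a q.2)).add (tendsto_finsetSum Finset.univ fun i _ => ht (eb i) (eb i))
  refine tendsto_nhds_unique hz ?_
  simp_rw [fun n => (hf n).eqn q (h12 hq)]
  exact tendsto_const_nhds

theorem Sol.of_locally {N : ℕ} {a : ℝ → ℝ} {V : Set (Euc N × ℝ)} {u : Euc N × ℝ → ℝ}
    (h : ∀ p ∈ V, ∃ R > 0, Sol a (Metric.ball p R) u) : Sol a V u := by
  refine ⟨fun p hp => ?_, fun p hp => ?_⟩ <;> obtain ⟨R, hR, hs⟩ := h p hp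
  · exact (hs.contDiffOn.contDiffAt (Metric.ball_mem_nhds p hR)).contDiffWithinAt
  · exact hs.eqn p (Metric.mem_ball_self hR)

theorem Sol.pd_eb {N : ℕ} {a : ℝ → ℝ} {V : Set (Euc N × ℝ)} (hV : IsOpen V)
    (ha : ∀ p ∈ V, 0 < a p.2 ∧ ContinuousAt a p.2) {u : Euc N × ℝ → ℝ} (hu : Sol a V u)
    (j : Fin N) : Sol a V (pd (eb j) u) := by
  refine Sol.of_locally fun p hp => ?_
  have hca : ContinuousAt (fun q : Euc N × ℝ => a q.2) p := (ha p hp).2.comp continuous_snd.continuousAt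
  have h1 : ∀ᶠ q in 𝓝 p, q ∈ V ∧ a p.2 / 2 < a q.2 ∧ a q.2 < 2 * a p.2 := by
    have := (ha p hp).1
    filter_upwards [hV.mem_nhds hp, hca.eventually_const_lt (by linarith : a p.2 / 2 < a p.2),
      hca.eventually_lt_const (by linarith : a p.2 < 2 * a p.2)] with q h1 h2 h3 using ⟨h1, h2, h3⟩
  obtain ⟨R, hR, hsub⟩ := Metric.eventually_nhds_iff_ball.1 h1
  have h4 : 4 * (R / 4) = R := by ring
  have hp' := (ha p hp).1
  refine ⟨R / 4, by positivity, Sol.exists_sol_of_dq (l := a p.2 / 2) (Λ := 2 * a p.2)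
    (by linarith) (by linarith) (by positivity) (hu.mono ?_) ?_ j⟩
  · rw [h4]; exact fun q hq => (hsub q hq).1
  · rw [h4]; exact fun q hq => ⟨(hsub q hq).2.1.le, (hsub q hq).2.2.le⟩

theorem contDiffOn_succ_of_pd {N : ℕ} {V : Set (Euc N × ℝ)} (hV : IsOpen V)
    {u : Euc N × ℝ → ℝ} {n : ℕ} (hd : DifferentiableOn ℝ u V)
    (h1 : ∀ j, ContDiffOn ℝ n (pd (eb j) u) V) (h2 : ContDiffOn ℝ n (pd ez u) V) :
    ContDiffOn ℝ (n + 1) u V := by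
  rw [contDiffOn_succ_iff_fderiv_of_isOpen hV]
  refine ⟨hd, by simp, ?_⟩
  have : fderiv ℝ u = fun p => ∑ i, pd (eb i) u p •
      ((EuclideanSpace.proj i : Euc N →L[ℝ] ℝ).comp (ContinuousLinearMap.fst ℝ (Euc N) ℝ)) +
      pd ez u p • ContinuousLinearMap.snd ℝ (Euc N) ℝ := by
    funext p
    refine ContinuousLinearMap.ext fun v => ?_
    have hv : v = ∑ i, v.1 i • (eb i : Euc N × ℝ) + v.2 • ez := by
      ext i
      · simp [eb, ez, Prod.fst_sum, Pi.single_apply]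
      · simp [eb, ez, Prod.snd_sum]
    conv_lhs => rw [hv]
    simp [pd, mul_comm]
  rw [this]
  exact (ContDiffOn.sum fun i _ => (h1 i).smul contDiffOn_const).add (h2.smul contDiffOn_const)

theorem Sol.contDiffOn_nat {N : ℕ} {a : ℝ → ℝ} {V : Set (Euc N × ℝ)} (hV : IsOpen V)
    (ha : ∀ p ∈ V, 0 < a p.2 ∧ ContDiffAt ℝ ∞ a p.2) (n : ℕ) :
    ∀ {u : Euc N × ℝ → ℝ}, Sol a V u → ContDiffOn ℝ n u V := by
  have ha' : ∀ p ∈ V, 0 < a p.2 ∧ ContinuousAt a p.2 := fun p hp =>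
    ⟨(ha p hp).1, (ha p hp).2.continuousAt⟩
  induction n with
  | zero => exact fun hu => hu.contDiffOn.of_le (by simp)
  | succ n ih =>
    intro u hu
    rcases n with _ | n
    · exact hu.contDiffOn.of_le (by norm_num)
    have hcd : ∀ q ∈ V, ContDiffAt ℝ 2 u q := fun q hq => hu.contDiffOn.contDiffAt (hV.mem_nhds hq)
    have hdu : DifferentiableOn ℝ u V := hu.contDiffOn.differentiableOn (by simp)
    have hj : ∀ j, ContDiffOn ℝ (n + 1 : ℕ) (pd (eb j) u) V := fun j => ih (hu.pd_eb hV ha' j)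
    have hdz : DifferentiableOn ℝ (pd ez u) V :=
      (contDiffOn_pd hV ez hu.contDiffOn (m := 1) (by norm_num [one_add_one_eq_two])).differentiableOn
        (by simp)
    have hz : ContDiffOn ℝ (n + 1 : ℕ) (pd ez u) V := by
      refine contDiffOn_succ_of_pd hV hdz (fun j => ?_) ?_
      · refine (contDiffOn_pd hV ez (hj j) (m := n) (by norm_cast)).congr fun q hq => ?_
        exact pd_pd_comm (hcd q hq) _ _
      · have h1 : ContDiffOn ℝ n (fun q : Euc N × ℝ =>
            -(a q.2)⁻¹ * ∑ i, pd (eb i) (pd (eb i) u) q) V := by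
          refine ContDiffOn.mul (ContDiffOn.neg (ContDiffOn.inv ?_ fun q hq => (ha q hq).1.ne'))
            (ContDiffOn.sum fun i _ => contDiffOn_pd hV _ (hj i) (by norm_cast))
          exact fun q hq => (((ha q hq).2.of_le (by exact_mod_cast le_top)).comp q
            contDiffAt_snd).contDiffWithinAt
        refine h1.congr fun q hq => ?_
        have := hu.eqn q hq
        have h0 := (ha q hq).1
        field_simp
        linarith
    exact_mod_cast contDiffOn_succ_of_pd hV hdu hj hz

theorem Sol.contDiffOn_infty {N : ℕ} {a : ℝ → ℝ} {V : Set (Euc N × ℝ)} (hV : IsOpen V)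
    (ha : ∀ p ∈ V, 0 < a p.2 ∧ ContDiffAt ℝ ∞ a p.2) {u : Euc N × ℝ → ℝ} (hu : Sol a V u) :
    ContDiffOn ℝ ∞ u V :=
  _root_.contDiffOn_infty.2 fun n => Sol.contDiffOn_nat hV ha n hu

theorem Sol.const {N : ℕ} (a : ℝ → ℝ) (V : Set (Euc N × ℝ)) (c : ℝ) : Sol a V fun _ => c := by
  refine ⟨contDiffOn_const, fun p _ => ?_⟩
  have : ∀ e : Euc N × ℝ, pd e (fun _ : Euc N × ℝ => c) = fun _ => 0 := fun e => by
    funext p; simp [pd]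
  have h0 : ∀ e : Euc N × ℝ, pd e (fun _ : Euc N × ℝ => (0 : ℝ)) = fun _ => 0 := fun e => by
    funext p; simp [pd]
  simp [this, h0]

theorem Sol.pd_iterate {N : ℕ} {a : ℝ → ℝ} {V : Set (Euc N × ℝ)} (hV : IsOpen V)
    (ha : ∀ p ∈ V, 0 < a p.2 ∧ ContinuousAt a p.2) {u : Euc N × ℝ → ℝ} (hu : Sol a V u)
    (j : Fin N) (k : ℕ) : Sol a V ((pd (eb j))^[k] u) := by
  induction k with
  | zero => exact hu
  | succ k ih => rw [Function.iterate_succ_apply']; exact ih.pd_eb hV ha j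

theorem Sol.abs_pd_iterate_le {N : ℕ} {a : ℝ → ℝ} {V : Set (Euc N × ℝ)} (hV : IsOpen V)
    (ha : ∀ p ∈ V, 0 < a p.2 ∧ ContinuousAt a p.2) {u : Euc N × ℝ → ℝ} (hu : Sol a V u)
    (j : Fin N) {p : Euc N × ℝ} {R M Λ : ℝ} (hR : 0 < R)
    (hball : Metric.closedBall p R ⊆ V) (hb : ∀ q ∈ Metric.closedBall p R, |u q| ≤ M)
    (haΛ : ∀ q ∈ Metric.closedBall p R, a q.2 ≤ Λ) {n : ℕ} (hn : 0 < n) :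
    |(pd (eb j))^[n] u p| ≤ (8 * (Λ + N) / R * n) ^ n * M := by
  have hn' : (0 : ℝ) < n := by exact_mod_cast hn
  have key : ∀ i ≤ n, ∀ q ∈ Metric.closedBall p (R * (1 - i / n)),
      |(pd (eb j))^[i] u q| ≤ (8 * (Λ + N) / R * n) ^ i * M := by
    intro i
    induction i with
    | zero => intro _ q hq; simpa using hb q (by simpa using hq)
    | succ i ih =>
      intro hi q hq
      have hsub : Metric.closedBall q (2 * (R / (2 * n))) ⊆
          Metric.closedBall p (R * (1 - i / n)) := by
        refine Metric.closedBall_subset_closedBall' ?_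
        rw [Metric.mem_closedBall] at hq
        push_cast at hq
        have : 2 * (R / (2 * n)) + R * (1 - (i + 1) / n) = R * (1 - i / n) := by field_simp; ring
        linarith
      have hsub2 : Metric.closedBall p (R * (1 - i / n)) ⊆ Metric.closedBall p R := by
        refine Metric.closedBall_subset_closedBall ?_
        have : (0 : ℝ) ≤ i / n := by positivity
        nlinarith
      have h := (hu.pd_iterate hV ha j i).abs_pd_le hV (p₀ := q) (ρ := R / (2 * n))
        (M := (8 * (Λ + N) / R * n) ^ i * M) (Λ := Λ) (by positivity)
        (hsub.trans (hsub2.trans hball)) (fun q' hq' => ih (by omega) q' (hsub hq'))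
        (fun q' hq' => ⟨(ha q' (hball (hsub2 (hsub hq')))).1.le, haΛ q' (hsub2 (hsub hq'))⟩) j
      rw [Function.iterate_succ_apply']
      refine h.trans (le_of_eq ?_)
      have hr : 4 * (Λ + N) / (R / (2 * n)) = 8 * (Λ + N) / R * n := by field_simp; ring
      rw [hr, pow_succ']
      ring
  exact key n le_rfl p (by simp [div_self hn'.ne'])

theorem abs_le_pow_of_vanishing {g : ℕ → ℝ → ℝ} {δ B : ℝ} {n : ℕ}
    (hg : ∀ k, ∀ t ∈ Icc 0 δ, HasDerivAt (g k) (g (k + 1) t) t) (h0 : ∀ k, g k 0 = 0)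
    (hB : ∀ t ∈ Icc 0 δ, |g n t| ≤ B) :
    ∀ m k, k + m = n → ∀ t ∈ Icc 0 δ, |g k t| ≤ B * (t ^ m / m.factorial) := by
  intro m
  induction m with
  | zero => rintro k rfl t ht; simpa using hB t ht
  | succ m ih =>
    intro k hk t ht
    have h1 := image_norm_le_of_norm_deriv_right_le_deriv_boundary (a := 0) (b := δ) (f := g k)
      (f' := g (k + 1)) (B := fun t => B * (t ^ (m + 1) / (m + 1).factorial))
      (B' := fun t => B * (t ^ m / m.factorial))
      (fun t ht => (hg k t ht).continuousAt.continuousWithinAt)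
      (fun t ht => (hg k t (Ico_subset_Icc_self ht)).hasDerivWithinAt)
      (by simp [h0])
      (fun t => by
        refine (((hasDerivAt_pow (m + 1) t).div_const _).const_mul B).congr_deriv ?_
        rw [Nat.factorial_succ]
        push_cast
        have : (m.factorial : ℝ) ≠ 0 := by positivity
        field_simp)
      (fun t ht => ih (k + 1) (by omega) t (Ico_subset_Icc_self ht)) ht
    exact h1

theorem Sol.eq_zero_right {N : ℕ} {a : ℝ → ℝ} {V : Set (Euc N × ℝ)} (hV : IsOpen V)
    (ha : ∀ p ∈ V, 0 < a p.2 ∧ ContinuousAt a p.2) {u : Euc N × ℝ → ℝ} (hu : Sol a V u)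
    (j : Fin N) {p : Euc N × ℝ} {R Λ : ℝ} (hR : 0 < R) (hΛ : 0 ≤ Λ)
    (hball : Metric.closedBall p R ⊆ V) (haΛ : ∀ q ∈ Metric.closedBall p R, a q.2 ≤ Λ)
    (h0 : ∀ k, (pd (eb j))^[k] u p = 0) {δ : ℝ} (hδ : δ ≤ R / 2)
    (hδ' : Real.exp 1 * (16 * (Λ + N) / R) * δ < 1) :
    ∀ t ∈ Icc 0 δ, u (p + t • eb j) = 0 := by
  intro t ht
  obtain ⟨M, hM⟩ := (isCompact_closedBall p R).exists_bound_of_continuousOn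
    (hu.contDiffOn.continuousOn.mono hball)
  have hM0 : 0 ≤ M := (norm_nonneg _).trans (hM p (Metric.mem_closedBall_self hR.le))
  have hsub : ∀ s ∈ Icc 0 δ, Metric.closedBall (p + s • eb j) (R / 2) ⊆ Metric.closedBall p R := by
    intro s hs
    refine Metric.closedBall_subset_closedBall' ?_
    have h := norm_smul_eb_le j s
    rw [abs_of_nonneg hs.1] at h
    rw [dist_eq_norm, add_sub_cancel_left]
    linarith [hs.2]
  have hmem : ∀ s ∈ Icc 0 δ, p + s • eb j ∈ V := fun s hs =>
    hball (hsub s hs (Metric.mem_closedBall_self (by positivity)))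
  have hder : ∀ k, ∀ s ∈ Icc 0 δ, HasDerivAt (fun s : ℝ => (pd (eb j))^[k] u (p + s • eb j))
      ((pd (eb j))^[k + 1] u (p + s • eb j)) s := by
    intro k s hs
    rw [Function.iterate_succ_apply']
    exact hasDerivAt_line (((hu.pd_iterate hV ha j k).contDiffOn.contDiffAt
      (hV.mem_nhds (hmem s hs))).differentiableAt (by simp))
  set K := 16 * (Λ + N) / R with hK
  have hK0 : 0 ≤ K := by positivity
  have hbd : ∀ n : ℕ, 0 < n → |u (p + t • eb j)| ≤ M * (Real.exp 1 * K * t) ^ n := by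
    intro n hn
    have h1 := abs_le_pow_of_vanishing (g := fun k s => (pd (eb j))^[k] u (p + s • eb j))
      (δ := δ) (B := (K * n) ^ n * M) (n := n) hder (fun k => by simpa using h0 k)
      (fun s hs => by
        have := hu.abs_pd_iterate_le hV ha j (p := p + s • eb j) (R := R / 2) (M := M) (Λ := Λ)
          (by positivity) ((hsub s hs).trans hball) (fun q hq => hM q (hsub s hs hq))
          (fun q hq => haΛ q (hsub s hs hq)) hn
        have h2 : 8 * (Λ + N) / (R / 2) = K := by rw [hK]; field_simp; ring
        rwa [h2] at this) n 0 (by simp) t ht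
    simp only [Function.iterate_zero, id] at h1
    refine h1.trans ?_
    have h3 := Real.pow_div_factorial_le_exp n (n.cast_nonneg) n
    have h4 : Real.exp n = Real.exp 1 ^ n := by rw [← Real.exp_nat_mul, mul_one]
    rw [h4] at h3
    calc (K * n) ^ n * M * (t ^ n / n.factorial) = M * (K ^ n * t ^ n) * ((n : ℝ) ^ n / n.factorial) := by
          rw [mul_pow]; ring
      _ ≤ M * (K ^ n * t ^ n) * Real.exp 1 ^ n := by
          have := ht.1
          gcongr
      _ = _ := by rw [mul_pow, mul_pow]; ring
  have hlt : Real.exp 1 * K * t < 1 :=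
    (mul_le_mul_of_nonneg_left ht.2 (by positivity)).trans_lt hδ'
  have hlim := (tendsto_pow_atTop_nhds_zero_of_lt_one
    (mul_nonneg (by positivity : (0 : ℝ) ≤ Real.exp 1 * K) ht.1) hlt).const_mul M
  rw [mul_zero] at hlim
  have := ge_of_tendsto hlim ((eventually_gt_atTop 0).mono hbd)
  exact abs_eq_zero.1 (le_antisymm this (abs_nonneg _))

theorem Sol.eventually_eq_zero_right {N : ℕ} {a : ℝ → ℝ} {V : Set (Euc N × ℝ)} (hV : IsOpen V)
    (ha : ∀ p ∈ V, 0 < a p.2 ∧ ContinuousAt a p.2) {u : Euc N × ℝ → ℝ} (hu : Sol a V u)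
    (j : Fin N) {p : Euc N × ℝ} (hp : p ∈ V) (h0 : ∀ k, (pd (eb j))^[k] u p = 0) :
    ∃ δ : ℝ, 0 < δ ∧ ∀ k, ∀ t ∈ Icc 0 δ, (pd (eb j))^[k] u (p + t • eb j) = 0 := by
  have hca : ContinuousAt (fun q : Euc N × ℝ => a q.2) p := (ha p hp).2.comp continuous_snd.continuousAt
  have h1 : ∀ᶠ q in 𝓝 p, q ∈ V ∧ a q.2 < 2 * a p.2 := by
    have := (ha p hp).1
    filter_upwards [hV.mem_nhds hp,
      hca.eventually_lt_const (by linarith : a p.2 < 2 * a p.2)] with q h1 h3 using ⟨h1, h3⟩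
  obtain ⟨R, hR, hsub⟩ := Metric.nhds_basis_closedBall.eventually_iff.1 h1
  have hΛ : 0 ≤ 2 * a p.2 := by linarith [(ha p hp).1]
  have hK : 0 ≤ Real.exp 1 * (16 * (2 * a p.2 + N) / R) := by positivity
  set K := Real.exp 1 * (16 * (2 * a p.2 + N) / R)
  refine ⟨min (R / 2) (1 / (K + 1)), by positivity, fun k => ?_⟩
  refine (hu.pd_iterate hV ha j k).eq_zero_right hV ha j hR hΛ (fun q hq => (hsub hq).1)
    (fun q hq => (hsub hq).2.le) (fun m => ?_) (min_le_left _ _) ?_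
  · rw [← Function.iterate_add_apply]; exact h0 _
  · calc K * min (R / 2) (1 / (K + 1)) ≤ K * (1 / (K + 1)) := by gcongr; exact min_le_right _ _
      _ < 1 := by rw [mul_one_div, div_lt_one (by positivity)]; linarith

theorem countable_zeros_of_ne {g : ℕ → ℝ → ℝ} {I : Set ℝ}
    (hg : ∀ k, ∀ t ∈ I, HasDerivAt (g k) (g (k + 1) t) t)
    (h : ∀ t ∈ I, ∃ k, g k t ≠ 0) : {t ∈ I | g 0 t = 0}.Countable := by
  have hsub : {t ∈ I | g 0 t = 0} ⊆ ⋃ k, {t ∈ {t | t ∈ I ∧ g k t = 0} |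
      𝓝[{t | t ∈ I ∧ g k t = 0} ∩ Ioi t] t = ⊥} := by
    rintro t ⟨ht, h0⟩
    have hex := h t ht
    classical
    have hk := Nat.find_spec hex
    have hmin := fun m => Nat.find_min hex (m := m)
    obtain ⟨k, hkk⟩ : ∃ k, Nat.find hex = k + 1 :=
      Nat.exists_eq_succ_of_ne_zero fun hz => by rw [hz] at hk; exact hk h0
    rw [hkk] at hk hmin
    have hk0 : g k t = 0 := by simpa using hmin k (by omega)
    refine mem_iUnion.2 ⟨k, ⟨ht, hk0⟩, ?_⟩
    have hne := (hg k t ht).eventually_ne (c := 0) hk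
    rw [← empty_mem_iff_bot]
    have h1 : {s | g k s ≠ 0} ∈ 𝓝[{t | t ∈ I ∧ g k t = 0} ∩ Ioi t] t :=
      nhdsWithin_mono t (fun s hs => (mem_Ioi.1 hs.2).ne') hne
    filter_upwards [h1, self_mem_nhdsWithin] with s h2 h3 using h2 h3.1.2
  exact (countable_iUnion fun k => countable_setOfPred_isolated_right_within).mono hsub

/-- A nonnegative solution of `a(z) ∂²_z u + Δ_x u = 0` on the cylinder `Ω × (0,∞)` over an open
bounded set, bounded with its first two derivatives, vanishing on the lateral boundary. -/
structure CylSol {N : ℕ} (a : ℝ → ℝ) (Ω : Set (Euc N)) (u : Euc N × ℝ → ℝ) (M : ℝ) : Prop where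
  isOpen : IsOpen Ω
  isBounded : Bornology.IsBounded Ω
  pos : ∀ z, 0 < z → 0 < a z
  smooth : ∀ z, 0 < z → ContDiffAt ℝ ∞ a z
  sol : Sol a (Ω ×ˢ Ioi 0) u
  cont : ∀ x ∈ closure Ω, ∀ z, 0 < z → ContinuousWithinAt u (closure Ω ×ˢ Ioi 0) (x, z)
  nonneg : ∀ x ∈ Ω, ∀ z, 0 < z → 0 ≤ u (x, z)
  lateral : ∀ x ∈ frontier Ω, ∀ z, 0 < z → u (x, z) = 0
  bound : ∀ x ∈ Ω, ∀ z, 0 < z → u (x, z) ≤ M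
  bound₁ : ∀ x ∈ Ω, ∀ z, 0 < z → ‖fderiv ℝ u (x, z)‖ ≤ M
  bound₂ : ∀ x ∈ Ω, ∀ z, 0 < z → ‖fderiv ℝ (fderiv ℝ u) (x, z)‖ ≤ M

theorem exists_exit {I : Set ℝ} (hI : IsOpen I) {t₀ b : ℝ} (h0 : t₀ ∈ I) (hb : ∀ t ∈ I, t ≤ b) :
    ∃ T, t₀ < T ∧ T ∉ I ∧ Ico t₀ T ⊆ I := by
  set S := {t | t₀ ≤ t ∧ t ∉ I} with hS
  have hne : S.Nonempty := ⟨max t₀ (b + 1), le_max_left _ _, fun h => by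
    have h1 := hb _ h
    have h2 := le_max_right t₀ (b + 1)
    linarith⟩
  have hbd : BddBelow S := ⟨t₀, fun t ht => ht.1⟩
  have hcl : IsClosed S := isClosed_Ici.inter hI.isClosed_compl
  have hmem := hcl.csInf_mem hne hbd
  refine ⟨sInf S, lt_of_le_of_ne hmem.1 fun h => hmem.2 (h ▸ h0), hmem.2, fun t ht => ?_⟩
  by_contra hn
  exact absurd (csInf_le hbd ⟨ht.1, hn⟩) (not_le.2 ht.2)

namespace CylSol

variable {N : ℕ} {a : ℝ → ℝ} {Ω : Set (Euc N)} {u : Euc N × ℝ → ℝ} {M : ℝ}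

theorem isOpen_cyl (h : CylSol a Ω u M) : IsOpen (Ω ×ˢ Ioi (0 : ℝ)) := h.isOpen.prod isOpen_Ioi

theorem contDiffOn_infty (h : CylSol a Ω u M) : ContDiffOn ℝ ∞ u (Ω ×ˢ Ioi 0) :=
  h.sol.contDiffOn_infty h.isOpen_cyl fun _ hp => ⟨h.pos _ hp.2, h.smooth _ hp.2⟩

theorem contDiffAt (h : CylSol a Ω u M) {x : Euc N} (hx : x ∈ Ω) {z : ℝ} (hz : 0 < z) :
    ContDiffAt ℝ ∞ u (x, z) :=
  h.contDiffOn_infty.contDiffAt (h.isOpen_cyl.mem_nhds ⟨hx, hz⟩)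

theorem continuousOn_slice (h : CylSol a Ω u M) {z : ℝ} (hz : 0 < z) :
    ContinuousOn (fun x => u (x, z)) (closure Ω) := fun x hx =>
  (h.cont x hx z hz).comp (f := fun x => (x, z)) (by fun_prop) fun _ hy =>
    mk_mem_prod hy (mem_Ioi.2 hz)

theorem measurableSet_slice (h : CylSol a Ω u M) {z : ℝ} (hz : 0 < z) {B : Set ℝ}
    (hB : MeasurableSet B) : MeasurableSet {x | x ∈ Ω ∧ u (x, z) ∈ B} := by
  have h1 : Measurable (Ω.domRestrict fun x => u (x, z)) :=
    (continuousOn_iff_continuous_domRestrict.1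
      ((h.continuousOn_slice hz).mono subset_closure)).measurable
  have h2 := h.isOpen.measurableSet.subtype_image (h1 hB)
  convert h2 using 1
  ext x
  simp [and_comm]

theorem volume_level_eq_zero (h : CylSol a Ω u M) (hN : 0 < N) {z : ℝ} (hz : 0 < z) {c : ℝ}
    (hc : 0 < c) : volume {x | x ∈ Ω ∧ u (x, z) = c} = 0 := by
  set e : Euc N := EuclideanSpace.single ⟨0, hN⟩ 1 with he
  have hmeas : MeasurableSet {x | x ∈ Ω ∧ u (x, z) = c} :=
    h.measurableSet_slice hz (measurableSet_singleton c)
  suffices h1 : ∀ᵐ x : Euc N, x ∈ {x | x ∈ Ω ∧ u (x, z) = c}ᶜ by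
    simpa [ae_iff] using h1
  refine ae_mem_of_ae_add_linearMap_mem (LinearMap.toSpanSingleton ℝ (Euc N) e)
    (volume : Measure ℝ) volume hmeas.compl fun x => ?_
  refine Set.Countable.ae_notMem (s := {t | (x + t • e) ∈ Ω ∧ u (x + t • e, z) = c}) ?_ volume
  set V := Ω ×ˢ Ioi (0 : ℝ)
  have hV : IsOpen V := h.isOpen_cyl
  have ha : ∀ p ∈ V, 0 < a p.2 ∧ ContinuousAt a p.2 := fun p hp =>
    ⟨h.pos _ hp.2, (h.smooth _ hp.2).continuousAt⟩
  have hv : Sol a V (fun p => u p - c) := h.sol.sub hV (Sol.const a V c)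
  set j : Fin N := ⟨0, hN⟩
  set I := {t : ℝ | x + t • e ∈ Ω} with hI
  have hline : Continuous fun t : ℝ => x + t • e := by fun_prop
  have hIo : IsOpen I := h.isOpen.preimage hline
  set g : ℕ → ℝ → ℝ := fun k t => (pd (eb j))^[k] (fun p => u p - c) (x + t • e, z) with hgdef
  have hpt : ∀ t : ℝ, ((x, z) : Euc N × ℝ) + t • eb j = (x + t • e, z) := fun t => by
    ext <;> simp [eb, he, j]
  have hpt' : ∀ t s : ℝ, ((x + t • e, z) : Euc N × ℝ) + s • eb j = (x + (t + s) • e, z) :=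
    fun t s => by rw [← hpt, ← hpt, add_assoc, ← add_smul]
  have hg : ∀ k, ∀ t ∈ I, HasDerivAt (g k) (g (k + 1) t) t := by
    intro k t ht
    have hs := hv.pd_iterate hV ha j k
    have h1 := hasDerivAt_line (u := (pd (eb j))^[k] fun p => u p - c) (q := (x, z)) (e := eb j)
      (s := t) ((hs.contDiffOn.contDiffAt (hV.mem_nhds (by rw [hpt]; exact ⟨ht, hz⟩))).differentiableAt
        (by simp))
    simp only [hpt] at h1
    simp only [hgdef, Function.iterate_succ_apply']
    exact h1
  have hcount := countable_zeros_of_ne (g := g) hg fun t₀ ht₀ => by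
    by_contra! hall
    obtain ⟨r, hr⟩ := h.isBounded.subset_ball x
    obtain ⟨T, hT0, hTI, hTsub⟩ := exists_exit hIo ht₀ (b := r) fun t ht => by
      have := hr ht
      rw [mem_ball_iff_norm, add_sub_cancel_left, norm_smul] at this
      have he1 : ‖e‖ = 1 := by simp [he]
      rw [he1, mul_one] at this
      exact (le_abs_self t).trans this.le
    have hzero : ∀ t ∈ Ico t₀ T, u (x + t • e, z) = c := by
      intro t ht
      have hIcc : Icc t₀ t ⊆ I := fun s hs => hTsub ⟨hs.1, hs.2.trans_lt ht.2⟩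
      have hsubset : Icc t₀ t ⊆ {s | ∀ k, g k s = 0} := by
        refine IsClosed.Icc_subset_of_forall_mem_nhdsWithin ?_ hall ?_
        · have : {s | ∀ k, g k s = 0} ∩ Icc t₀ t = ⋂ k, Icc t₀ t ∩ g k ⁻¹' {0} := by
            ext s; simp [forall_and, and_comm]
          rw [this]
          exact isClosed_iInter fun k => ContinuousOn.preimage_isClosed_of_isClosed
            (fun s hs => (hg k s (hIcc hs)).continuousAt.continuousWithinAt) isClosed_Icc
            isClosed_singleton
        · rintro s ⟨hs, hs'⟩
          obtain ⟨δ, hδ, hδ'⟩ := hv.eventually_eq_zero_right hV ha j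
            (p := (x + s • e, z)) ⟨hIcc (Ico_subset_Icc_self hs'), hz⟩ hs
          have : Ioo s (s + δ) ∈ 𝓝[>] s := Ioo_mem_nhdsGT (by linarith)
          filter_upwards [this] with s' hs'' k
          have := hδ' k (s' - s) ⟨by linarith [hs''.1], by linarith [hs''.2]⟩
          rw [hpt', add_sub_cancel] at this
          exact this
      have := hsubset ⟨ht.1, le_rfl⟩ 0
      simp only [hgdef, Function.iterate_zero, id] at this
      linarith
    have hlim : Tendsto (fun t : ℝ => x + t • e) (𝓝[<] T) (𝓝 (x + T • e)) :=
      (hline.tendsto T).mono_left nhdsWithin_le_nhds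
    have hev : ∀ᶠ t in 𝓝[<] T, t ∈ Ico t₀ T := by
      filter_upwards [Ioo_mem_nhdsLT hT0] with t ht using ⟨ht.1.le, ht.2⟩
    have hcl : x + T • e ∈ closure Ω :=
      mem_closure_of_tendsto hlim (hev.mono fun t ht => hTsub ht)
    have hfr : x + T • e ∈ frontier Ω := by
      rw [h.isOpen.frontier_eq]; exact ⟨hcl, hTI⟩
    have h3 : Tendsto (fun t : ℝ => u (x + t • e, z)) (𝓝[<] T) (𝓝 (u (x + T • e, z))) :=
      (h.continuousOn_slice hz (x + T • e) hcl).tendsto.comp (tendsto_nhdsWithin_iff.2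
        ⟨hlim, hev.mono fun t ht => subset_closure (hTsub ht)⟩)
    have h4 : Tendsto (fun t : ℝ => u (x + t • e, z)) (𝓝[<] T) (𝓝 c) :=
      tendsto_const_nhds.congr' (hev.mono fun t ht => (hzero t ht).symm)
    have := tendsto_nhds_unique h3 h4
    rw [h.lateral _ hfr z hz] at this
    exact hc.ne this
  refine hcount.mono fun t ht => ?_
  have h1 : x + t • e ∈ Ω := ht.1
  have h2 : u (x + t • e, z) = c := ht.2
  exact ⟨h1, by simp [hgdef, h2]⟩

end CylSol

section

open scoped Pointwise

theorem volume_add_le_of_isCompact {K L : Set ℝ} (hK : IsCompact K) (hL : IsCompact L)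
    (hKn : K.Nonempty) (hLn : L.Nonempty) : volume K + volume L ≤ volume (K + L) := by
  obtain ⟨m, hm, hm'⟩ := hL.exists_isLeast hLn
  obtain ⟨k, hk, hk'⟩ := hK.exists_isGreatest hKn
  have h1 : (fun x => x + m) '' K ∪ (fun x => k + x) '' L ⊆ K + L := by
    rintro _ (⟨x, hx, rfl⟩ | ⟨x, hx, rfl⟩)
    · exact add_mem_add hx hm
    · exact add_mem_add hk hx
  have hKL : IsCompact ((fun x => k + x) '' L) := hL.image (by fun_prop)
  have h2 : AEDisjoint volume ((fun x => x + m) '' K) ((fun x => k + x) '' L) := by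
    refine measure_mono_null (t := {k + m}) ?_ (by simp)
    rintro _ ⟨⟨x, hx, rfl⟩, ⟨y, hy, hxy⟩⟩
    have := hm' hy
    have := hk' hx
    simp only [mem_singleton_iff] at hxy ⊢
    linarith
  calc volume K + volume L = volume ((fun x => x + m) '' K) + volume ((fun x => k + x) '' L) := by
        rw [image_add_right, measure_preimage_add_right, image_add_left, measure_preimage_add]
    _ = volume ((fun x => x + m) '' K ∪ (fun x => k + x) '' L) :=
        (measure_union₀ hKL.measurableSet.nullMeasurableSet h2).symm
    _ ≤ _ := measure_mono h1

theorem volume_add_volume_le {A B : Set ℝ} (hA : MeasurableSet A) (hB : MeasurableSet B)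
    (hAn : A.Nonempty) (hBn : B.Nonempty) : volume A + volume B ≤ volume (A + B) := by
  obtain ⟨x, hx⟩ := hAn
  obtain ⟨y, hy⟩ := hBn
  rw [hA.measure_eq_iSup_isCompact, hB.measure_eq_iSup_isCompact]
  simp only [iSup_and']
  refine ENNReal.biSup_add_biSup_le' (p := fun K => K ⊆ A ∧ IsCompact K)
    (q := fun L => L ⊆ B ∧ IsCompact L) ⟨∅, empty_subset _, isCompact_empty⟩
    ⟨∅, empty_subset _, isCompact_empty⟩ fun K hK L hL => ?_
  have hK' : IsCompact (insert x K) := hK.2.insert x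
  have hL' : IsCompact (insert y L) := hL.2.insert y
  calc volume K + volume L ≤ volume (insert x K) + volume (insert y L) := by
        gcongr <;> exact subset_insert _ _
    _ ≤ volume (insert x K + insert y L) :=
        volume_add_le_of_isCompact hK' hL' (insert_nonempty _ _) (insert_nonempty _ _)
    _ ≤ volume (A + B) := measure_mono
        (add_subset_add (insert_subset hx hK.1) (insert_subset hy hL.1))

theorem prekopaLeindler_normalized {l : ℝ} (hl : l ∈ Ioo (0 : ℝ) 1) {f g h : ℝ → ℝ}
    (hf : Measurable f) (hg : Measurable g) (hh : Measurable h)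
    (hf0 : ∀ x, 0 ≤ f x) (hg0 : ∀ x, 0 ≤ g x) (hh0 : ∀ x, 0 ≤ h x)
    (hf1 : ∀ x, f x ≤ 1) (hg1 : ∀ x, g x ≤ 1)
    (hfs : ∀ t < 1, ∃ x, t < f x) (hgs : ∀ t < 1, ∃ x, t < g x)
    (H : ∀ x y, f x ^ (1 - l) * g y ^ l ≤ h ((1 - l) * x + l * y)) :
    ENNReal.ofReal (1 - l) * (∫⁻ x, ENNReal.ofReal (f x)) +
      ENNReal.ofReal l * (∫⁻ x, ENNReal.ofReal (g x)) ≤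
      ∫⁻ x, ENNReal.ofReal (h x) := by
  rw [lintegral_eq_lintegral_meas_lt _ (.of_forall hf0) hf.aemeasurable,
    lintegral_eq_lintegral_meas_lt _ (.of_forall hg0) hg.aemeasurable,
    lintegral_eq_lintegral_meas_lt _ (.of_forall hh0) hh.aemeasurable,
    ← lintegral_const_mul', ← lintegral_const_mul', ← lintegral_add_right']
  · refine setLIntegral_mono_ae' measurableSet_Ioi (.of_forall fun t ht => ?_)
    rw [mem_Ioi] at ht
    rcases le_or_gt 1 t with h1 | h1
    · have e1 : {x | t < f x} = ∅ := by ext x; simpa using (hf1 x).trans h1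
      have e2 : {x | t < g x} = ∅ := by ext x; simpa using (hg1 x).trans h1
      simp [e1, e2]
    have hl1 : 0 < 1 - l := by linarith [hl.2]
    have hA : MeasurableSet {x | t < f x} := measurableSet_lt measurable_const hf
    have hB : MeasurableSet {x | t < g x} := measurableSet_lt measurable_const hg
    have key := volume_add_volume_le (hA.const_smul₀ (1 - l)) (hB.const_smul₀ l)
      (Set.Nonempty.smul_set (hfs t h1)) (Set.Nonempty.smul_set (hgs t h1))
    rw [Measure.addHaar_smul, Measure.addHaar_smul] at key
    simp only [Module.finrank_self, pow_one, abs_of_pos hl1, abs_of_pos hl.1] at key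
    refine key.trans (measure_mono ?_)
    rintro _ ⟨_, ⟨x, hx, rfl⟩, _, ⟨y, hy, rfl⟩, rfl⟩
    refine lt_of_lt_of_le ?_ (H x y)
    have hx' : t < f x := hx
    have hy' : t < g y := hy
    calc t = t ^ (1 - l) * t ^ l := by rw [← Real.rpow_add ht]; simp
      _ < f x ^ (1 - l) * g y ^ l := by
        have a1 := Real.rpow_lt_rpow ht.le hx' hl1
        have a2 := Real.rpow_lt_rpow ht.le hy' hl.1
        have a3 : 0 ≤ t ^ (1 - l) := Real.rpow_nonneg ht.le _
        have a4 : 0 ≤ t ^ l := Real.rpow_nonneg ht.le _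
        exact mul_lt_mul'' a1 a2 a3 a4
  · refine (Antitone.measurable fun s t hst => ?_).const_mul _ |>.aemeasurable
    exact measure_mono fun x hx => lt_of_le_of_lt hst hx
  · simp
  · simp

theorem ENNReal.geom_mean_le_arith_mean2 {l : ℝ} (hl : l ∈ Ioo (0 : ℝ) 1) (X Y : ℝ≥0∞) :
    X ^ (1 - l) * Y ^ l ≤ ENNReal.ofReal (1 - l) * X + ENNReal.ofReal l * Y := by
  have hl1 : 0 < 1 - l := by linarith [hl.2]
  have hl0 := hl.1
  rcases eq_or_ne X ⊤ with rfl | hX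
  · rw [ENNReal.mul_top (by simpa using hl1)]; simp
  rcases eq_or_ne Y ⊤ with rfl | hY
  · rw [ENNReal.mul_top (a := ENNReal.ofReal l) (by simpa using hl0)]; simp
  lift X to ℝ≥0 using hX
  lift Y to ℝ≥0 using hY
  have := NNReal.geom_mean_le_arith_mean2_weighted (1 - l).toNNReal l.toNNReal X Y (by
    rw [← Real.toNNReal_add hl1.le hl0.le]; simp)
  rw [Real.coe_toNNReal _ hl1.le, Real.coe_toNNReal _ hl0.le] at this
  rw [← ENNReal.coe_rpow_of_nonneg _ hl1.le, ← ENNReal.coe_rpow_of_nonneg _ hl0.le]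
  simp only [ENNReal.ofReal]
  exact_mod_cast this

/-- The Prékopa–Leindler inequality for the measure `μ`. -/
def PrekopaLeindler {E : Type} [AddCommGroup E] [Module ℝ E] [MeasurableSpace E]
    (μ : Measure E) : Prop :=
  ∀ l ∈ Ioo (0 : ℝ) 1, ∀ f g h : E → ℝ≥0∞, Measurable f → Measurable g → Measurable h →
    (∀ x y, f x ^ (1 - l) * g y ^ l ≤ h ((1 - l) • x + l • y)) →
    (∫⁻ x, f x ∂μ) ^ (1 - l) * (∫⁻ x, g x ∂μ) ^ l ≤ ∫⁻ x, h x ∂μ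

theorem prekopaLeindler_of_bounded {l : ℝ} (hl : l ∈ Ioo (0 : ℝ) 1) {f g h : ℝ → ℝ≥0∞}
    (hf : Measurable f) (hg : Measurable g) (hh : Measurable h)
    (H : ∀ x y, f x ^ (1 - l) * g y ^ l ≤ h ((1 - l) • x + l • y)) {C : ℝ≥0∞} (hC : C ≠ ⊤)
    (hfC : ∀ x, f x ≤ C) (hgC : ∀ x, g x ≤ C) :
    (∫⁻ x, f x) ^ (1 - l) * (∫⁻ x, g x) ^ l ≤ ∫⁻ x, h x := by
  have hl1 : 0 < 1 - l := by linarith [hl.2]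
  have hl0 := hl.1
  have hat : (⨆ x, f x) ≠ ⊤ := ne_top_of_le_ne_top hC (iSup_le hfC)
  have hbt : (⨆ x, g x) ≠ ⊤ := ne_top_of_le_ne_top hC (iSup_le hgC)
  rcases eq_or_ne (⨆ x, f x) 0 with ha | ha
  · have : f = fun _ => 0 := by funext x; simpa using (iSup_eq_bot.1 ha) x
    simp [this, ENNReal.zero_rpow_of_pos hl1]
  rcases eq_or_ne (⨆ x, g x) 0 with hb | hb
  · have : g = fun _ => 0 := by funext x; simpa using (iSup_eq_bot.1 hb) x
    simp [this, ENNReal.zero_rpow_of_pos hl0]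
  have hfa : ∀ x, f x ≤ ⨆ x, f x := le_iSup f
  have hgb : ∀ x, g x ≤ ⨆ x, g x := le_iSup g
  have hsup : ∀ {f : ℝ → ℝ≥0∞} {a : ℝ≥0∞}, a = ⨆ x, f x → a ≠ 0 → a ≠ ⊤ → ∀ t < (1 : ℝ),
      ∃ x, t < (f x / a).toReal := by
    intro f a haf ha0 hat t ht
    rcases lt_or_ge t 0 with h0 | h0
    · exact ⟨0, h0.trans_le ENNReal.toReal_nonneg⟩
    have h1 : ENNReal.ofReal t * a < ⨆ x, f x := by
      rw [← haf]
      conv_rhs => rw [← one_mul a]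
      exact (ENNReal.mul_lt_mul_iff_left ha0 hat).2 (by rw [← ENNReal.ofReal_one]; exact ENNReal.ofReal_lt_ofReal_iff'.2 ⟨ht, one_pos⟩)
    obtain ⟨x, hx⟩ := lt_iSup_iff.1 h1
    refine ⟨x, ?_⟩
    rw [← ENNReal.lt_div_iff_mul_lt (.inl ha0) (.inl hat)] at hx
    have hft : f x / a ≠ ⊤ := ENNReal.div_ne_top (ne_top_of_le_ne_top hat (haf ▸ le_iSup f x)) ha0
    exact (ENNReal.ofReal_lt_iff_lt_toReal h0 hft).1 hx
  have hfs := hsup (f := f) rfl ha hat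
  have hgs := hsup (f := g) rfl hb hbt
  generalize (⨆ x, f x) = A at *
  generalize (⨆ x, g x) = B at *
  have hf1 : ∀ x, f x / A ≤ 1 := fun x => ENNReal.div_le_of_le_mul (by simpa using hfa x)
  have hg1 : ∀ x, g x / B ≤ 1 := fun x => ENNReal.div_le_of_le_mul (by simpa using hgb x)
  set c := A ^ (1 - l) * B ^ l with hc
  have hA' : A ^ (1 - l) ≠ 0 ∧ A ^ (1 - l) ≠ ⊤ :=
    ⟨by simp [ENNReal.rpow_eq_zero_iff, ha, hat], by simp [ENNReal.rpow_eq_top_iff, ha, hat]⟩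
  have hB' : B ^ l ≠ 0 ∧ B ^ l ≠ ⊤ :=
    ⟨by simp [ENNReal.rpow_eq_zero_iff, hb, hbt], by simp [ENNReal.rpow_eq_top_iff, hb, hbt]⟩
  have hc0 : c ≠ 0 := mul_ne_zero hA'.1 hB'.1
  have hct : c ≠ ⊤ := ENNReal.mul_ne_top hA'.2 hB'.2
  have hdiv : ∀ X Y : ℝ≥0∞, (X / A) ^ (1 - l) * (Y / B) ^ l = X ^ (1 - l) * Y ^ l / c := by
    intro X Y
    rw [ENNReal.div_rpow_of_nonneg _ _ hl1.le, ENNReal.div_rpow_of_nonneg _ _ hl0.le, hc,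
      div_eq_mul_inv, div_eq_mul_inv, div_eq_mul_inv,
      ENNReal.mul_inv (.inl hA'.1) (.inl hA'.2)]
    ring
  have key := prekopaLeindler_normalized hl (f := fun x => (f x / A).toReal)
    (g := fun x => (g x / B).toReal) (h := fun x => (min (h x / c) 1).toReal)
    (by fun_prop) (by fun_prop) (by fun_prop)
    (fun x => ENNReal.toReal_nonneg) (fun x => ENNReal.toReal_nonneg)
    (fun x => ENNReal.toReal_nonneg)
    (fun x => by simpa using ENNReal.toReal_mono ENNReal.one_ne_top (hf1 x))
    (fun x => by simpa using ENNReal.toReal_mono ENNReal.one_ne_top (hg1 x))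
    hfs hgs fun x y => by
      rw [ENNReal.toReal_rpow, ENNReal.toReal_rpow, ← ENNReal.toReal_mul]
      refine ENNReal.toReal_mono (ne_top_of_le_ne_top ENNReal.one_ne_top (min_le_right _ _)) ?_
      refine le_min ?_ ?_
      · rw [hdiv]
        gcongr
        exact H x y
      · exact mul_le_one' (ENNReal.rpow_le_one (hf1 x) hl1.le) (ENNReal.rpow_le_one (hg1 y) hl0.le)
  have e1 : ∀ x, ENNReal.ofReal (f x / A).toReal = f x / A := fun x =>
    ENNReal.ofReal_toReal (ne_top_of_le_ne_top ENNReal.one_ne_top (hf1 x))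
  have e2 : ∀ x, ENNReal.ofReal (g x / B).toReal = g x / B := fun x =>
    ENNReal.ofReal_toReal (ne_top_of_le_ne_top ENNReal.one_ne_top (hg1 x))
  have e3 : ∫⁻ x, ENNReal.ofReal (min (h x / c) 1).toReal ≤ (∫⁻ x, h x) / c := by
    rw [div_eq_mul_inv, ← lintegral_mul_const _ hh]
    exact lintegral_mono fun x => ENNReal.ofReal_toReal_le.trans (min_le_left _ _)
  simp only [e1, e2] at key
  simp only [div_eq_mul_inv] at key
  rw [lintegral_mul_const _ hf, lintegral_mul_const _ hg] at key
  simp only [← div_eq_mul_inv] at key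
  have := ((ENNReal.geom_mean_le_arith_mean2 hl _ _).trans key).trans e3
  rw [hdiv] at this
  rwa [ENNReal.div_le_iff hc0 hct, ENNReal.div_mul_cancel hc0 hct] at this

theorem prekopaLeindler_real : PrekopaLeindler (volume : Measure ℝ) := by
  intro l hl f g h hf hg hh H
  have hl1 : 0 < 1 - l := by linarith [hl.2]
  have hl0 := hl.1
  have hn : ∀ n : ℕ, (∫⁻ x, min (f x) n) ^ (1 - l) * (∫⁻ x, min (g x) n) ^ l ≤ ∫⁻ x, h x := by
    intro n
    refine prekopaLeindler_of_bounded hl (by fun_prop) (by fun_prop) hh (fun x y => ?_)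
      (C := n) (by simp) (fun x => min_le_right _ _) (fun x => min_le_right _ _)
    refine le_trans ?_ (H x y)
    gcongr <;> exact min_le_left _ _
  have hlim : ∀ {f : ℝ → ℝ≥0∞}, Measurable f →
      Tendsto (fun n : ℕ => ∫⁻ x, min (f x) n) atTop (𝓝 (∫⁻ x, f x)) := by
    intro f hf
    refine lintegral_tendsto_of_tendsto_of_monotone (fun n => by fun_prop)
      (.of_forall fun x m n hmn => by dsimp only; gcongr) (.of_forall fun x => ?_)
    have : Tendsto (fun n : ℕ => min (f x) n) atTop (𝓝 (min (f x) ⊤)) :=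
      tendsto_const_nhds.min ENNReal.tendsto_nat_nhds_top
    simpa using this
  rcases eq_or_ne (∫⁻ x, f x) 0 with h0 | h0
  · simp [h0, ENNReal.zero_rpow_of_pos hl1]
  rcases eq_or_ne (∫⁻ x, g x) 0 with h0' | h0'
  · simp [h0', ENNReal.zero_rpow_of_pos hl0]
  refine le_of_tendsto (ENNReal.Tendsto.mul ((hlim hf).ennrpow_const (1 - l)) (.inl ?_)
    ((hlim hg).ennrpow_const l) (.inl ?_)) (.of_forall hn)
  · simp [ENNReal.rpow_eq_zero_iff, h0, not_lt.2 hl1.le]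
  · simp [ENNReal.rpow_eq_zero_iff, h0', not_lt.2 hl0.le]

theorem PrekopaLeindler.prod {E F : Type} [AddCommGroup E] [Module ℝ E] [MeasurableSpace E]
    [AddCommGroup F] [Module ℝ F] [MeasurableSpace F] {μ : Measure E} {ν : Measure F} [SFinite ν]
    (hμ : PrekopaLeindler μ) (hν : PrekopaLeindler ν) : PrekopaLeindler (μ.prod ν) := by
  intro l hl f g h hf hg hh H
  rw [lintegral_prod _ hf.aemeasurable, lintegral_prod _ hg.aemeasurable,
    lintegral_prod _ hh.aemeasurable]
  refine hμ l hl _ _ _ hf.lintegral_prod_right' hg.lintegral_prod_right' hh.lintegral_prod_right'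
    fun x y => ?_
  exact hν l hl _ _ _ (hf.comp measurable_prodMk_left) (hg.comp measurable_prodMk_left)
    (hh.comp measurable_prodMk_left) fun x' y' => H (x, x') (y, y')

theorem PrekopaLeindler.of_measurePreserving {E F : Type} [AddCommGroup E] [Module ℝ E]
    [MeasurableSpace E] [AddCommGroup F] [Module ℝ F] [MeasurableSpace F] {μ : Measure E}
    {ν : Measure F} (hμ : PrekopaLeindler μ) (e : E → F) (he : MeasurePreserving e μ ν)
    (hlin : ∀ (s t : ℝ) x y, e (s • x + t • y) = s • e x + t • e y) : PrekopaLeindler ν := by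
  intro l hl f g h hf hg hh H
  rw [← he.lintegral_comp hf, ← he.lintegral_comp hg, ← he.lintegral_comp hh]
  refine hμ l hl _ _ _ (hf.comp he.measurable) (hg.comp he.measurable) (hh.comp he.measurable)
    fun x y => ?_
  rw [hlin]
  exact H _ _

theorem prekopaLeindler_pi (n : ℕ) : PrekopaLeindler (volume : Measure (Fin n → ℝ)) := by
  induction n with
  | zero =>
    intro l hl f g h hf hg hh H
    rw [Measure.volume_pi_eq_dirac 0, lintegral_dirac' _ hf, lintegral_dirac' _ hg,
      lintegral_dirac' _ hh]
    simpa using H 0 0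
  | succ n ih =>
    have h1 : PrekopaLeindler (volume : Measure (ℝ × (Fin n → ℝ))) := prekopaLeindler_real.prod ih
    exact h1.of_measurePreserving _
      (volume_preserving_piFinSuccAbove (fun _ : Fin (n + 1) => ℝ) 0).symm fun s t x y => by
        refine (MeasurableEquiv.piFinSuccAbove (fun _ : Fin (n + 1) => ℝ) 0).injective ?_
        rw [MeasurableEquiv.apply_symm_apply]
        refine Prod.ext ?_ ?_
        · simp
        · simp
          rfl

theorem prekopaLeindler_euc (N : ℕ) : PrekopaLeindler (volume : Measure (Euc N)) :=
  (prekopaLeindler_pi N).of_measurePreserving _ (PiLp.volume_preserving_toLp (Fin N))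
    fun s t x y => by simp

theorem omegaN_pos (N : ℕ) : 0 < omegaN N :=
  ENNReal.toReal_pos (Metric.measure_ball_pos _ _ one_pos).ne' measure_ball_lt_top.ne

theorem add_pow_le_volume_add {N : ℕ} {A B : Set (Euc N)} (hA : MeasurableSet A)
    (hB : IsOpen B) {p q : ℝ} (hp : 0 < p) (hq : 0 < q)
    (hpA : volume A = ENNReal.ofReal (p ^ N)) (hqB : volume B = ENNReal.ofReal (q ^ N)) :
    ENNReal.ofReal ((p + q) ^ N) ≤ volume (A + B) := by
  have hpq : 0 < p + q := add_pos hp hq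
  set l := q / (p + q) with hl
  have hl0 : 0 < l := div_pos hq hpq
  have hl' : 1 - l = p / (p + q) := by rw [hl]; field_simp; ring
  have hl1 : 0 < 1 - l := by rw [hl']; exact div_pos hp hpq
  have hAB : IsOpen (A + B) := hB.add_left
  have key := prekopaLeindler_euc N l ⟨hl0, by linarith⟩
    (((1 - l) • · : Euc N → Euc N) ⁻¹' A |>.indicator 1)
    ((l • · : Euc N → Euc N) ⁻¹' B |>.indicator 1) ((A + B).indicator 1)
    (measurable_one.indicator (hA.preimage (measurable_const_smul _)))
    (measurable_one.indicator (hB.measurableSet.preimage (measurable_const_smul _)))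
    (measurable_one.indicator hAB.measurableSet) (fun x y => by
      by_cases hx : (1 - l) • x ∈ A
      · by_cases hy : l • y ∈ B
        · have : (1 - l) • x + l • y ∈ A + B := add_mem_add hx hy
          simp [indicator, hx, hy, this]
        · simp [indicator, hy, ENNReal.zero_rpow_of_pos hl0]
      · simp [indicator, hx, ENNReal.zero_rpow_of_pos hl1])
  rw [lintegral_indicator_one (hA.preimage (measurable_const_smul _)),
    lintegral_indicator_one (hB.measurableSet.preimage (measurable_const_smul _)),
    lintegral_indicator_one hAB.measurableSet, Measure.addHaar_preimage_smul _ hl1.ne',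
    Measure.addHaar_preimage_smul _ hl0.ne', hpA, hqB] at key
  refine le_trans (le_of_eq ?_) key
  have e1 : ENNReal.ofReal |((1 - l) ^ Module.finrank ℝ (Euc N))⁻¹| * ENNReal.ofReal (p ^ N) =
      ENNReal.ofReal ((p + q) ^ N) := by
    rw [← ENNReal.ofReal_mul (abs_nonneg _), abs_of_pos (by positivity), hl']
    congr 1
    simp only [finrank_euclideanSpace, Fintype.card_fin]
    rw [div_pow, inv_div, div_mul_cancel₀ _ (by positivity)]
  have e2 : ENNReal.ofReal |(l ^ Module.finrank ℝ (Euc N))⁻¹| * ENNReal.ofReal (q ^ N) =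
      ENNReal.ofReal ((p + q) ^ N) := by
    rw [← ENNReal.ofReal_mul (abs_nonneg _), abs_of_pos (by positivity), hl]
    congr 1
    simp only [finrank_euclideanSpace, Fintype.card_fin]
    rw [div_pow, inv_div, div_mul_cancel₀ _ (by positivity)]
  rw [e1, e2, ← ENNReal.rpow_add _ _ (by simp; positivity) (by simp)]
  simp

/-- The isoperimetric profile of `ℝ^N`. -/
def isoProfile (N : ℕ) (s : ℝ) : ℝ := N * omegaN N ^ (1 / (N : ℝ)) * s ^ (1 - 1 / (N : ℝ))

theorem volume_add_ball_ge {N : ℕ} (hN : 2 ≤ N) {A : Set (Euc N)} (hA : MeasurableSet A)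
    (hAt : volume A ≠ ⊤) {ε : ℝ} (hε : 0 < ε) :
    ENNReal.ofReal ((volume A).toReal + ε * isoProfile N (volume A).toReal) ≤
      volume (A + Metric.ball 0 ε) := by
  rcases eq_or_ne (volume A) 0 with h0 | h0
  · have : (1 - (N : ℝ)⁻¹) ≠ 0 := by
      have : (1 : ℝ) < N := by exact_mod_cast (by omega : 1 < N)
      have := inv_lt_one_of_one_lt₀ this
      linarith
    simp [h0, isoProfile, Real.zero_rpow this]
  have ha : 0 < (volume A).toReal := ENNReal.toReal_pos h0 hAt
  set a := (volume A).toReal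
  have hN0 : (N : ℝ) ≠ 0 := by exact_mod_cast (by omega : N ≠ 0)
  have hω := omegaN_pos N
  have : Nontrivial (Fin N) := Fin.nontrivial_iff_two_le.2 hN
  have key := add_pow_le_volume_add hA (Metric.isOpen_ball (x := (0 : Euc N)) (ε := ε))
    (p := a ^ (1 / (N : ℝ))) (q := ε * omegaN N ^ (1 / (N : ℝ))) (by positivity) (by positivity)
    (by rw [← Real.rpow_natCast, ← Real.rpow_mul ha.le, one_div, inv_mul_cancel₀ hN0,
          Real.rpow_one, ENNReal.ofReal_toReal hAt])
    (by rw [mul_pow, ← Real.rpow_natCast (_ ^ _), ← Real.rpow_mul hω.le, one_div,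
          inv_mul_cancel₀ hN0, Real.rpow_one, Measure.addHaar_ball _ _ hε.le,
          ENNReal.ofReal_mul (by positivity), omegaN, ENNReal.ofReal_toReal measure_ball_lt_top.ne]
        simp)
  refine le_trans (ENNReal.ofReal_le_ofReal ?_) key
  obtain ⟨n, rfl⟩ : ∃ n, N = n + 1 := ⟨N - 1, by omega⟩
  refine le_trans (le_of_eq ?_) (pow_add_mul_le_add_pow (a := a ^ (1 / ((n + 1 : ℕ) : ℝ)))
    (b := ε * omegaN (n + 1) ^ (1 / ((n + 1 : ℕ) : ℝ)))
    (by positivity) (by positivity) (n + 1))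
  rw [Nat.add_sub_cancel, ← Real.rpow_natCast, ← Real.rpow_natCast, ← Real.rpow_mul ha.le, ← Real.rpow_mul ha.le,
    one_div, inv_mul_cancel₀ hN0, Real.rpow_one, isoProfile]
  have : (1 - 1 / ((n + 1 : ℕ) : ℝ)) = ((n + 1 : ℕ) : ℝ)⁻¹ * n := by
    push_cast
    field_simp
    ring
  rw [this, one_div]
  push_cast
  ring

/-- A nonnegative function, smooth in the bounded open set `Ω` and vanishing outside, with bounds
on the derivatives up to order two. -/
structure Slice {N : ℕ} (Ω : Set (Euc N)) (f : Euc N → ℝ) (M : ℝ) : Prop where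
  isOpen : IsOpen Ω
  isBounded : Bornology.IsBounded Ω
  cont : Continuous f
  zero : ∀ x ∉ Ω, f x = 0
  nonneg : ∀ x, 0 ≤ f x
  bound : ∀ x, f x ≤ M
  smooth : ∀ x ∈ Ω, ContDiffAt ℝ ∞ f x
  bound₁ : ∀ x ∈ Ω, ‖fderiv ℝ f x‖ ≤ M
  bound₂ : ∀ x ∈ Ω, ‖fderiv ℝ (fderiv ℝ f) x‖ ≤ M

/-- The distribution function of `f`. -/
def distr {N : ℕ} (f : Euc N → ℝ) (t : ℝ) : ℝ := volume.real {x | t < f x}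

namespace Slice

variable {N : ℕ} {Ω : Set (Euc N)} {f : Euc N → ℝ} {M : ℝ}

theorem M_nonneg (h : Slice Ω f M) : 0 ≤ M := (h.nonneg 0).trans (h.bound 0)

theorem mem_of_pos (h : Slice Ω f M) {x : Euc N} (hx : 0 < f x) : x ∈ Ω := by
  by_contra hc
  exact hx.ne' (h.zero x hc)

theorem superlevel_subset (h : Slice Ω f M) {t : ℝ} (ht : 0 ≤ t) : {x | t < f x} ⊆ Ω :=
  fun _ hx => h.mem_of_pos (lt_of_le_of_lt ht hx)

theorem volume_lt_top (h : Slice Ω f M) : volume Ω < ⊤ := h.isBounded.measure_lt_top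

theorem volume_superlevel_lt_top (h : Slice Ω f M) {t : ℝ} (ht : 0 ≤ t) :
    volume {x | t < f x} < ⊤ :=
  (measure_mono (h.superlevel_subset ht)).trans_lt h.volume_lt_top

theorem isCompact_superlevel (h : Slice Ω f M) {t : ℝ} (ht : 0 < t) :
    IsCompact {x | t ≤ f x} :=
  Metric.isCompact_of_isClosed_isBounded (isClosed_le continuous_const h.cont)
    (h.isBounded.subset fun _ hx => h.mem_of_pos (lt_of_lt_of_le ht hx))

theorem measurable (h : Slice Ω f M) : Measurable f := h.cont.measurable

theorem distr_antitoneOn (h : Slice Ω f M) : AntitoneOn (distr f) (Ici 0) := fun _ hs _ _ hst =>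
  measureReal_mono (fun _ hx => lt_of_le_of_lt hst hx) (h.volume_superlevel_lt_top hs).ne

theorem norm_fderiv_sub_le (h : Slice Ω f M) {x y : Euc N} (hs : segment ℝ y x ⊆ Ω) :
    ∀ z ∈ segment ℝ y x, ‖fderiv ℝ f z - fderiv ℝ f y‖ ≤ M * ‖z - y‖ := by
  intro z hz
  refine Convex.norm_image_sub_le_of_norm_fderiv_le (𝕜 := ℝ) (fun q hq => ?_)
    (fun q hq => h.bound₂ q (hs hq)) (convex_segment y x) (left_mem_segment ℝ y x) hz
  exact ((h.smooth q (hs hq)).fderiv_right (m := ∞) (by simp)).differentiableAt (by simp)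

theorem taylor_le (h : Slice Ω f M) {x y : Euc N} (hs : segment ℝ y x ⊆ Ω) :
    |f x - f y - fderiv ℝ f y (x - y)| ≤ M * ‖x - y‖ ^ 2 := by
  have := Convex.norm_image_sub_le_of_norm_fderiv_le' (𝕜 := ℝ) (f := f) (φ := fderiv ℝ f y)
    (C := M * ‖x - y‖) (s := segment ℝ y x) (x := y) (y := x)
    (fun q hq => (h.smooth q (hs hq)).differentiableAt (by simp)) (fun q hq => ?_)
    (convex_segment y x) (left_mem_segment ℝ y x) (right_mem_segment ℝ y x)
  · rw [Real.norm_eq_abs] at this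
    exact this.trans (le_of_eq (by ring))
  · refine (h.norm_fderiv_sub_le hs q hq).trans ?_
    refine mul_le_mul_of_nonneg_left ?_ h.M_nonneg
    obtain ⟨θ, hθ, rfl⟩ := (segment_eq_image' ℝ y x ▸ hq)
    simp only [add_sub_cancel_left, norm_smul, Real.norm_eq_abs, abs_of_nonneg hθ.1]
    exact mul_le_of_le_one_left (norm_nonneg _) hθ.2

theorem exists_ball_subset (h : Slice Ω f M) {t : ℝ} (ht : 0 < t) :
    ∃ ε₀ : ℝ, 0 < ε₀ ∧ ∀ x, t ≤ f x → Metric.ball x ε₀ ⊆ Ω := by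
  obtain ⟨ε, hε, hs⟩ := (h.isCompact_superlevel ht).exists_thickening_subset_open h.isOpen
    fun _ hx => h.mem_of_pos (lt_of_lt_of_le ht hx)
  exact ⟨ε, hε, fun x hx => (Metric.ball_subset_thickening (E := {x | t ≤ f x}) hx ε).trans hs⟩

theorem eps_mul_iso_le (h : Slice Ω f M) (hN : 2 ≤ N) {t ε ε₀ : ℝ} (ht : 0 < t)
    (hε : 0 < ε) (hεε : ε ≤ ε₀) (hε₀ : ∀ x, t ≤ f x → Metric.ball x ε₀ ⊆ Ω) :
    ENNReal.ofReal (ε * isoProfile N (distr f t)) ≤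
      volume {y | y ∈ Ω ∧ f y ≤ t ∧ t < f y + (ε * ‖fderiv ℝ f y‖ + M * ε ^ 2)} := by
  have hA : MeasurableSet {x | t < f x} := measurableSet_lt measurable_const h.measurable
  have hAt := (h.volume_superlevel_lt_top ht.le).ne
  have key := volume_add_ball_ge hN hA hAt hε
  rw [ENNReal.ofReal_add ENNReal.toReal_nonneg, ENNReal.ofReal_toReal hAt] at key
  · have hsub : {x | t < f x} + Metric.ball 0 ε ⊆ {x | t < f x} ∪
        {y | y ∈ Ω ∧ f y ≤ t ∧ t < f y + (ε * ‖fderiv ℝ f y‖ + M * ε ^ 2)} := by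
      rintro _ ⟨x, hx, v, hv, rfl⟩
      rw [mem_ball_zero_iff] at hv
      rcases lt_or_ge t (f (x + v)) with h1 | h1
      · exact .inl h1
      have hb := hε₀ x (le_of_lt hx)
      have hy : x + v ∈ Metric.ball x ε₀ := by simpa using hv.trans_le hεε
      have hseg : segment ℝ (x + v) x ⊆ Ω :=
        ((convex_ball x ε₀).segment_subset hy (Metric.mem_ball_self (hε.trans_le hεε))).trans hb
      refine .inr ⟨hb hy, h1, ?_⟩
      have h2 := h.taylor_le hseg
      have e : x - (x + v) = -v := by abel
      have h3 : |fderiv ℝ f (x + v) (x - (x + v))| ≤ ‖fderiv ℝ f (x + v)‖ * ε := by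
        refine ((fderiv ℝ f (x + v)).le_opNorm _).trans ?_
        rw [e, norm_neg]
        gcongr
      have h4 : M * ‖x - (x + v)‖ ^ 2 ≤ M * ε ^ 2 := by
        have := h.M_nonneg
        rw [e, norm_neg]
        gcongr
      have h5 : t < f x := hx
      have := (abs_le.1 (h2.trans h4)).2
      have := (abs_le.1 h3).2
      linarith
    have := key.trans ((measure_mono hsub).trans (measure_union_le _ _))
    exact (ENNReal.add_le_add_iff_left hAt).1 this
  · have := omegaN_pos N
    unfold isoProfile
    positivity

theorem _root_.isoProfile_mono {N : ℕ} (hN : 2 ≤ N) {s t : ℝ} (hs : 0 ≤ s) (hst : s ≤ t) :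
    isoProfile N s ≤ isoProfile N t := by
  have := omegaN_pos N
  have h1 : (2 : ℝ) ≤ N := by exact_mod_cast hN
  have h2 : 0 ≤ 1 - 1 / (N : ℝ) := by
    rw [sub_nonneg, div_le_one (by linarith)]
    linarith
  unfold isoProfile
  gcongr

theorem measurable_norm_fderiv : Measurable fun x => ‖fderiv ℝ f x‖ :=
  (measurable_fderiv ℝ f).norm

theorem iso_le_lintegral_aux (h : Slice Ω f M) (hN : 2 ≤ N) {t₁ t₂ ε ε₀ : ℝ} (ht : 0 < t₁)
    (hε : 0 < ε) (hεε : ε ≤ ε₀) (hε₀ : ∀ x, t₁ ≤ f x → Metric.ball x ε₀ ⊆ Ω) :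
    ENNReal.ofReal (t₂ - t₁) * ENNReal.ofReal (ε * isoProfile N (distr f t₂)) ≤
      ∫⁻ y in {y | y ∈ Ω ∧ t₁ < f y + (ε * M + M * ε ^ 2) ∧ f y < t₂},
        ENNReal.ofReal (ε * ‖fderiv ℝ f y‖ + M * ε ^ 2) := by
  set g : Euc N → ℝ := fun y => ε * ‖fderiv ℝ f y‖ + M * ε ^ 2 with hg
  have hgm : Measurable g := by
    have := measurable_norm_fderiv (f := f)
    fun_prop
  have hfm := h.measurable
  have hΩ := h.isOpen.measurableSet
  set D : Set (ℝ × Euc N) := {p | (t₁ < p.1 ∧ p.1 < t₂) ∧ p.2 ∈ Ω ∧ f p.2 ≤ p.1 ∧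
    p.1 < f p.2 + g p.2} with hD
  have hDm : MeasurableSet D :=
    ((measurableSet_lt measurable_const measurable_fst).inter
      (measurableSet_lt measurable_fst measurable_const)).inter
      ((measurable_snd hΩ).inter ((measurableSet_le (by fun_prop) measurable_fst).inter
        (measurableSet_lt measurable_fst (by fun_prop))))
  have h1 : ENNReal.ofReal (t₂ - t₁) * ENNReal.ofReal (ε * isoProfile N (distr f t₂)) ≤
      (volume.prod volume) D := by
    rw [Measure.prod_apply hDm]
    calc _ = ∫⁻ _ in Ioo t₁ t₂, ENNReal.ofReal (ε * isoProfile N (distr f t₂)) := by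
          rw [setLIntegral_const, Real.volume_Ioo, mul_comm]
      _ ≤ ∫⁻ t in Ioo t₁ t₂, volume (Prod.mk t ⁻¹' D) := by
          refine setLIntegral_mono' measurableSet_Ioo fun t ht' => ?_
          have ht0 : 0 < t := ht.trans ht'.1
          refine le_trans ?_ ((h.eps_mul_iso_le hN ht0 hε hεε fun x hx =>
            hε₀ x (ht'.1.le.trans hx)).trans (measure_mono fun y hy => ?_))
          · refine ENNReal.ofReal_le_ofReal (mul_le_mul_of_nonneg_left ?_ hε.le)
            exact isoProfile_mono hN ENNReal.toReal_nonneg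
              (h.distr_antitoneOn ht0.le (ht0.trans ht'.2).le ht'.2.le)
          · exact ⟨ht', hy⟩
      _ ≤ _ := setLIntegral_le_lintegral _ _
  refine h1.trans ?_
  rw [Measure.prod_apply_symm hDm]
  have hS : MeasurableSet {y | y ∈ Ω ∧ t₁ < f y + (ε * M + M * ε ^ 2) ∧ f y < t₂} :=
    hΩ.inter ((measurableSet_lt (g := fun y => f y + (ε * M + M * ε ^ 2)) measurable_const
      (by fun_prop)).inter (measurableSet_lt hfm measurable_const))
  rw [← lintegral_indicator hS]
  refine lintegral_mono fun y => ?_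
  by_cases hy : y ∈ {y | y ∈ Ω ∧ t₁ < f y + (ε * M + M * ε ^ 2) ∧ f y < t₂}
  · rw [indicator_of_mem hy]
    calc _ ≤ volume (Ico (f y) (f y + g y)) := measure_mono fun t ht' => ⟨ht'.2.2.1, ht'.2.2.2⟩
      _ = ENNReal.ofReal (g y) := by rw [Real.volume_Ico, add_sub_cancel_left]
      _ ≤ _ := le_rfl
  · rw [indicator_of_notMem hy, nonpos_iff_eq_zero]
    refine measure_mono_null (fun t ht' => hy ?_) (measure_empty (μ := volume))
    refine ⟨ht'.2.1, ?_, ht'.2.2.1.trans_lt ht'.1.2⟩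
    have h2 := h.bound₁ y ht'.2.1
    have h3 : ε * ‖fderiv ℝ f y‖ ≤ ε * M := by gcongr
    have h4 : t < f y + g y := ht'.2.2.2
    have h5 : t₁ < t := ht'.1.1
    simp only [hg] at h4
    linarith

theorem iso_le_integral (h : Slice Ω f M) (hN : 2 ≤ N) {t₀ t₁ t₂ : ℝ} (ht : 0 < t₀)
    (ht' : t₀ < t₁) (ht₂ : t₁ ≤ t₂) :
    (t₂ - t₁) * isoProfile N (distr f t₂) ≤ ∫ y in {y | t₀ < f y ∧ f y < t₂}, ‖fderiv ℝ f y‖ := by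
  obtain ⟨ε₀, hε₀, hb⟩ := h.exists_ball_subset (ht.trans ht')
  have hM := h.M_nonneg
  have hfm := h.measurable
  set S : Set (Euc N) := {y | t₀ < f y ∧ f y < t₂}
  have hS : MeasurableSet S := (measurableSet_lt measurable_const hfm).inter
      (measurableSet_lt hfm measurable_const)
  have hSΩ : S ⊆ Ω := fun y hy => h.mem_of_pos (ht.trans hy.1)
  have hSt : volume S < ⊤ := (measure_mono hSΩ).trans_lt h.volume_lt_top
  have hinteg : IntegrableOn (fun y => ‖fderiv ℝ f y‖) S :=
    Measure.integrableOn_of_bounded (M := M) hSt.ne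
      (measurable_norm_fderiv.aestronglyMeasurable)
      ((ae_restrict_iff' hS).2 (.of_forall fun y hy => by
        simpa using h.bound₁ y (hSΩ hy)))
  have main : ∀ᶠ ε : ℝ in 𝓝[>] 0, (t₂ - t₁) * isoProfile N (distr f t₂) ≤
      (∫ y in S, ‖fderiv ℝ f y‖) + M * ε * volume.real S := by
    have hsm : ∀ᶠ ε : ℝ in 𝓝[>] 0, ε * M + M * ε ^ 2 < t₁ - t₀ := by
      refine nhdsWithin_le_nhds ?_
      have : Tendsto (fun ε : ℝ => ε * M + M * ε ^ 2) (𝓝 0) (𝓝 (0 * M + M * 0 ^ 2)) :=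
        Continuous.tendsto (by fun_prop) 0
      refine this.eventually_lt_const ?_
      simpa using ht'
    have hle : ∀ᶠ ε : ℝ in 𝓝[>] 0, ε ≤ ε₀ :=
      nhdsWithin_le_nhds (eventually_le_nhds hε₀)
    filter_upwards [hsm, hle, self_mem_nhdsWithin] with ε h1 h2 h3
    rw [mem_Ioi] at h3
    have key := h.iso_le_lintegral_aux hN (t₂ := t₂) (ht.trans ht') h3 h2 hb
    have hiso : 0 ≤ isoProfile N (distr f t₂) := by
      have := omegaN_pos N
      have : 0 ≤ distr f t₂ := ENNReal.toReal_nonneg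
      unfold isoProfile
      positivity
    have key2 := key.trans (lintegral_mono_set (t := S) fun y hy =>
      ⟨by linarith [hy.2.1], hy.2.2⟩)
    have hint2 : Integrable (fun y => ε * ‖fderiv ℝ f y‖ + M * ε ^ 2) (volume.restrict S) :=
      (hinteg.const_mul ε).add (integrableOn_const (hs := hSt.ne))
    rw [← ofReal_integral_eq_lintegral_ofReal hint2
      (.of_forall fun y => by dsimp only [Pi.zero_apply]; positivity),
      ← ENNReal.ofReal_mul (by linarith), ENNReal.ofReal_le_ofReal_iff
      (integral_nonneg fun y => by dsimp only [Pi.zero_apply]; positivity),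
      integral_add (hinteg.const_mul ε) (integrableOn_const (hs := hSt.ne)), integral_const_mul,
      setIntegral_const, smul_eq_mul] at key2
    refine le_of_mul_le_mul_left ?_ h3
    linarith
  have hlim : Tendsto (fun ε : ℝ => (∫ y in S, ‖fderiv ℝ f y‖) + M * ε * volume.real S)
      (𝓝[>] 0) (𝓝 ((∫ y in S, ‖fderiv ℝ f y‖) + M * 0 * volume.real S)) :=
    (Continuous.tendsto (by fun_prop) 0).mono_left nhdsWithin_le_nhds
  simpa using ge_of_tendsto hlim main

end Slice

end

/-- The Laplacian. -/
def lapl {N : ℕ} (f : Euc N → ℝ) (x : Euc N) : ℝ :=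
  ∑ i : Fin N, fderiv ℝ (fderiv ℝ f) x (EuclideanSpace.single i 1) (EuclideanSpace.single i 1)

theorem norm_sq_eq_sum_single {N : ℕ} (L : Euc N →L[ℝ] ℝ) :
    ‖L‖ ^ 2 = ∑ i : Fin N, L (EuclideanSpace.single i 1) ^ 2 := by
  have h := (EuclideanSpace.basisFun (Fin N) ℝ).sum_sq_norm_inner_left
    ((InnerProductSpace.toDual ℝ (Euc N)).symm L)
  rw [LinearIsometryEquiv.norm_map] at h
  rw [← h]
  refine Finset.sum_congr rfl fun i _ => ?_
  rw [InnerProductSpace.toDual_symm_apply]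
  simp

theorem exists_ramp {a b η : ℝ} (hab : a ≤ b) (hη : 0 < η) : ∃ ρ S : ℝ → ℝ, Continuous ρ ∧
    (∀ y, HasDerivAt S (ρ y) y) ∧ (∀ y, 0 ≤ ρ y) ∧ (∀ y ∈ Icc a b, ρ y = 1) ∧
    (∀ y ≤ a - η, ρ y = 0) ∧ (∀ y ≤ a - η, S y = 0) ∧ (∀ y, 0 ≤ S y) ∧
    (∀ y, S y ≤ b - a + 2 * η) ∧ (∀ y, b ≤ y → b - a ≤ S y) := by
  set ρ : ℝ → ℝ := fun y => max 0 (min 1 (min ((y - (a - η)) / η) ((b + η - y) / η))) with hρd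
  have hρ : Continuous ρ := by fun_prop
  have h0 : ∀ y, 0 ≤ ρ y := fun y => le_max_left _ _
  have h1 : ∀ y, ρ y ≤ 1 := fun y => max_le zero_le_one (min_le_left _ _)
  have hl : ∀ y ≤ a - η, ρ y = 0 := fun y hy => max_eq_left <| (min_le_right _ _).trans <|
    (min_le_left _ _).trans (div_nonpos_of_nonpos_of_nonneg (by linarith) hη.le)
  have hr : ∀ y, b + η ≤ y → ρ y = 0 := fun y hy => max_eq_left <| (min_le_right _ _).trans <|
    (min_le_right _ _).trans (div_nonpos_of_nonpos_of_nonneg (by linarith) hη.le)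
  have hm : ∀ y ∈ Icc a b, ρ y = 1 := by
    intro y hy
    have e1 : 1 ≤ (y - (a - η)) / η := by rw [le_div_iff₀ hη]; linarith [hy.1]
    have e2 : 1 ≤ (b + η - y) / η := by rw [le_div_iff₀ hη]; linarith [hy.2]
    simp only [hρd]
    rw [min_eq_left (le_min e1 e2), max_eq_right zero_le_one]
  have hi : ∀ x y, IntervalIntegrable ρ volume x y := fun x y => hρ.intervalIntegrable x y
  have hS : ∀ y, HasDerivAt (fun y => ∫ x in (a - η)..y, ρ x) (ρ y) y := fun y =>
    intervalIntegral.integral_hasDerivAt_right (hi _ _)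
      (hρ.stronglyMeasurableAtFilter _ _) hρ.continuousAt
  have hmono : Monotone fun y => ∫ x in (a - η)..y, ρ x :=
    monotone_of_hasDerivAt_nonneg hS h0
  have hSl : ∀ y ≤ a - η, ∫ x in (a - η)..y, ρ x = 0 := fun y hy =>
    intervalIntegral.integral_zero_ae (.of_forall fun x hx => by
      rw [uIoc_of_ge hy] at hx
      exact hl x hx.2)
  refine ⟨ρ, fun y => ∫ x in (a - η)..y, ρ x, hρ, hS, h0, hm, hl, hSl, fun y => ?_, fun y => ?_,
    fun y hy => ?_⟩
  · rcases le_total y (a - η) with hy | hy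
    · exact (hSl y hy).ge
    · exact (hSl _ le_rfl).ge.trans (hmono hy)
  · have e1 : ∫ x in (a - η)..(b + η), ρ x ≤ b - a + 2 * η := by
      have := intervalIntegral.integral_mono_on (a := a - η) (b := b + η) (by linarith) (hi _ _)
        (_root_.intervalIntegrable_const (c := (1 : ℝ))) fun x _ => h1 x
      simp only [intervalIntegral.integral_const, smul_eq_mul, mul_one] at this
      linarith
    rcases le_total y (b + η) with hy | hy
    · exact (hmono hy).trans e1
    · have : ∫ x in (b + η)..y, ρ x = 0 := intervalIntegral.integral_zero_ae
        (.of_forall fun x hx => by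
          rw [uIoc_of_le hy] at hx
          exact hr x hx.1.le)
      dsimp only
      rw [← intervalIntegral.integral_add_adjacent_intervals (hi _ (b + η)) (hi _ _), this,
        add_zero]
      exact e1
  · refine le_trans ?_ (hmono hy)
    dsimp only
    rw [← intervalIntegral.integral_add_adjacent_intervals (hi _ a) (hi _ _)]
    have e1 : ∫ x in a..b, ρ x = b - a := by
      rw [intervalIntegral.integral_congr (g := fun _ => 1) fun x hx => ?_]
      · simp
      · rw [uIcc_of_le hab] at hx
        exact hm x hx
    have e2 : 0 ≤ ∫ x in (a - η)..a, ρ x :=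
      intervalIntegral.integral_nonneg (by linarith) fun x _ => h0 x
    linarith

namespace Slice

variable {N : ℕ} {Ω : Set (Euc N)} {f : Euc N → ℝ} {M : ℝ}

theorem measurable_second (e e' : Euc N) :
    Measurable fun x => fderiv ℝ (fderiv ℝ f) x e e' :=
  (ContinuousLinearMap.measurable_apply e').comp
    ((ContinuousLinearMap.measurable_apply e).comp (measurable_fderiv ℝ (fderiv ℝ f)))

theorem measurable_lapl : Measurable (lapl f) :=
  Finset.measurable_fun_sum _ fun _ _ => measurable_second _ _

theorem abs_second_le (h : Slice Ω f M) {x : Euc N} (hx : x ∈ Ω) {e e' : Euc N} (he : ‖e‖ = 1)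
    (he' : ‖e'‖ = 1) : |fderiv ℝ (fderiv ℝ f) x e e'| ≤ M := by
  have h1 := ContinuousLinearMap.le_opNorm (fderiv ℝ (fderiv ℝ f) x e) e'
  have h2 := ContinuousLinearMap.le_opNorm (fderiv ℝ (fderiv ℝ f) x) e
  rw [he', mul_one] at h1
  rw [he, mul_one] at h2
  exact h1.trans (h2.trans (h.bound₂ x hx))

theorem abs_lapl_le (h : Slice Ω f M) {x : Euc N} (hx : x ∈ Ω) : |lapl f x| ≤ N * M := by
  refine (Finset.abs_sum_le_sum_abs _ _).trans ?_
  refine (Finset.sum_le_sum fun i _ => h.abs_second_le hx (by simp) (by simp)).trans ?_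
  simp

theorem abs_fderiv_le (h : Slice Ω f M) {x : Euc N} (hx : x ∈ Ω) {e : Euc N} (he : ‖e‖ = 1) :
    |fderiv ℝ f x e| ≤ M := by
  have h1 := ContinuousLinearMap.le_opNorm (fderiv ℝ f x) e
  rw [he, mul_one] at h1
  exact h1.trans (h.bound₁ x hx)

theorem integrable_of_bounded (h : Slice Ω f M) {g : Euc N → ℝ} (hg : Measurable g) (C : ℝ)
    (hC : ∀ x ∈ Ω, |g x| ≤ C) (h0 : ∀ x ∉ Ω, g x = 0) : Integrable g := by
  rw [← integrableOn_iff_integrable_of_support_subset (s := Ω) fun x hx => by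
    by_contra hc
    exact hx (h0 x hc)]
  exact Measure.integrableOn_of_bounded (M := C) h.volume_lt_top.ne hg.aestronglyMeasurable
    ((ae_restrict_iff' h.isOpen.measurableSet).2 (.of_forall fun x hx => hC x hx))

variable {ρ S : ℝ → ℝ} {c : ℝ}

theorem exists_bound_comp (h : Slice Ω f M) (hρ : Continuous ρ) :
    ∃ C, 0 ≤ C ∧ ∀ x, |ρ (f x)| ≤ C := by
  obtain ⟨C, hC⟩ := (isCompact_Icc (a := 0) (b := M)).exists_bound_of_continuousOn hρ.continuousOn
  have := fun x => hC (f x) ⟨h.nonneg x, h.bound x⟩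
  exact ⟨C, (norm_nonneg _).trans (this 0), this⟩

theorem integral_ramp (h : Slice Ω f M) (hc : 0 < c) (hρ : Continuous ρ)
    (hS : ∀ y, HasDerivAt S (ρ y) y) (hρ0 : ∀ y ≤ c, ρ y = 0) (hS0 : ∀ y ≤ c, S y = 0) :
    ∫ x, ρ (f x) * ‖fderiv ℝ f x‖ ^ 2 = ∫ x, S (f x) * -lapl f x := by
  obtain ⟨C, hC0, hC⟩ := h.exists_bound_comp hρ
  have hSc : Continuous S := continuous_iff_continuousAt.2 fun y => (hS y).continuousAt
  obtain ⟨C', hC0', hC'⟩ := h.exists_bound_comp hSc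
  have hM := h.M_nonneg
  have hfm := h.measurable
  have hz : ∀ x ∉ Ω, ρ (f x) = 0 ∧ S (f x) = 0 := fun x hx => by
    rw [h.zero x hx]
    exact ⟨hρ0 _ hc.le, hS0 _ hc.le⟩
  set e : Fin N → Euc N := fun i => EuclideanSpace.single i 1
  have he : ∀ i, ‖e i‖ = 1 := fun i => by simp [e]
  have hm1 : ∀ i, Measurable fun x => fderiv ℝ f x (e i) := fun i =>
    (ContinuousLinearMap.measurable_apply (e i)).comp (measurable_fderiv ℝ f)
  have i1 : ∀ i, Integrable fun x => ρ (f x) * (fderiv ℝ f x (e i)) ^ 2 := fun i =>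
    h.integrable_of_bounded ((hρ.measurable.comp hfm).mul ((hm1 i).pow_const 2)) (C * M ^ 2)
      (fun x hx => by
        rw [abs_mul, abs_pow]
        have := h.abs_fderiv_le hx (he i)
        have := hC x
        gcongr) fun x hx => by rw [(hz x hx).1, zero_mul]
  have i2 : ∀ i, Integrable fun x => S (f x) * fderiv ℝ (fderiv ℝ f) x (e i) (e i) := fun i =>
    h.integrable_of_bounded ((hSc.measurable.comp hfm).mul (measurable_second _ _)) (C' * M)
      (fun x hx => by
        rw [abs_mul]
        have := h.abs_second_le hx (he i) (he i)
        have := hC' x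
        gcongr) fun x hx => by rw [(hz x hx).2, zero_mul]
  have i3 : ∀ i, Integrable fun x => S (f x) * fderiv ℝ f x (e i) := fun i =>
    h.integrable_of_bounded ((hSc.measurable.comp hfm).mul (hm1 i)) (C' * M)
      (fun x hx => by
        rw [abs_mul]
        have := h.abs_fderiv_le hx (he i)
        have := hC' x
        gcongr) fun x hx => by rw [(hz x hx).2, zero_mul]
  have hd : ∀ i x, HasLineDerivAt ℝ (fun x => S (f x) * fderiv ℝ f x (e i))
      (ρ (f x) * (fderiv ℝ f x (e i)) ^ 2 + S (f x) * fderiv ℝ (fderiv ℝ f) x (e i) (e i))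
      x (e i) := by
    intro i x
    by_cases hx : x ∈ Ω
    · have d1 : HasFDerivAt f (fderiv ℝ f x) x :=
        ((h.smooth x hx).differentiableAt (by simp)).hasFDerivAt
      have d2 : HasFDerivAt (fderiv ℝ f) (fderiv ℝ (fderiv ℝ f) x) x :=
        (((h.smooth x hx).fderiv_right (m := ∞) (by simp)).differentiableAt (by simp)).hasFDerivAt
      have d3 := ((hS (f x)).comp_hasFDerivAt x d1).mul
        (d2.clm_apply (hasFDerivAt_const (e i) x))
      have := d3.hasLineDerivAt (e i)
      refine this.congr_deriv ?_
      simp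
      ring
    · have hlt : ∀ᶠ y in 𝓝 x, f y < c :=
        h.cont.continuousAt.eventually_lt_const (by rw [h.zero x hx]; exact hc)
      have heq : (fun x => S (f x) * fderiv ℝ f x (e i)) =ᶠ[𝓝 x] fun _ => 0 := by
        filter_upwards [hlt] with y hy
        rw [hS0 _ hy.le, zero_mul]
      rw [(hz x hx).1, (hz x hx).2, zero_mul, zero_mul, add_zero]
      exact ((hasFDerivAt_const (0 : ℝ) x).congr_of_eventuallyEq heq).hasLineDerivAt (e i)
  have key : ∀ i, ∫ x, ρ (f x) * (fderiv ℝ f x (e i)) ^ 2 =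
      -∫ x, S (f x) * fderiv ℝ (fderiv ℝ f) x (e i) (e i) := by
    intro i
    have := integral_bilinear_hasLineDerivAt_right_eq_neg_left_of_integrable
      (μ := volume) (v := e i) (B := ContinuousLinearMap.mul ℝ ℝ) (f := fun _ => (1 : ℝ))
      (f' := fun _ => 0) (g := fun x => S (f x) * fderiv ℝ f x (e i))
      (g' := fun x => ρ (f x) * (fderiv ℝ f x (e i)) ^ 2 +
        S (f x) * fderiv ℝ (fderiv ℝ f) x (e i) (e i))
      (by simp) (by
        simp only [ContinuousLinearMap.mul_apply', one_mul]
        exact (i1 i).add (i2 i))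
      (by simpa using i3 i)
      (fun x _ => (hasFDerivAt_const (1 : ℝ) x).hasLineDerivAt (e i)) (fun x _ => hd i x)
    simp only [ContinuousLinearMap.mul_apply', one_mul, zero_mul, integral_zero, neg_zero] at this
    rw [integral_add (i1 i) (i2 i)] at this
    linarith
  have e1 : ∀ x, ρ (f x) * ‖fderiv ℝ f x‖ ^ 2 =
      ∑ i, ρ (f x) * (fderiv ℝ f x (e i)) ^ 2 := fun x => by
    rw [norm_sq_eq_sum_single, Finset.mul_sum]
  have e2 : ∀ x, S (f x) * -lapl f x =
      -∑ i, S (f x) * fderiv ℝ (fderiv ℝ f) x (e i) (e i) := fun x => by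
    rw [lapl, mul_neg, Finset.mul_sum]
  simp only [e1, e2]
  rw [integral_neg, integral_finsetSum _ fun i _ => i1 i, integral_finsetSum _ fun i _ => i2 i,
    ← Finset.sum_neg_distrib]
  exact Finset.sum_congr rfl fun i _ => key i

end Slice

theorem tendsto_nhdsGT_of_continuous {φ : ℝ → ℝ} (hφ : Continuous φ) :
    Tendsto φ (𝓝[>] 0) (𝓝 (φ 0)) :=
  (hφ.tendsto 0).mono_left nhdsWithin_le_nhds

namespace Slice

variable {N : ℕ} {Ω : Set (Euc N)} {f : Euc N → ℝ} {M : ℝ}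

theorem exists_energy (h : Slice Ω f M) {t : ℝ} (ht : 0 < t) : ∃ J : ℝ → ℝ,
    Tendsto J (𝓝[>] 0) (𝓝 (∫ x in {x | t < f x}, -lapl f x)) ∧
    ∀ δ : ℝ, 0 < δ → ∫ x in {x | t + δ ^ 2 < f x ∧ f x < t + 2 * δ ^ 2 + δ},
      ‖fderiv ℝ f x‖ ^ 2 ≤ δ * J δ := by
  have hex : ∀ δ : ℝ, 0 < δ → ∃ ρ S : ℝ → ℝ, Continuous ρ ∧ (∀ y, HasDerivAt S (ρ y) y) ∧
      (∀ y, 0 ≤ ρ y) ∧ (∀ y ∈ Icc (t + δ ^ 2) (t + 2 * δ ^ 2 + δ), ρ y = 1) ∧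
      (∀ y ≤ t, ρ y = 0) ∧ (∀ y ≤ t, S y = 0) ∧ (∀ y, 0 ≤ S y) ∧
      (∀ y, S y ≤ δ + 3 * δ ^ 2) ∧ (∀ y, t + 2 * δ ^ 2 + δ ≤ y → δ ≤ S y) := by
    intro δ hδ
    have hδ2 : 0 < δ ^ 2 := by positivity
    obtain ⟨ρ, S, h1, h2, h3, h4, h5, h6, h7, h8, h9⟩ :=
      exists_ramp (a := t + δ ^ 2) (b := t + 2 * δ ^ 2 + δ) (by linarith) hδ2
    rw [add_sub_cancel_right] at h5 h6
    exact ⟨ρ, S, h1, h2, h3, h4, h5, h6, h7, fun y => (h8 y).trans (by linarith),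
      fun y hy => le_trans (by linarith) (h9 y hy)⟩
  choose! ρ S h1 h2 h3 h4 h5 h6 h7 h8 h9 using hex
  have hfm := h.measurable
  have hΩ := h.isOpen.measurableSet
  have hM := h.M_nonneg
  have hSm : ∀ δ > 0, Measurable (S δ) := fun δ hδ =>
    (continuous_iff_continuousAt.2 fun y => (h2 δ hδ y).continuousAt).measurable
  refine ⟨fun δ => ∫ x, δ⁻¹ * (S δ (f x) * -lapl f x), ?_, fun δ hδ => ?_⟩
  · have hS : MeasurableSet {x | t < f x} := measurableSet_lt measurable_const hfm
    rw [← integral_indicator hS]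
    refine tendsto_integral_filter_of_dominated_convergence
      (Ω.indicator fun _ => 4 * (N * M)) ?_ ?_ ?_ ?_
    · filter_upwards [self_mem_nhdsWithin] with δ hδ
      exact ((((hSm δ hδ).comp hfm).mul measurable_lapl.neg).const_mul _).aestronglyMeasurable
    · have : ∀ᶠ δ : ℝ in 𝓝[>] 0, δ ≤ 1 := nhdsWithin_le_nhds (eventually_le_nhds one_pos)
      filter_upwards [self_mem_nhdsWithin, this] with δ hδ hδ1
      rw [mem_Ioi] at hδ
      refine .of_forall fun x => ?_
      by_cases hx : x ∈ Ω
      · rw [indicator_of_mem hx, Real.norm_eq_abs, abs_mul, abs_mul, abs_neg, ← mul_assoc]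
        have e1 := h.abs_lapl_le hx
        have e2 : |δ⁻¹| * |S δ (f x)| ≤ 4 := by
          rw [abs_of_pos (inv_pos.2 hδ), abs_of_nonneg (h7 δ hδ _), inv_mul_le_iff₀ hδ]
          refine (h8 δ hδ _).trans ?_
          nlinarith
        gcongr
      · rw [h.zero x hx, h6 δ hδ 0 ht.le]
        simp [hx]
    · exact (integrable_indicator_iff hΩ).2 (integrableOn_const (hs := h.volume_lt_top.ne))
    · refine .of_forall fun x => ?_
      rcases le_or_gt (f x) t with hx | hx
      · rw [indicator_of_notMem (by simpa using hx)]
        refine tendsto_const_nhds.congr' ?_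
        filter_upwards [self_mem_nhdsWithin] with δ hδ
        rw [h6 δ hδ _ hx]
        simp
      · rw [indicator_of_mem (by simpa using hx)]
        simp only [← mul_assoc]
        have e : Tendsto (fun δ => δ⁻¹ * S δ (f x)) (𝓝[>] 0) (𝓝 1) := by
          have hu : Tendsto (fun δ : ℝ => 1 + 3 * δ) (𝓝[>] 0) (𝓝 (1 + 3 * 0)) :=
            tendsto_nhdsGT_of_continuous (φ := fun δ : ℝ => 1 + 3 * δ) (by fun_prop)
          have hb : Tendsto (fun δ : ℝ => t + 2 * δ ^ 2 + δ) (𝓝[>] 0)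
              (𝓝 (t + 2 * 0 ^ 2 + 0)) :=
            tendsto_nhdsGT_of_continuous (φ := fun δ : ℝ => t + 2 * δ ^ 2 + δ) (by fun_prop)
          have hb' : ∀ᶠ δ : ℝ in 𝓝[>] 0, t + 2 * δ ^ 2 + δ < f x :=
            hb.eventually_lt_const (by simpa using hx)
          refine tendsto_of_tendsto_of_tendsto_of_le_of_le' tendsto_const_nhds
            (by simpa using hu) ?_ ?_
          · filter_upwards [self_mem_nhdsWithin, hb'] with δ hδ hδ'
            rw [mem_Ioi] at hδ
            rw [le_inv_mul_iff₀ hδ, mul_one]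
            exact h9 δ hδ _ hδ'.le
          · filter_upwards [self_mem_nhdsWithin] with δ hδ
            rw [mem_Ioi] at hδ
            rw [inv_mul_le_iff₀ hδ]
            exact (h8 δ hδ _).trans (le_of_eq (by ring))
        simpa using e.mul_const (-lapl f x)
  · dsimp only
    rw [integral_const_mul, ← mul_assoc, mul_inv_cancel₀ hδ.ne', one_mul,
      ← h.integral_ramp ht (h1 δ hδ) (h2 δ hδ) (h5 δ hδ) (h6 δ hδ)]
    have hB : MeasurableSet {x | t + δ ^ 2 < f x ∧ f x < t + 2 * δ ^ 2 + δ} :=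
      (measurableSet_lt measurable_const hfm).inter (measurableSet_lt hfm measurable_const)
    obtain ⟨C, hC0, hC⟩ := h.exists_bound_comp (h1 δ hδ)
    rw [← integral_indicator hB]
    refine integral_mono_of_nonneg (.of_forall fun x => ?_) ?_ (.of_forall fun x => ?_)
    · exact indicator_nonneg (fun _ _ => by positivity) x
    · refine h.integrable_of_bounded (((h1 δ hδ).measurable.comp hfm).mul
        (measurable_norm_fderiv.pow_const 2)) (C * M ^ 2) (fun x hx => ?_) fun x hx => ?_
      · rw [abs_mul, abs_pow, abs_norm]
        have := h.bound₁ x hx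
        have := hC x
        gcongr
      · rw [h.zero x hx, h5 δ hδ 0 ht.le, zero_mul]
    · refine indicator_apply_le' (fun hx => ?_) fun _ =>
        mul_nonneg (h3 δ hδ _) (by positivity)
      dsimp only
      rw [h4 δ hδ _ ⟨hx.1.le, hx.2.le⟩, one_mul]

theorem integral_neg_lapl_nonneg (h : Slice Ω f M) {t : ℝ} (ht : 0 < t) :
    0 ≤ ∫ x in {x | t < f x}, -lapl f x := by
  obtain ⟨J, hJ, hJ'⟩ := h.exists_energy ht
  refine ge_of_tendsto hJ ?_
  filter_upwards [self_mem_nhdsWithin] with δ hδ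
  rw [mem_Ioi] at hδ
  exact nonneg_of_mul_nonneg_right ((integral_nonneg fun x => by positivity).trans (hJ' δ hδ)) hδ

theorem integrableOn_of_measurable (h : Slice Ω f M) {g : Euc N → ℝ} (hg : Measurable g) (C : ℝ)
    (hC : ∀ x ∈ Ω, |g x| ≤ C) : IntegrableOn g Ω :=
  Measure.integrableOn_of_bounded (M := C) h.volume_lt_top.ne hg.aestronglyMeasurable
    ((ae_restrict_iff' h.isOpen.measurableSet).2 (.of_forall fun x hx => hC x hx))

theorem isoProfile_sq_le (h : Slice Ω f M) (hN : 2 ≤ N) {t A : ℝ} (ht : 0 < t) (hA : 0 < A)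
    (hμ : HasDerivAt (distr f) (-A) t) :
    isoProfile N (distr f t) ^ 2 ≤ A * ∫ x in {x | t < f x}, -lapl f x := by
  set G := ∫ x in {x | t < f x}, -lapl f x with hG
  have hG0 : 0 ≤ G := h.integral_neg_lapl_nonneg ht
  have hω := omegaN_pos N
  have hN1 : (2 : ℝ) ≤ N := by exact_mod_cast hN
  have hd0 : ∀ s, 0 ≤ distr f s := fun s => ENNReal.toReal_nonneg
  have hexp : 0 < 1 - 1 / (N : ℝ) := by
    rw [sub_pos, div_lt_one (by linarith)]
    linarith
  have hiso : 0 ≤ isoProfile N (distr f t) := by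
    have := hd0 t
    unfold isoProfile
    positivity
  have hisoc : Continuous (isoProfile N) := by
    unfold isoProfile
    exact continuous_const.mul (Real.continuous_rpow_const hexp.le)
  obtain ⟨J, hJ, hJ'⟩ := h.exists_energy ht
  have hfm := h.measurable
  have key : ∀ κ > 0, isoProfile N (distr f t) ≤ κ / 2 * G + A / (2 * κ) := by
    intro κ hκ
    set T : ℝ → ℝ := fun δ => t + 2 * δ ^ 2 + δ with hT
    have hTc : Continuous T := by fun_prop
    have hT0 : T 0 = t := by simp [hT]
    have hTt : Tendsto T (𝓝[>] 0) (𝓝 t) := hT0 ▸ tendsto_nhdsGT_of_continuous hTc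
    have l1 : Tendsto (fun δ => isoProfile N (distr f (T δ))) (𝓝[>] 0)
        (𝓝 (isoProfile N (distr f t))) :=
      (hisoc.tendsto _).comp (hμ.continuousAt.tendsto.comp hTt)
    have l2 : Tendsto (fun δ => δ⁻¹ * (distr f t - distr f (T δ))) (𝓝[>] 0) (𝓝 A) := by
      have d1 : HasDerivAt T 1 0 := by
        have := (((hasDerivAt_const (0 : ℝ) t).fun_add (((hasDerivAt_id' (0 : ℝ)).fun_pow
          2).const_mul 2)).fun_add (hasDerivAt_id' (0 : ℝ)))
        exact this.congr_deriv (by simp)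
      have d2 : HasDerivAt (fun δ => distr f (T δ)) (-A) 0 := by
        have := HasDerivAt.comp (0 : ℝ) (h₂ := distr f) (h := T) (hT0.symm ▸ hμ) d1
        exact this.congr_deriv (mul_one _)
      have := d2.tendsto_slope_zero_right
      simp only [zero_add, hT0, smul_eq_mul] at this
      have := this.neg
      rw [neg_neg] at this
      refine this.congr fun δ => by ring
    have l3 : Tendsto (fun δ => κ / 2 * J δ + δ⁻¹ * (distr f t - distr f (T δ)) / (2 * κ)) (𝓝[>] 0)
        (𝓝 (κ / 2 * G + A / (2 * κ))) := (hJ.const_mul _).add (l2.div_const _)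
    refine le_of_tendsto_of_tendsto l1 l3 ?_
    filter_upwards [self_mem_nhdsWithin] with δ hδ
    rw [mem_Ioi] at hδ
    have hδ2 : 0 < δ ^ 2 := by positivity
    have e1 := h.iso_le_integral hN (t₀ := t + δ ^ 2) (t₁ := t + 2 * δ ^ 2) (t₂ := T δ)
      (by linarith) (by linarith) (by simp only [hT]; linarith)
    set B : Set (Euc N) := {y | t + δ ^ 2 < f y ∧ f y < T δ} with hB
    have hBm : MeasurableSet B :=
      (measurableSet_lt measurable_const hfm).inter (measurableSet_lt hfm measurable_const)
    have hBΩ : B ⊆ Ω := fun y hy => h.mem_of_pos (by linarith [hy.1])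
    have hBt : volume B < ⊤ := (measure_mono hBΩ).trans_lt h.volume_lt_top
    have e2 : ∫ y in B, ‖fderiv ℝ f y‖ ≤
        ∫ y in B, (κ / 2 * ‖fderiv ℝ f y‖ ^ 2 + 1 / (2 * κ)) := by
      have i1 : IntegrableOn (fun y => ‖fderiv ℝ f y‖) B :=
        (h.integrableOn_of_measurable measurable_norm_fderiv M fun x hx => by
          simpa using h.bound₁ x hx).mono_set hBΩ
      have i2 : IntegrableOn (fun y => κ / 2 * ‖fderiv ℝ f y‖ ^ 2 + 1 / (2 * κ)) B := by
        refine (h.integrableOn_of_measurable (((measurable_norm_fderiv.pow_const 2).const_mul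
          (κ / 2)).add_const (1 / (2 * κ))) (κ / 2 * M ^ 2 + 1 / (2 * κ))
          fun x hx => ?_).mono_set hBΩ
        have := h.bound₁ x hx
        rw [abs_of_nonneg (by positivity)]
        gcongr
      refine integral_mono i1 i2 fun y => ?_
      have : 0 ≤ (κ * ‖fderiv ℝ f y‖ - 1) ^ 2 / (2 * κ) := by positivity
      have e : (κ * ‖fderiv ℝ f y‖ - 1) ^ 2 / (2 * κ) =
          κ / 2 * ‖fderiv ℝ f y‖ ^ 2 + 1 / (2 * κ) - ‖fderiv ℝ f y‖ := by
        field_simp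
        ring
      dsimp only
      linarith
    have i3 : IntegrableOn (fun y => ‖fderiv ℝ f y‖ ^ 2) B := by
      refine (h.integrableOn_of_measurable (measurable_norm_fderiv.pow_const 2) (M ^ 2)
        fun x hx => ?_).mono_set hBΩ
      have := h.bound₁ x hx
      rw [abs_of_nonneg (by positivity)]
      gcongr
    rw [integral_add (i3.const_mul _) (integrableOn_const (hs := hBt.ne)), integral_const_mul,
      setIntegral_const, smul_eq_mul] at e2
    have e3 := hJ' δ hδ
    have e4 : volume.real B ≤ distr f t - distr f (T δ) := by
      have : volume.real B + distr f (T δ) ≤ distr f t := by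
        rw [distr, distr, ← measureReal_union _ (measurableSet_lt measurable_const hfm) hBt.ne
          (h.volume_superlevel_lt_top (by simp only [hT]; positivity)).ne]
        · refine measureReal_mono (union_subset (fun y hy => ?_) fun y hy => ?_)
            (h.volume_superlevel_lt_top ht.le).ne
          · exact lt_trans (by linarith) hy.1
          · refine lt_trans ?_ (show T δ < f y from hy)
            simp only [hT]
            linarith
        · exact disjoint_left.2 fun y hy hy' => lt_asymm hy.2 hy'
      linarith
    have e5 : T δ - (t + 2 * δ ^ 2) = δ := by simp only [hT]; ring
    rw [e5] at e1
    refine le_of_mul_le_mul_left (e1.trans (e2.trans ?_)) hδ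
    have e6 : δ * (κ / 2 * J δ + δ⁻¹ * (distr f t - distr f (T δ)) / (2 * κ)) =
        κ / 2 * (δ * J δ) + (distr f t - distr f (T δ)) * (1 / (2 * κ)) := by
      field_simp
    rw [e6]
    gcongr
  rcases hiso.eq_or_lt with h0 | h0
  · rw [← h0]
    simpa using mul_nonneg hA.le hG0
  · have := key (A / isoProfile N (distr f t)) (div_pos hA h0)
    generalize isoProfile N (distr f t) = I at *
    have e : A / I / 2 * G + A / (2 * (A / I)) = (A * G / I + I) / 2 := by
      field_simp
    rw [e, le_div_iff₀ two_pos, ← sub_le_iff_le_add, le_div_iff₀ h0] at this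
    linarith

end Slice

/-- The decreasing rearrangement expressed through the distribution function. -/
def dre {N : ℕ} (f : Euc N → ℝ) (s : ℝ) : ℝ := sSup {t | 0 ≤ t ∧ s < distr f t}

namespace Slice

variable {N : ℕ} {Ω : Set (Euc N)} {f : Euc N → ℝ} {M : ℝ}

theorem distr_nonneg (t : ℝ) : 0 ≤ distr f t := ENNReal.toReal_nonneg

theorem distr_eq_zero (h : Slice Ω f M) {t : ℝ} (ht : M ≤ t) : distr f t = 0 := by
  have : {x | t < f x} = ∅ := by
    ext x
    simpa using (h.bound x).trans ht
  simp [distr, this]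

theorem bddAbove_dre (h : Slice Ω f M) {s : ℝ} (hs : 0 ≤ s) :
    BddAbove {t | 0 ≤ t ∧ s < distr f t} := ⟨M, fun t ht => by
  by_contra hc
  have h2 := ht.2
  rw [h.distr_eq_zero (not_le.1 hc).le] at h2
  exact absurd hs (not_le.2 h2)⟩

theorem dre_nonneg (s : ℝ) : 0 ≤ dre f s := Real.sSup_nonneg fun _ ht => ht.1

theorem le_dre (h : Slice Ω f M) {s t : ℝ} (hs : 0 ≤ s) (ht : 0 ≤ t) (hst : s < distr f t) :
    t ≤ dre f s := le_csSup (h.bddAbove_dre hs) ⟨ht, hst⟩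

theorem dre_le (h : Slice Ω f M) {s t : ℝ} (ht : 0 ≤ t) (hst : distr f t ≤ s) :
    dre f s ≤ t := by
  refine Real.sSup_le (fun t' ht' => ?_) ht
  by_contra hc
  exact absurd (h.distr_antitoneOn ht ht'.1 (not_le.1 hc).le) (not_le.2 (hst.trans_lt ht'.2))

theorem lt_distr_of_lt_dre (h : Slice Ω f M) {s t : ℝ} (ht : 0 ≤ t) (hst : t < dre f s) :
    s < distr f t := by
  by_contra hc
  exact absurd (h.dre_le ht (not_lt.1 hc)) (not_le.2 hst)

theorem dre_antitoneOn (h : Slice Ω f M) : AntitoneOn (dre f) (Ici 0) := by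
  intro s hs s' _ hss
  by_contra hc
  obtain ⟨t, h1, h2⟩ := exists_between (not_le.1 hc)
  have ht : 0 ≤ t := (dre_nonneg s).trans h1.le
  exact absurd (h.le_dre hs ht (hss.trans_lt (h.lt_distr_of_lt_dre ht h2))) (not_le.2 h1)

theorem rearr_eq_dre (h : Slice Ω f M) {g : Euc N → ℝ} (hg : ∀ x ∈ Ω, g x = f x) {s : ℝ}
    (hs : 0 ≤ s) : rearr Ω g s = dre f s := by
  unfold rearr dre
  congr 1
  ext t
  refine and_congr_right fun ht => ?_
  have : {x | x ∈ Ω ∧ t < |g x|} = {x | t < f x} := by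
    ext x
    constructor
    · rintro ⟨hx, hx'⟩
      rwa [hg x hx, abs_of_nonneg (h.nonneg x)] at hx'
    · intro hx
      have hxΩ := h.superlevel_subset ht hx
      exact ⟨hxΩ, by rwa [hg x hxΩ, abs_of_nonneg (h.nonneg x)]⟩
  rw [this, distr, measureReal_def, ENNReal.ofReal_lt_iff_lt_toReal hs
    (h.volume_superlevel_lt_top ht).ne]

theorem distr_eq_integral (h : Slice Ω f M) {t : ℝ} (ht : 0 ≤ t) :
    distr f t = ∫ x in Ω, ({x | t < f x}.indicator (fun _ => (1 : ℝ)) x) := by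
  rw [setIntegral_indicator (measurableSet_lt measurable_const h.measurable),
    inter_eq_self_of_subset_right (h.superlevel_subset ht)]
  simp [distr]

theorem tendsto_distr (h : Slice Ω f M) {t : ℝ} (ht : 0 ≤ t) {l : Filter ℝ}
    [l.IsCountablyGenerated] (hl : l ≤ 𝓝 t) (hl0 : ∀ᶠ r in l, 0 ≤ r)
    (hlt : ∀ᵐ x ∂volume.restrict Ω, f x = t → ∀ᶠ r in l, t ≤ r) :
    Tendsto (distr f) l (𝓝 (distr f t)) := by
  rw [h.distr_eq_integral ht]
  refine Tendsto.congr' (f₁ := fun r => ∫ x in Ω, ({x | r < f x}.indicator (fun _ => (1 : ℝ)) x))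
    (hl0.mono fun r hr => (h.distr_eq_integral hr).symm) ?_
  refine tendsto_integral_filter_of_dominated_convergence (fun _ => 1) ?_ ?_ ?_ ?_
  · exact .of_forall fun r => (measurable_const.indicator
      (measurableSet_lt measurable_const h.measurable)).aestronglyMeasurable
  · refine .of_forall fun r => .of_forall fun x => ?_
    by_cases hx : x ∈ {x | r < f x} <;> simp [hx]
  · exact integrableOn_const (hs := h.volume_lt_top.ne)
  · filter_upwards [hlt] with x hx
    refine tendsto_const_nhds.congr' ?_
    rcases lt_trichotomy (f x) t with h1 | h1 | h1
    · filter_upwards [hl (eventually_gt_nhds h1)] with r hr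
      have hr' : f x < r := hr
      simp [hr'.le, h1.le]
    · filter_upwards [hx h1] with r hr
      simp [hr, h1]
    · filter_upwards [hl (eventually_lt_nhds h1)] with r hr
      have hr' : r < f x := hr
      simp [hr', h1]

theorem continuousAt_distr (h : Slice Ω f M) (hnull : ∀ c > 0, volume {x | f x = c} = 0) {t : ℝ}
    (ht : 0 < t) : ContinuousAt (distr f) t := by
  refine h.tendsto_distr ht.le le_rfl (eventually_ge_nhds ht) ?_
  refine ae_restrict_of_ae ?_
  have : ∀ᵐ x, f x ≠ t := by
    rw [ae_iff]
    simpa using hnull t ht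
  filter_upwards [this] with x hx hx'
  exact absurd hx' hx

theorem continuousWithinAt_distr (h : Slice Ω f M) {t : ℝ} (ht : 0 ≤ t) :
    Tendsto (distr f) (𝓝[>] t) (𝓝 (distr f t)) := by
  refine h.tendsto_distr ht nhdsWithin_le_nhds ?_ (.of_forall fun x _ => ?_)
  · filter_upwards [self_mem_nhdsWithin] with r hr
    exact ht.trans (le_of_lt hr)
  · filter_upwards [self_mem_nhdsWithin] with r hr
    exact le_of_lt hr

theorem lt_dre_of_lt_distr (h : Slice Ω f M) {s t : ℝ} (hs : 0 ≤ s) (ht : 0 ≤ t)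
    (hst : s < distr f t) : t < dre f s := by
  have := ((h.continuousWithinAt_distr ht).eventually_const_lt hst).and self_mem_nhdsWithin
  obtain ⟨r, hr, hr'⟩ := this.exists
  exact lt_of_lt_of_le hr' (h.le_dre hs (ht.trans (le_of_lt hr')) hr)

theorem lt_dre_iff (h : Slice Ω f M) {s t : ℝ} (hs : 0 ≤ s) (ht : 0 ≤ t) :
    t < dre f s ↔ s < distr f t :=
  ⟨h.lt_distr_of_lt_dre ht, h.lt_dre_of_lt_distr hs ht⟩

theorem distr_dre_le (h : Slice Ω f M) {s : ℝ} (hs : 0 ≤ s) : distr f (dre f s) ≤ s := by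
  by_contra hc
  exact lt_irrefl _ (h.lt_dre_of_lt_distr hs (dre_nonneg s) (not_le.1 hc))

theorem distr_dre_eq (h : Slice Ω f M) (hnull : ∀ c > 0, volume {x | f x = c} = 0) {s : ℝ}
    (hs : 0 ≤ s) (hpos : 0 < dre f s) : distr f (dre f s) = s := by
  refine (h.distr_dre_le hs).antisymm ?_
  have h1 : Tendsto (distr f) (𝓝[<] (dre f s)) (𝓝 (distr f (dre f s))) :=
    (h.continuousAt_distr hnull hpos).tendsto.mono_left nhdsWithin_le_nhds
  refine ge_of_tendsto h1 ?_
  filter_upwards [self_mem_nhdsWithin, nhdsWithin_le_nhds (eventually_ge_nhds hpos)] with t ht ht0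
  exact (h.lt_distr_of_lt_dre ht0 ht).le

theorem distr_strictAnti (h : Slice Ω f M) (hN : 0 < N) {t t' : ℝ} (ht : 0 ≤ t) (htt : t < t')
    (hpos : 0 < distr f t') : distr f t' < distr f t := by
  have hne : {x | t' < f x}.Nonempty := by
    rw [nonempty_iff_ne_empty]
    intro he
    simp [distr, he] at hpos
  obtain ⟨x, hx⟩ := hne
  have hx' : t' < f x := hx
  obtain ⟨y, hy⟩ : ∃ y, f y = 0 := by
    by_contra! hc
    have hΩ : Ω = univ := eq_univ_of_forall fun y => by
      by_contra hy
      exact hc y (h.zero y hy)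
    have : Nonempty (Fin N) := ⟨⟨0, hN⟩⟩
    have := h.isBounded
    rw [hΩ] at this
    exact NormedSpace.unbounded_univ ℝ (Euc N) this
  have hmid : (t + t') / 2 ∈ range f := by
    have := isPreconnected_univ.intermediate_value (mem_univ y) (mem_univ x) h.cont.continuousOn
    rw [← image_univ]
    refine this ⟨?_, ?_⟩ <;> linarith
  obtain ⟨p, hp⟩ := hmid
  have hop : IsOpen {x | t < f x ∧ f x < t'} :=
    (isOpen_lt continuous_const h.cont).inter (isOpen_lt h.cont continuous_const)
  have hpm : 0 < volume {x | t < f x ∧ f x < t'} :=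
    hop.measure_pos _ ⟨p, by rw [mem_ofPred_eq, hp]; constructor <;> linarith⟩
  have hle : distr f t' + volume.real {x | t < f x ∧ f x < t'} ≤ distr f t := by
    rw [distr, distr, ← measureReal_union _ hop.measurableSet
      (h.volume_superlevel_lt_top (ht.trans htt.le)).ne
      ((measure_mono fun x hx => hx.1).trans_lt (h.volume_superlevel_lt_top ht)).ne]
    · refine measureReal_mono (union_subset (fun y hy => ?_) fun y hy => hy.1)
        (h.volume_superlevel_lt_top ht).ne
      exact htt.trans hy
    · exact disjoint_left.2 fun y hy hy' => lt_asymm hy hy'.2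
  have : 0 < volume.real {x | t < f x ∧ f x < t'} := ENNReal.toReal_pos hpm.ne'
    ((measure_mono fun x hx => hx.1).trans_lt (h.volume_superlevel_lt_top ht)).ne
  linarith

theorem distr_lt_of_dre_lt (h : Slice Ω f M) (hN : 0 < N) {s t : ℝ} (hs : 0 < s)
    (hst : dre f s < t) : distr f t < s := by
  rcases (distr_nonneg (f := f) t).eq_or_lt with h0 | h0
  · rwa [← h0]
  · exact (h.distr_strictAnti hN (dre_nonneg s) hst h0).trans_le (h.distr_dre_le hs.le)

theorem continuousAt_dre (h : Slice Ω f M) (hN : 0 < N) {s : ℝ} (hs : 0 < s) :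
    ContinuousAt (dre f) s := by
  refine tendsto_order.2 ⟨fun t ht => ?_, fun t ht => ?_⟩
  · rcases lt_or_ge t 0 with h0 | h0
    · exact .of_forall fun r => h0.trans_le (dre_nonneg r)
    · filter_upwards [eventually_ge_nhds hs, eventually_lt_nhds (h.lt_distr_of_lt_dre h0 ht)]
        with r hr hr'
      exact h.lt_dre_of_lt_distr hr h0 hr'
  · obtain ⟨t', h1, h2⟩ := exists_between ht
    filter_upwards [eventually_gt_nhds (h.distr_lt_of_dre_lt hN hs h1)] with r hr
    exact (h.dre_le ((dre_nonneg s).trans h1.le) (le_of_lt hr)).trans_lt h2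

theorem dre_distr (h : Slice Ω f M) (hN : 0 < N) {t : ℝ} (ht : 0 ≤ t) (hpos : 0 < distr f t) :
    dre f (distr f t) = t := by
  refine (h.dre_le ht le_rfl).antisymm (le_of_forall_lt_imp_le_of_dense fun t' ht' => ?_)
  rcases lt_or_ge t' 0 with h0 | h0
  · exact h0.le.trans (dre_nonneg _)
  · exact (h.lt_dre_of_lt_distr (distr_nonneg t) h0 (h.distr_strictAnti hN h0 ht' hpos)).le

theorem hasDerivAt_distr (h : Slice Ω f M) (hnull : ∀ c > 0, volume {x | f x = c} = 0)
    (hN : 0 < N) {s d : ℝ} (hs : 0 < s) (hd : HasDerivAt (dre f) d s) (hd0 : d ≠ 0) :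
    0 < dre f s ∧ d < 0 ∧ HasDerivAt (distr f) d⁻¹ (dre f s) := by
  have hpos : 0 < dre f s := by
    refine (dre_nonneg s).lt_of_ne fun h0 => hd0 ?_
    have : IsLocalMin (dre f) s := .of_forall fun r => by
      rw [← h0]
      exact dre_nonneg r
    exact this.hasDerivAt_eq_zero hd
  have hds := h.distr_dre_eq hnull hs.le hpos
  have hc := h.continuousAt_distr hnull hpos
  refine ⟨hpos, lt_of_le_of_ne ?_ hd0, HasDerivAt.of_local_left_inverse hc (hds.symm ▸ hd) hd0 ?_⟩
  · have h1 := hd.tendsto_slope_zero_right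
    refine le_of_tendsto h1 ?_
    filter_upwards [self_mem_nhdsWithin] with r hr
    rw [mem_Ioi] at hr
    have := h.dre_antitoneOn (mem_Ici.2 hs.le) (mem_Ici.2 (by positivity : 0 ≤ s + r))
      (by linarith)
    exact mul_nonpos_of_nonneg_of_nonpos (inv_pos.2 hr).le (sub_nonpos.2 this)
  · filter_upwards [hc.eventually_const_lt (hds.symm ▸ hs), eventually_ge_nhds hpos] with t ht ht0
    exact h.dre_distr hN ht0 ht

end Slice

/-- The concentration function. -/
def conc {N : ℕ} (f : Euc N → ℝ) (s : ℝ) : ℝ := ∫ σ in (0 : ℝ)..s, dre f σ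

namespace Slice

variable {N : ℕ} {Ω : Set (Euc N)} {f : Euc N → ℝ} {M : ℝ}

theorem intervalIntegrable_dre (h : Slice Ω f M) {s : ℝ} (hs : 0 ≤ s) :
    IntervalIntegrable (dre f) volume 0 s := by
  refine AntitoneOn.intervalIntegrable (h.dre_antitoneOn.mono ?_)
  rw [uIcc_of_le hs]
  exact Icc_subset_Ici_self

theorem conc_eq_integral (h : Slice Ω f M) {s : ℝ} (hs : 0 ≤ s) :
    conc f s = ∫ t in Ioi (0 : ℝ), min s (distr f t) := by
  have hi := h.intervalIntegrable_dre hs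
  rw [conc, intervalIntegral.integral_of_le hs]
  rw [intervalIntegrable_iff_integrableOn_Ioc_of_le hs] at hi
  rw [Integrable.integral_eq_integral_meas_lt hi (.of_forall fun σ => dre_nonneg σ)]
  refine setIntegral_congr_fun measurableSet_Ioi fun t ht => ?_
  have ht0 : (0 : ℝ) < t := ht
  have hset : ({σ | t < dre f σ} ∩ Ioc 0 s : Set ℝ) =ᵐ[volume]
      (Ioc 0 (min s (distr f t)) : Set ℝ) := by
    refine Filter.EventuallyEq.trans (g := (Ioo 0 (min s (distr f t)) : Set ℝ)) ?_ Ioo_ae_eq_Ioc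
    have : ∀ᵐ σ : ℝ, σ ≠ s := by simp [ae_iff]
    filter_upwards [this] with σ hσ
    refine propext ⟨fun hh => ?_, fun hh => ?_⟩
    · obtain ⟨h1, h2, h3⟩ := hh
      exact ⟨h2, lt_min (lt_of_le_of_ne h3 hσ) ((h.lt_dre_iff h2.le ht0.le).1 h1)⟩
    · obtain ⟨h2, h3⟩ := hh
      exact ⟨(h.lt_dre_iff h2.le ht0.le).2 (h3.trans_le (min_le_right _ _)), h2,
        (h3.trans_le (min_le_left _ _)).le⟩
  rw [measureReal_def, Measure.restrict_apply' measurableSet_Ioc, measure_congr hset]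
  rw [Real.volume_Ioc, sub_zero, ENNReal.toReal_ofReal (le_min hs (distr_nonneg t))]

theorem integrableOn_min_distr (h : Slice Ω f M) {s : ℝ} (hs : 0 ≤ s) :
    IntegrableOn (fun t => min s (distr f t)) (Ioi 0) := by
  have h1 : IntegrableOn (fun t => min s (distr f t)) (Icc 0 M) := by
    refine AntitoneOn.integrableOn_isCompact isCompact_Icc fun a ha b hb hab => ?_
    exact min_le_min le_rfl (h.distr_antitoneOn ha.1 hb.1 hab)
  have h2 : IntegrableOn (fun t => min s (distr f t)) (Ioi M) := by
    refine (integrableOn_zero (s := Ioi M)).congr_fun (fun t ht => ?_) measurableSet_Ioi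
    simp [h.distr_eq_zero (le_of_lt ht), hs]
  refine (h1.union h2).mono_set fun t ht => ?_
  rcases le_or_gt t M with h3 | h3
  · exact Or.inl ⟨le_of_lt ht, h3⟩
  · exact Or.inr h3

theorem integrableOn_self (h : Slice Ω f M) : IntegrableOn f Ω :=
  h.integrableOn_of_measurable h.measurable M fun x _ => by
    rw [abs_of_nonneg (h.nonneg x)]
    exact h.bound x

theorem setIntegral_le_conc (h : Slice Ω f M) {E : Set (Euc N)} (hE : E ⊆ Ω)
    (hEm : MeasurableSet E) {s : ℝ} (hs : volume.real E ≤ s) : ∫ x in E, f x ≤ conc f s := by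
  have hs0 : 0 ≤ s := measureReal_nonneg.trans hs
  have hEt : volume E ≠ ⊤ := ((measure_mono hE).trans_lt h.volume_lt_top).ne
  rw [h.conc_eq_integral hs0,
    Integrable.integral_eq_integral_meas_lt (h.integrableOn_self.mono_set hE)
      (.of_forall fun x => h.nonneg x)]
  refine integral_mono_of_nonneg (.of_forall fun t => measureReal_nonneg)
    (h.integrableOn_min_distr hs0) ?_
  filter_upwards [ae_restrict_mem measurableSet_Ioi] with t ht
  rw [measureReal_restrict_apply' hEm]
  exact le_min ((measureReal_mono inter_subset_right hEt).trans hs)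
    (measureReal_mono inter_subset_left (h.volume_superlevel_lt_top (le_of_lt ht)).ne)

theorem setIntegral_dre_eq_conc (h : Slice Ω f M) (hnull : ∀ c > 0, volume {x | f x = c} = 0)
    {s : ℝ} (hs : 0 ≤ s) : ∫ x in {x | dre f s < f x}, f x = conc f s := by
  have hE : {x | dre f s < f x} ⊆ Ω := h.superlevel_subset (dre_nonneg s)
  have hEm : MeasurableSet {x | dre f s < f x} := measurableSet_lt measurable_const h.measurable
  rw [h.conc_eq_integral hs,
    Integrable.integral_eq_integral_meas_lt (h.integrableOn_self.mono_set hE)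
      (.of_forall fun x => h.nonneg x)]
  refine setIntegral_congr_fun measurableSet_Ioi fun t ht => ?_
  have ht0 : (0 : ℝ) < t := ht
  rw [measureReal_restrict_apply' hEm]
  rcases le_or_gt (dre f s) t with h1 | h1
  · have hsub : {x | t < f x} ⊆ {x | dre f s < f x} := fun x hx => h1.trans_lt hx
    rw [inter_eq_left.2 hsub, min_eq_right]
    · rfl
    · exact (h.distr_antitoneOn (dre_nonneg s) ht0.le h1).trans (h.distr_dre_le hs)
  · have hsub : {x | dre f s < f x} ⊆ {x | t < f x} := fun x hx => h1.trans hx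
    rw [inter_eq_right.2 hsub, min_eq_left]
    · exact h.distr_dre_eq hnull hs (ht0.trans h1)
    · exact (h.lt_distr_of_lt_dre ht0.le h1).le

theorem hasDerivAt_conc (h : Slice Ω f M) (hN : 0 < N) {s : ℝ} (hs : 0 < s) :
    HasDerivAt (conc f) (dre f s) s := by
  have hc : ContinuousOn (dre f) (Ioi 0) := fun r hr =>
    (h.continuousAt_dre hN hr).continuousWithinAt
  exact intervalIntegral.integral_hasDerivAt_right (h.intervalIntegrable_dre hs.le)
    (hc.stronglyMeasurableAtFilter isOpen_Ioi s hs) (h.continuousAt_dre hN hs)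

theorem deriv_deriv_conc (h : Slice Ω f M) (hN : 0 < N) {s : ℝ} (hs : 0 < s) :
    deriv (deriv (conc f)) s = deriv (dre f) s := by
  refine Filter.EventuallyEq.deriv_eq ?_
  filter_upwards [eventually_gt_nhds hs] with r hr
  exact (h.hasDerivAt_conc hN hr).deriv

end Slice

/-- The slice of `u` at height `z`, extended by zero outside `Ω`. -/
def slc {N : ℕ} (Ω : Set (Euc N)) (u : Euc N × ℝ → ℝ) (z : ℝ) : Euc N → ℝ :=
  Ω.indicator fun x => u (x, z)

namespace CylSol

variable {N : ℕ} {a : ℝ → ℝ} {Ω : Set (Euc N)} {u : Euc N × ℝ → ℝ} {M : ℝ}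

theorem slc_eventuallyEq (h : CylSol a Ω u M) {x : Euc N} (hx : x ∈ Ω) (z : ℝ) :
    slc Ω u z =ᶠ[𝓝 x] fun x => u (x, z) := by
  filter_upwards [h.isOpen.mem_nhds hx] with y hy
  exact indicator_of_mem hy _

theorem slc_apply {x : Euc N} (hx : x ∈ Ω) (z : ℝ) : slc Ω u z x = u (x, z) :=
  indicator_of_mem hx _

theorem fderiv_slc (h : CylSol a Ω u M) {x : Euc N} (hx : x ∈ Ω) {z : ℝ} (hz : 0 < z) :
    fderiv ℝ (slc Ω u z) x =
      (fderiv ℝ u (x, z)).comp (ContinuousLinearMap.inl ℝ (Euc N) ℝ) := by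
  rw [(h.slc_eventuallyEq hx z).fderiv_eq]
  have h1 : HasFDerivAt u (fderiv ℝ u (x, z)) (x, z) :=
    ((h.contDiffAt hx hz).differentiableAt (by simp)).hasFDerivAt
  exact (h1.comp x (hasFDerivAt_prodMk_left x z)).fderiv

theorem fderiv_fderiv_slc (h : CylSol a Ω u M) {x : Euc N} (hx : x ∈ Ω) {z : ℝ} (hz : 0 < z)
    (e e' : Euc N) : fderiv ℝ (fderiv ℝ (slc Ω u z)) x e e' =
      fderiv ℝ (fderiv ℝ u) (x, z) (e, 0) (e', 0) := by
  have h0 : fderiv ℝ (slc Ω u z) =ᶠ[𝓝 x] fun y =>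
      (fderiv ℝ u (y, z)).comp (ContinuousLinearMap.inl ℝ (Euc N) ℝ) := by
    filter_upwards [h.isOpen.mem_nhds hx] with y hy
    exact h.fderiv_slc hy hz
  rw [h0.fderiv_eq]
  have h1 : HasFDerivAt (fderiv ℝ u) (fderiv ℝ (fderiv ℝ u) (x, z)) (x, z) :=
    (((h.contDiffAt hx hz).fderiv_right (m := ∞) le_rfl).differentiableAt (by simp)).hasFDerivAt
  have h2 : HasFDerivAt (fun y => fderiv ℝ u (y, z)) _ x :=
    h1.comp x (hasFDerivAt_prodMk_left x z)
  rw [(h2.clm_comp (hasFDerivAt_const (ContinuousLinearMap.inl ℝ (Euc N) ℝ) x)).fderiv]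
  simp

theorem norm_prodMk_zero (e : Euc N) : ‖((e, 0) : Euc N × ℝ)‖ = ‖e‖ := by
  simp [Prod.norm_def]

theorem slice (h : CylSol a Ω u M) (hM : 0 ≤ M) {z : ℝ} (hz : 0 < z) :
    Slice Ω (slc Ω u z) M where
  isOpen := h.isOpen
  isBounded := h.isBounded
  cont := continuous_indicator (fun x hx => h.lateral x hx z hz) (h.continuousOn_slice hz)
  zero x hx := indicator_of_notMem hx _
  nonneg := indicator_nonneg fun x hx => h.nonneg x hx z hz
  bound x := indicator_apply_le' (fun hx => h.bound x hx z hz) fun _ => hM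
  smooth x hx := by
    refine ContDiffAt.congr_of_eventuallyEq ?_ (h.slc_eventuallyEq hx z)
    exact (h.contDiffAt hx hz).comp (f := fun x => (x, z)) x (by fun_prop)
  bound₁ x hx := by
    rw [h.fderiv_slc hx hz]
    refine ContinuousLinearMap.opNorm_le_bound _ hM fun e => ?_
    refine (ContinuousLinearMap.le_of_opNorm_le _ (h.bound₁ x hx z hz) _).trans_eq ?_
    simp
  bound₂ x hx := by
    refine ContinuousLinearMap.opNorm_le_bound₂ _ hM fun e e' => ?_
    rw [h.fderiv_fderiv_slc hx hz]
    refine (ContinuousLinearMap.le_opNorm₂ _ _ _).trans ?_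
    rw [norm_prodMk_zero, norm_prodMk_zero]
    gcongr
    exact h.bound₂ x hx z hz

theorem null_slc (h : CylSol a Ω u M) (hN : 0 < N) {z : ℝ} (hz : 0 < z) :
    ∀ c > 0, volume {x | slc Ω u z x = c} = 0 := fun c hc => by
  refine measure_mono_null (fun x hx => ?_) (h.volume_level_eq_zero hN hz hc)
  have hx' : slc Ω u z x = c := hx
  by_cases hxΩ : x ∈ Ω
  · exact ⟨hxΩ, by rwa [slc_apply hxΩ] at hx'⟩
  · rw [slc, indicator_of_notMem hxΩ] at hx'
    exact absurd hx' hc.ne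

theorem lapl_slc (h : CylSol a Ω u M) {x : Euc N} (hx : x ∈ Ω) {z : ℝ} (hz : 0 < z) :
    -lapl (slc Ω u z) x = a z * pd ez (pd ez u) (x, z) := by
  have h1 := h.sol.eqn (x, z) ⟨hx, hz⟩
  have h2 : ∑ i, pd (eb i) (pd (eb i) u) (x, z) = lapl (slc Ω u z) x := by
    refine Finset.sum_congr rfl fun i _ => ?_
    rw [h.fderiv_fderiv_slc hx hz,
      pd_pd_eq ((h.contDiffAt hx hz).of_le (by norm_cast))]
    rfl
  rw [h2] at h1
  dsimp only at h1
  linarith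

end CylSol

theorem eventually_hasDerivAt_of_deriv_deriv_ne {f : ℝ → ℝ} {z : ℝ} (hf : ContinuousAt f z)
    (hne : deriv (deriv f) z ≠ 0) : ∀ᶠ s in 𝓝 z, HasDerivAt f (deriv f s) s := by
  have hd : HasDerivAt (deriv f) (deriv (deriv f) z) z :=
    (differentiableAt_of_deriv_ne_zero hne).hasDerivAt
  have key : ∀ᶠ s in 𝓝[≠] z, HasDerivAt f (deriv f s) s := by
    have h1 : ∀ᶠ s in 𝓝[≠] z, deriv f s ≠ 0 := by
      by_cases h0 : deriv f z = 0
      · rw [← h0]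
        exact hd.eventually_ne hne
      · exact nhdsWithin_le_nhds (hd.continuousAt.eventually_ne h0)
    exact h1.mono fun s hs => (differentiableAt_of_deriv_ne_zero hs).hasDerivAt
  have hz : HasDerivAt f (deriv f z) z := by
    obtain ⟨ε, hε, hball⟩ := Metric.mem_nhdsWithin_iff.1 key
    rw [Real.ball_eq_Ioo] at hball
    have hR : Ioo z (z + ε) ⊆ {s | HasDerivAt f (deriv f s) s} := fun s hs =>
      hball ⟨⟨by linarith [hs.1], hs.2⟩, hs.1.ne'⟩
    have hL : Ioo (z - ε) z ⊆ {s | HasDerivAt f (deriv f s) s} := fun s hs =>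
      hball ⟨⟨hs.1, by linarith [hs.2]⟩, hs.2.ne⟩
    have h1 : HasDerivWithinAt f (deriv f z) (Ici z) z :=
      hasDerivWithinAt_Ici_of_tendsto_deriv
        (fun s hs => (hR hs).differentiableAt.differentiableWithinAt) hf.continuousWithinAt
        (Ioo_mem_nhdsGT (by linarith)) (hd.continuousAt.tendsto.mono_left nhdsWithin_le_nhds)
    have h2 : HasDerivWithinAt f (deriv f z) (Iic z) z :=
      hasDerivWithinAt_Iic_of_tendsto_deriv
        (fun s hs => (hL hs).differentiableAt.differentiableWithinAt) hf.continuousWithinAt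
        (Ioo_mem_nhdsLT (by linarith)) (hd.continuousAt.tendsto.mono_left nhdsWithin_le_nhds)
    exact (h1.union h2).hasDerivAt (by simp)
  rw [eventually_nhdsWithin_iff] at key
  filter_upwards [key] with s hs
  by_cases hsz : s = z
  · rwa [hsz]
  · exact hs hsz

/-- Comparison of second derivatives at a point where `F` touches `f` from below. -/
theorem le_deriv_deriv_of_touching {f F F' : ℝ → ℝ} {z c : ℝ}
    (hf : ∀ᶠ s in 𝓝 z, HasDerivAt f (deriv f s) s) {d : ℝ} (hd : HasDerivAt (deriv f) d z)
    (hF : ∀ᶠ s in 𝓝 z, HasDerivAt F (F' s) s) (hF' : HasDerivAt F' c z)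
    (hle : ∀ᶠ s in 𝓝 z, F s ≤ f s) (heq : F z = f z) : c ≤ d := by
  have h1 : ∀ᶠ s in 𝓝 z, HasDerivAt (fun s => f s - F s) (deriv f s - F' s) s := by
    filter_upwards [hf, hF] with s h1 h2
    exact h1.fun_sub h2
  refine sub_nonneg.1 (second_deriv_nonneg_of_isLocalMin h1 (hd.fun_sub hF') ?_)
  filter_upwards [hle] with s hs
  rw [heq, sub_self]
  exact sub_nonneg.2 hs

theorem deriv_deriv_nonneg_of_touching {f F F' : ℝ → ℝ} {z c : ℝ} (hfc : ContinuousAt f z)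
    (hF : ∀ᶠ s in 𝓝 z, HasDerivAt F (F' s) s) (hF' : HasDerivAt F' c z)
    (hle : ∀ᶠ s in 𝓝 z, F s ≤ f s) (heq : F z = f z) (hc : 0 ≤ c) : 0 ≤ deriv (deriv f) z := by
  by_cases h0 : deriv (deriv f) z = 0
  · rw [h0]
  · exact hc.trans (le_deriv_deriv_of_touching (eventually_hasDerivAt_of_deriv_deriv_ne hfc h0)
      (differentiableAt_of_deriv_ne_zero h0).hasDerivAt hF hF' hle heq)

/-- Differentiation under the integral sign in the vertical variable. -/
theorem hasDerivAt_setIntegral_vertical {N : ℕ} {Ω E : Set (Euc N)} {g : Euc N × ℝ → ℝ} {C : ℝ}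
    (hΩ : IsOpen Ω) (hfin : volume Ω ≠ ⊤) (hE : E ⊆ Ω)
    (hg : ContDiffOn ℝ 1 g (Ω ×ˢ Ioi 0)) (hb : ∀ x ∈ Ω, ∀ z, 0 < z → |g (x, z)| ≤ C)
    (hb' : ∀ x ∈ Ω, ∀ z, 0 < z → |pd ez g (x, z)| ≤ C) (hEm : MeasurableSet E) {z : ℝ}
    (hz : 0 < z) :
    HasDerivAt (fun z => ∫ x in E, g (x, z)) (∫ x in E, pd ez g (x, z)) z := by
  have hV : IsOpen (Ω ×ˢ Ioi (0 : ℝ)) := hΩ.prod isOpen_Ioi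
  have hsm : ∀ {k : Euc N × ℝ → ℝ}, ContinuousOn k (Ω ×ˢ Ioi (0 : ℝ)) → ∀ r, 0 < r →
      AEStronglyMeasurable (fun x => k (x, r)) (volume.restrict E) := fun {k} hk r hr => by
    have : ContinuousOn (fun x => k (x, r)) Ω :=
      hk.comp (f := fun x => (x, r)) (by fun_prop) fun x hx => ⟨hx, hr⟩
    exact (this.aestronglyMeasurable hΩ.measurableSet).mono_measure (Measure.restrict_mono_set _ hE)
  have hpos : Ioi (0 : ℝ) ∈ 𝓝 z := Ioi_mem_nhds hz
  have hcp : ContinuousOn (pd ez g) (Ω ×ˢ Ioi (0 : ℝ)) :=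
    (contDiffOn_pd hV ez hg (m := 0) (by simp)).continuousOn
  refine (hasDerivAt_integral_of_dominated_loc_of_deriv_le (s := Ioi 0)
    (F := fun z x => g (x, z)) (F' := fun z x => pd ez g (x, z)) (bound := fun _ => C)
    hpos ?_ ?_ ?_ ?_ ?_ ?_).2
  · filter_upwards [hpos] with r hr
    exact hsm hg.continuousOn r hr
  · refine IntegrableOn.of_bound ((measure_mono hE).trans_lt hfin.lt_top)
      (hsm hg.continuousOn z hz) C ?_
    filter_upwards [ae_restrict_mem hEm] with x hx
    exact hb x (hE hx) z hz
  · exact hsm hcp z hz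
  · filter_upwards [ae_restrict_mem hEm] with x hx r hr
    exact hb' x (hE hx) r hr
  · exact integrableOn_const (hs := ((measure_mono hE).trans_lt hfin.lt_top).ne)
  · filter_upwards [ae_restrict_mem hEm] with x hx r hr
    have h1 : DifferentiableAt ℝ g (x, r) :=
      (hg.contDiffAt (hV.mem_nhds ⟨hE hx, hr⟩)).differentiableAt (by simp)
    exact h1.hasFDerivAt.comp_hasDerivAt r (hasFDerivAt_prodMk_right x r).hasDerivAt |>.congr_deriv
      (by simp [pd, ez])

theorem norm_ez_le {N : ℕ} : ‖(ez : Euc N × ℝ)‖ ≤ 1 := by simp [ez, Prod.norm_def]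

namespace CylSol

variable {N : ℕ} {a : ℝ → ℝ} {Ω : Set (Euc N)} {u : Euc N × ℝ → ℝ} {M : ℝ}

theorem volume_ne_top (h : CylSol a Ω u M) : volume Ω ≠ ⊤ := h.isBounded.measure_lt_top.ne

theorem contDiffOn_vel (h : CylSol a Ω u M) : ContDiffOn ℝ ∞ (pd ez u) (Ω ×ˢ Ioi 0) :=
  contDiffOn_pd h.isOpen_cyl ez h.contDiffOn_infty (by simp)

theorem abs_u_le (h : CylSol a Ω u M) {x : Euc N} (hx : x ∈ Ω) {z : ℝ} (hz : 0 < z) :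
    |u (x, z)| ≤ M := by
  rw [abs_of_nonneg (h.nonneg x hx z hz)]
  exact h.bound x hx z hz

theorem abs_vel_le (h : CylSol a Ω u M) {x : Euc N} (hx : x ∈ Ω) {z : ℝ} (hz : 0 < z) :
    |pd ez u (x, z)| ≤ M := by
  have h1 := (fderiv ℝ u (x, z)).le_opNorm ez
  have h2 := h.bound₁ x hx z hz
  have h3 := mul_le_mul h2 (norm_ez_le (N := N)) (norm_nonneg _) ((norm_nonneg _).trans h2)
  rw [mul_one] at h3
  exact h1.trans h3

theorem abs_acc_le (h : CylSol a Ω u M) {x : Euc N} (hx : x ∈ Ω) {z : ℝ} (hz : 0 < z) :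
    |pd ez (pd ez u) (x, z)| ≤ M := by
  rw [pd_pd_eq ((h.contDiffAt hx hz).of_le (by norm_cast))]
  have h1 := (fderiv ℝ (fderiv ℝ u) (x, z)).le_opNorm₂ ez ez
  have h2 := h.bound₂ x hx z hz
  have h0 : 0 ≤ M := (norm_nonneg (fderiv ℝ u (x, z))).trans (h.bound₁ x hx z hz)
  have h3 := mul_le_mul h2 (norm_ez_le (N := N)) (norm_nonneg _) h0
  have h4 := mul_le_mul h3 (norm_ez_le (N := N)) (norm_nonneg _) (by simpa using h0)
  rw [mul_one, mul_one] at h4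
  exact h1.trans h4

theorem hasDerivAt_vertical (h : CylSol a Ω u M) {g : Euc N × ℝ → ℝ}
    (hg : ContDiffOn ℝ ∞ g (Ω ×ˢ Ioi 0)) {x : Euc N} (hx : x ∈ Ω) {z : ℝ} (hz : 0 < z) :
    HasDerivAt (fun z => g (x, z)) (pd ez g (x, z)) z := by
  have h1 : DifferentiableAt ℝ g (x, z) :=
    (hg.contDiffAt (h.isOpen_cyl.mem_nhds (mk_mem_prod hx hz))).differentiableAt (by simp)
  exact h1.hasFDerivAt.comp_hasDerivAt z (hasFDerivAt_prodMk_right x z).hasDerivAt |>.congr_deriv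
    (by simp [pd, ez])

theorem abs_u_sub_le (h : CylSol a Ω u M) {x : Euc N} (hx : x ∈ Ω) {z z' : ℝ} (hz : 0 < z)
    (hz' : 0 < z') : |u (x, z') - u (x, z)| ≤ M * |z' - z| :=
  (convex_Ioi (0 : ℝ)).norm_image_sub_le_of_norm_hasDerivWithin_le
    (f := fun z => u (x, z)) (f' := fun z => pd ez u (x, z))
    (fun _ hr => (h.hasDerivAt_vertical h.contDiffOn_infty hx hr).hasDerivWithinAt)
    (fun _ hr => h.abs_vel_le hx hr) hz hz'

theorem abs_vel_sub_le (h : CylSol a Ω u M) {x : Euc N} (hx : x ∈ Ω) {z z' : ℝ} (hz : 0 < z)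
    (hz' : 0 < z') : |pd ez u (x, z') - pd ez u (x, z)| ≤ M * |z' - z| :=
  (convex_Ioi (0 : ℝ)).norm_image_sub_le_of_norm_hasDerivWithin_le
    (f := fun z => pd ez u (x, z)) (f' := fun z => pd ez (pd ez u) (x, z))
    (fun _ hr => (h.hasDerivAt_vertical h.contDiffOn_vel hx hr).hasDerivWithinAt)
    (fun _ hr => h.abs_acc_le hx hr) hz hz'

theorem abs_taylor_le (h : CylSol a Ω u M) {x : Euc N} (hx : x ∈ Ω) {z z' : ℝ} (hz : 0 < z)
    (hz' : 0 < z') :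
    |u (x, z') - u (x, z) - (z' - z) * pd ez u (x, z)| ≤ M * (z' - z) ^ 2 := by
  have hsub : uIcc z z' ⊆ Ioi 0 := fun r hr => lt_of_lt_of_le (lt_min hz hz') hr.1
  have h1 := (convex_uIcc z z').norm_image_sub_le_of_norm_hasDerivWithin_le
    (f := fun r => u (x, r) - r * pd ez u (x, z)) (C := M * |z' - z|)
    (f' := fun r => pd ez u (x, r) - pd ez u (x, z))
    (fun r hr => ((h.hasDerivAt_vertical h.contDiffOn_infty hx (hsub hr)).fun_sub
      (by simpa using (hasDerivAt_id' r).mul_const (pd ez u (x, z)))).hasDerivWithinAt)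
    (fun r hr => (h.abs_vel_sub_le hx hz (hsub hr)).trans
      (mul_le_mul_of_nonneg_left (abs_sub_left_of_mem_uIcc hr)
        ((abs_nonneg _).trans (h.abs_u_le hx hz)))) left_mem_uIcc right_mem_uIcc
  rw [Real.norm_eq_abs, Real.norm_eq_abs, mul_assoc, ← abs_mul, ← sq, abs_of_nonneg (sq_nonneg (z' - z))]
    at h1
  convert h1 using 2
  ring

theorem integrableOn_slice (h : CylSol a Ω u M) {g : Euc N × ℝ → ℝ}
    (hg : ContinuousOn g (Ω ×ˢ Ioi 0)) {C z : ℝ} (hz : 0 < z) (hb : ∀ x ∈ Ω, |g (x, z)| ≤ C) :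
    IntegrableOn (fun x => g (x, z)) Ω := by
  have : ContinuousOn (fun x => g (x, z)) Ω :=
    hg.comp (f := fun x => (x, z)) (by fun_prop) fun x hx => ⟨hx, hz⟩
  refine IntegrableOn.of_bound h.volume_ne_top.lt_top
    (this.aestronglyMeasurable h.isOpen.measurableSet) C ?_
  filter_upwards [ae_restrict_mem h.isOpen.measurableSet] with x hx
  exact hb x hx

theorem integrableOn_self (h : CylSol a Ω u M) {z : ℝ} (hz : 0 < z) :
    IntegrableOn (fun x => u (x, z)) Ω :=
  h.integrableOn_slice h.contDiffOn_infty.continuousOn hz fun _ hx => h.abs_u_le hx hz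

theorem integrableOn_vel (h : CylSol a Ω u M) {z : ℝ} (hz : 0 < z) :
    IntegrableOn (fun x => pd ez u (x, z)) Ω :=
  h.integrableOn_slice h.contDiffOn_vel.continuousOn hz fun _ hx => h.abs_vel_le hx hz

theorem integrableOn_acc (h : CylSol a Ω u M) {z : ℝ} (hz : 0 < z) :
    IntegrableOn (fun x => pd ez (pd ez u) (x, z)) Ω :=
  h.integrableOn_slice (contDiffOn_pd h.isOpen_cyl ez h.contDiffOn_vel (m := 0)
    (by simp)).continuousOn hz fun _ hx => h.abs_acc_le hx hz

theorem hasDerivAt_integral (h : CylSol a Ω u M) {E : Set (Euc N)} (hE : E ⊆ Ω)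
    (hEm : MeasurableSet E) {z : ℝ} (hz : 0 < z) :
    HasDerivAt (fun z => ∫ x in E, u (x, z)) (∫ x in E, pd ez u (x, z)) z :=
  hasDerivAt_setIntegral_vertical h.isOpen h.volume_ne_top hE
    (h.contDiffOn_infty.of_le (by norm_cast)) (fun _ hx _ hz => h.abs_u_le hx hz)
    (fun _ hx _ hz => h.abs_vel_le hx hz) hEm hz

theorem hasDerivAt_integral_vel (h : CylSol a Ω u M) {E : Set (Euc N)} (hE : E ⊆ Ω)
    (hEm : MeasurableSet E) {z : ℝ} (hz : 0 < z) :
    HasDerivAt (fun z => ∫ x in E, pd ez u (x, z)) (∫ x in E, pd ez (pd ez u) (x, z)) z :=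
  hasDerivAt_setIntegral_vertical h.isOpen h.volume_ne_top hE
    (h.contDiffOn_vel.of_le (by norm_cast)) (fun _ hx _ hz => h.abs_vel_le hx hz)
    (fun _ hx _ hz => h.abs_acc_le hx hz) hEm hz

end CylSol

/-- The superlevel set of the slice at height `z`, of measure (at most) `s`. -/
def sup {N : ℕ} (Ω : Set (Euc N)) (u : Euc N × ℝ → ℝ) (s z : ℝ) : Set (Euc N) :=
  {x | dre (slc Ω u z) s < slc Ω u z x}

namespace CylSol

variable {N : ℕ} {a : ℝ → ℝ} {Ω : Set (Euc N)} {u : Euc N × ℝ → ℝ} {M : ℝ}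

theorem sup_subset (h : CylSol a Ω u M) (hM : 0 ≤ M) {s z : ℝ} (hz : 0 < z) :
    sup Ω u s z ⊆ Ω := (h.slice hM hz).superlevel_subset (Slice.dre_nonneg s)

theorem measurableSet_sup (h : CylSol a Ω u M) (hM : 0 ≤ M) {s z : ℝ} (hz : 0 < z) :
    MeasurableSet (sup Ω u s z) :=
  measurableSet_lt measurable_const (h.slice hM hz).measurable

theorem setIntegral_slc {E : Set (Euc N)} (hE : E ⊆ Ω)
    (hEm : MeasurableSet E) (z : ℝ) : ∫ x in E, slc Ω u z x = ∫ x in E, u (x, z) :=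
  setIntegral_congr_fun hEm fun _ hx => slc_apply (hE hx) z

theorem integral_sup (h : CylSol a Ω u M) (hM : 0 ≤ M) (hN : 0 < N) {s z : ℝ} (hs : 0 ≤ s)
    (hz : 0 < z) : ∫ x in sup Ω u s z, u (x, z) = conc (slc Ω u z) s := by
  rw [← setIntegral_slc (h.sup_subset hM hz) (h.measurableSet_sup hM hz)]
  exact (h.slice hM hz).setIntegral_dre_eq_conc (h.null_slc hN hz) hs

theorem integral_sup_le (h : CylSol a Ω u M) (hM : 0 ≤ M) {s z z' : ℝ} (hs : 0 ≤ s)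
    (hz : 0 < z) (hz' : 0 < z') : ∫ x in sup Ω u s z, u (x, z') ≤ conc (slc Ω u z') s := by
  rw [← setIntegral_slc (h.sup_subset hM hz) (h.measurableSet_sup hM hz)]
  exact (h.slice hM hz').setIntegral_le_conc (h.sup_subset hM hz) (h.measurableSet_sup hM hz)
    ((h.slice hM hz).distr_dre_le hs)

/-- The second-order expansion from below given by a fixed superlevel set. -/
theorem le_conc_sub (h : CylSol a Ω u M) (hM : 0 ≤ M) (hN : 0 < N) {s z z' : ℝ} (hs : 0 ≤ s)
    (hz : 0 < z) (hz' : 0 < z') :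
    (z' - z) * ∫ x in sup Ω u s z, pd ez u (x, z) ≤
      conc (slc Ω u z') s - conc (slc Ω u z) s + M * (z' - z) ^ 2 * volume.real Ω := by
  have hE := h.sup_subset hM (s := s) hz
  have hEm := h.measurableSet_sup hM (s := s) hz
  have hi := (h.integrableOn_self hz).mono_set hE
  have hi' := (h.integrableOn_self hz').mono_set hE
  have hv := (h.integrableOn_vel hz).mono_set hE
  have h1 := h.integral_sup_le hM hs hz hz'
  have hfin : volume (sup Ω u s z) ≠ ⊤ := ((measure_mono hE).trans_lt h.volume_ne_top.lt_top).ne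
  rw [← h.integral_sup hM hN hs hz]
  have h2 : ∫ x in sup Ω u s z, ((z' - z) * pd ez u (x, z)) ≤
      ∫ x in sup Ω u s z, ((u (x, z') - u (x, z)) + M * (z' - z) ^ 2) := by
    refine setIntegral_mono_on (hv.const_mul _)
      ((hi'.sub hi).add (integrableOn_const (hs := hfin))) hEm fun x hx => ?_
    have := (abs_le.1 (h.abs_taylor_le (hE hx) hz hz')).1
    linarith
  rw [integral_const_mul, integral_add (f := fun x => u (x, z') - u (x, z)) (hi'.sub hi)
    (integrableOn_const (hs := hfin)), integral_sub hi' hi, setIntegral_const, smul_eq_mul] at h2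
  have h3 : volume.real (sup Ω u s z) * (M * (z' - z) ^ 2) ≤
      M * (z' - z) ^ 2 * volume.real Ω := by
    rw [mul_comm]
    exact mul_le_mul_of_nonneg_left (measureReal_mono hE h.volume_ne_top) (by positivity)
  linarith

theorem abs_integral_vel_le (h : CylSol a Ω u M) (hM : 0 ≤ M) {E : Set (Euc N)} (hE : E ⊆ Ω)
    {z : ℝ} (hz : 0 < z) :
    |∫ x in E, pd ez u (x, z)| ≤ M * volume.real Ω := by
  have h1 := norm_setIntegral_le_of_norm_le_const (μ := volume) (s := E) (C := M)
    (f := fun x => pd ez u (x, z)) ((measure_mono hE).trans_lt h.volume_ne_top.lt_top)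
    (fun x hx => h.abs_vel_le (hE hx) hz)
  exact h1.trans (mul_le_mul_of_nonneg_left (measureReal_mono hE h.volume_ne_top) hM)

theorem continuousAt_conc (h : CylSol a Ω u M) (hM : 0 ≤ M) (hN : 0 < N) {s z : ℝ} (hs : 0 ≤ s)
    (hz : 0 < z) : ContinuousAt (fun z => conc (slc Ω u z) s) z := by
  set V := volume.real Ω with hV
  have hlim : Tendsto (fun z' => M * V * |z' - z| + M * (z' - z) ^ 2 * V) (𝓝 z) (𝓝 0) := by
    have : Continuous fun z' => M * V * |z' - z| + M * (z' - z) ^ 2 * V := by fun_prop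
    simpa using this.tendsto z
  rw [ContinuousAt, tendsto_iff_norm_sub_tendsto_zero]
  refine squeeze_zero' (.of_forall fun _ => norm_nonneg _) ?_ hlim
  filter_upwards [Ioi_mem_nhds hz] with z' hz'
  have e1 := h.le_conc_sub hM hN hs hz hz'
  have e2 := h.le_conc_sub hM hN hs hz' hz
  have b : ∀ {y : ℝ}, 0 < y → |(z' - z) * ∫ x in sup Ω u s y, pd ez u (x, y)| ≤
      M * V * |z' - z| := fun {y} hy => by
    rw [abs_mul, mul_comm]
    exact mul_le_mul_of_nonneg_right (h.abs_integral_vel_le hM (h.sup_subset hM hy) hy) (abs_nonneg _)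
  have b1 := abs_le.1 (b hz)
  have b2 := abs_le.1 (b hz')
  rw [Real.norm_eq_abs, abs_le]
  constructor <;> nlinarith [b1.1, b1.2, b2.1, b2.2]

theorem integral_acc_nonneg (h : CylSol a Ω u M) (hM : 0 ≤ M) {z t : ℝ} (hz : 0 < z)
    (ht : 0 ≤ t) : 0 ≤ ∫ x in {x | t < slc Ω u z x}, pd ez (pd ez u) (x, z) := by
  have hS := h.slice hM hz
  have hmeas : ∀ t, MeasurableSet {x | t < slc Ω u z x} := fun t =>
    measurableSet_lt measurable_const hS.measurable
  have key : ∀ t, 0 < t → 0 ≤ ∫ x in {x | t < slc Ω u z x}, pd ez (pd ez u) (x, z) :=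
    fun t ht => by
    have h1 := hS.integral_neg_lapl_nonneg ht
    rw [setIntegral_congr_fun (hmeas t) (g := fun x => a z * pd ez (pd ez u) (x, z))
      fun x hx => h.lapl_slc (hS.superlevel_subset ht.le hx) hz, integral_const_mul] at h1
    exact nonneg_of_mul_nonneg_right h1 (h.pos z hz)
  rcases ht.eq_or_lt with rfl | ht
  · have hU : {x | 0 < slc Ω u z x} = ⋃ n : ℕ, {x | 1 / ((n : ℝ) + 1) < slc Ω u z x} := by
      ext x
      simp only [mem_iUnion, mem_ofPred_eq]
      exact ⟨fun hx => exists_nat_one_div_lt hx, fun ⟨n, hn⟩ => lt_trans (by positivity) hn⟩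
    have hlim := tendsto_setIntegral_of_monotone (μ := volume)
      (f := fun x => pd ez (pd ez u) (x, z))
      (s := fun n : ℕ => {x | 1 / ((n : ℝ) + 1) < slc Ω u z x})
      (fun n => hmeas _) (fun m n hmn x (hx : 1 / ((m : ℝ) + 1) < slc Ω u z x) =>
        lt_of_le_of_lt (b := 1 / ((m : ℝ) + 1)) (by gcongr) hx)
      (by
        rw [← hU]
        exact (h.integrableOn_acc hz).mono_set (hS.superlevel_subset le_rfl))
    rw [← hU] at hlim
    exact ge_of_tendsto' hlim fun n => key _ (by positivity)
  · exact key t ht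

theorem deriv_deriv_conc_nonneg (h : CylSol a Ω u M) (hM : 0 ≤ M) (hN : 0 < N) {s z : ℝ}
    (hs : 0 ≤ s) (hz : 0 < z) : 0 ≤ deriv (deriv fun z => conc (slc Ω u z) s) z := by
  refine deriv_deriv_nonneg_of_touching (F := fun z' => ∫ x in sup Ω u s z, u (x, z'))
    (h.continuousAt_conc hM hN hs hz) ?_
    (h.hasDerivAt_integral_vel (h.sup_subset hM hz) (h.measurableSet_sup hM hz) hz) ?_
    (h.integral_sup hM hN hs hz) (h.integral_acc_nonneg hM hz (Slice.dre_nonneg s))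
  · filter_upwards [Ioi_mem_nhds hz] with r hr
    exact h.hasDerivAt_integral (h.sup_subset hM hz) (h.measurableSet_sup hM hz) hr
  · filter_upwards [Ioi_mem_nhds hz] with r hr
    exact h.integral_sup_le hM hs hz hr

end CylSol

theorem abs_div_sqrt_le_one (y η : ℝ) : |y / √(y ^ 2 + η ^ 2)| ≤ 1 := by
  rw [abs_div, abs_of_nonneg (Real.sqrt_nonneg _)]
  refine div_le_one_of_le₀ (Real.le_sqrt_of_sq_le ?_) (Real.sqrt_nonneg _)
  rw [sq_abs]
  nlinarith [sq_nonneg η]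

namespace Slice

variable {N : ℕ} {Ω : Set (Euc N)} {f : Euc N → ℝ} {M : ℝ}

theorem continuous_mul_of_tsupport (_ : Slice Ω f M) {k P : Euc N → ℝ} (hk : ContinuousOn k Ω)
    (hΩ : IsOpen Ω) (hP : Continuous P) (hs : tsupport P ⊆ Ω) : Continuous fun x => k x * P x :=
  continuous_of_tsupport fun _ hx =>
    ((hk.continuousAt (hΩ.mem_nhds (hs (tsupport_mul_subset_right hx)))).mul hP.continuousAt)

/-- Integration by parts against a function of `f`. -/
theorem integral_comp_mul (h : Slice Ω f M) {P : Euc N → ℝ} (hP : ContDiff ℝ 1 P)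
    (hPc : HasCompactSupport P) (hPs : tsupport P ⊆ Ω) (e : Euc N) {S ρ : ℝ → ℝ}
    (hρ : Continuous ρ) (hS : ∀ y, HasDerivAt S (ρ y) y) :
    ∫ x, ρ (f x) * (fderiv ℝ f x e * P x) = -∫ x, S (f x) * fderiv ℝ P x e := by
  have hSc : Continuous S := continuous_iff_continuousAt.2 fun y => (hS y).continuousAt
  have hfe : ContinuousOn (fun x => fderiv ℝ f x e) Ω := fun x hx =>
    (((h.smooth x hx).fderiv_right (m := ∞) le_rfl).continuousAt.clm_apply
      continuousAt_const).continuousWithinAt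
  have c1 : Continuous fun x => ρ (f x) * (fderiv ℝ f x e * P x) :=
    (hρ.comp h.cont).mul (h.continuous_mul_of_tsupport hfe h.isOpen hP.continuous hPs)
  have i1 : Integrable fun x => ρ (f x) * (fderiv ℝ f x e * P x) :=
    c1.integrable_of_hasCompactSupport hPc.mul_left.mul_left
  have hPe : HasCompactSupport fun x => fderiv ℝ P x e := hPc.fderiv_apply (𝕜 := ℝ) e
  have i2 : Integrable fun x => S (f x) * fderiv ℝ P x e :=
    ((hSc.comp h.cont).mul ((hP.continuous_fderiv (by simp)).clm_apply
      continuous_const)).integrable_of_hasCompactSupport hPe.mul_left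
  have i3 : Integrable fun x => S (f x) * P x :=
    ((hSc.comp h.cont).mul hP.continuous).integrable_of_hasCompactSupport hPc.mul_left
  have hd : ∀ x, HasLineDerivAt ℝ (fun x => S (f x) * P x)
      (ρ (f x) * (fderiv ℝ f x e * P x) + S (f x) * fderiv ℝ P x e) x e := by
    intro x
    have d2 : HasFDerivAt P (fderiv ℝ P x) x := (hP.differentiable (by simp) x).hasFDerivAt
    by_cases hx : x ∈ Ω
    · have d1 : HasFDerivAt f (fderiv ℝ f x) x :=
        ((h.smooth x hx).differentiableAt (by simp)).hasFDerivAt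
      have d3 := ((hS (f x)).comp_hasFDerivAt x d1).mul d2
      refine (d3.hasLineDerivAt e).congr_deriv ?_
      simp
      ring
    · have hx' : x ∉ tsupport P := fun hh => hx (hPs hh)
      have heq := notMem_tsupport_iff_eventuallyEq.1 hx'
      have hPx : P x = 0 := heq.self_of_nhds
      have hdx : fderiv ℝ P x = 0 := by
        rw [heq.fderiv_eq]
        simp
      rw [hPx, hdx]
      have heq' : (fun x => S (f x) * P x) =ᶠ[𝓝 x] fun _ => 0 := by
        filter_upwards [heq] with y hy
        rw [hy]
        simp
      simpa using ((hasFDerivAt_const (0 : ℝ) x).congr_of_eventuallyEq heq').hasLineDerivAt e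
  have := integral_bilinear_hasLineDerivAt_right_eq_neg_left_of_integrable
    (μ := volume) (v := e) (B := ContinuousLinearMap.mul ℝ ℝ) (f := fun _ => (1 : ℝ))
    (f' := fun _ => 0) (g := fun x => S (f x) * P x)
    (g' := fun x => ρ (f x) * (fderiv ℝ f x e * P x) + S (f x) * fderiv ℝ P x e)
    (by simp) (by
      simp only [ContinuousLinearMap.mul_apply', one_mul]
      exact i1.add i2)
    (by simpa using i3)
    (fun x _ => (hasFDerivAt_const (1 : ℝ) x).hasLineDerivAt e) (fun x _ => hd x)
  simp only [ContinuousLinearMap.mul_apply', one_mul, zero_mul, integral_zero, neg_zero] at this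
  rw [integral_add i1 i2] at this
  linarith

theorem ae_ne (_ : Slice Ω f M) (hnull : ∀ c > 0, volume {x | f x = c} = 0) {t : ℝ}
    (ht : 0 < t) : ∀ᵐ x, f x ≠ t := by
  rw [ae_iff]
  simpa using hnull t ht

theorem integral_sign_mul (h : Slice Ω f M) (hnull : ∀ c > 0, volume {x | f x = c} = 0)
    {P : Euc N → ℝ} (hP : ContDiff ℝ 1 P)
    (hPc : HasCompactSupport P) (hPs : tsupport P ⊆ Ω) (e : Euc N) {t : ℝ} (ht : 0 < t) :
    ∫ x, ((f x - t) / |f x - t|) * (fderiv ℝ f x e * P x) =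
      -∫ x, |f x - t| * fderiv ℝ P x e := by
  have hfe : ContinuousOn (fun x => fderiv ℝ f x e) Ω := fun x hx =>
    (((h.smooth x hx).fderiv_right (m := ∞) le_rfl).continuousAt.clm_apply
      continuousAt_const).continuousWithinAt
  have c1 := h.continuous_mul_of_tsupport hfe h.isOpen hP.continuous hPs
  have i1 : Integrable fun x => fderiv ℝ f x e * P x :=
    c1.integrable_of_hasCompactSupport hPc.mul_left
  have hPe : HasCompactSupport fun x => fderiv ℝ P x e := hPc.fderiv_apply (𝕜 := ℝ) e
  have c2 : Continuous fun x => fderiv ℝ P x e :=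
    (hP.continuous_fderiv (by simp)).clm_apply continuous_const
  have hfc := h.cont
  have L1 : Tendsto (fun η : ℝ => ∫ x, ((f x - t) / √((f x - t) ^ 2 + η ^ 2)) *
      (fderiv ℝ f x e * P x)) (𝓝[≠] 0)
      (𝓝 (∫ x, ((f x - t) / |f x - t|) * (fderiv ℝ f x e * P x))) := by
    refine tendsto_integral_filter_of_dominated_convergence
      (fun x => |fderiv ℝ f x e * P x|) ?_ ?_ i1.abs ?_
    · refine .of_forall fun η => ?_
      have : Measurable fun x => (f x - t) / √((f x - t) ^ 2 + η ^ 2) := by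
        have := h.measurable
        fun_prop
      exact (this.mul c1.measurable).aestronglyMeasurable
    · refine .of_forall fun η => .of_forall fun x => ?_
      rw [Real.norm_eq_abs, abs_mul]
      exact mul_le_of_le_one_left (abs_nonneg _) (abs_div_sqrt_le_one _ _)
    · filter_upwards [h.ae_ne hnull ht] with x hx
      refine Tendsto.mul_const _ ?_
      have hne : √((f x - t) ^ 2 + 0 ^ 2) ≠ 0 := by
        rw [Real.sqrt_ne_zero']
        have : f x - t ≠ 0 := sub_ne_zero.2 hx
        positivity
      have : ContinuousAt (fun η : ℝ => (f x - t) / √((f x - t) ^ 2 + η ^ 2)) 0 :=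
        continuousAt_const.div (by fun_prop) hne
      have := this.tendsto
      rw [zero_pow two_ne_zero, add_zero, Real.sqrt_sq_eq_abs] at this
      exact this.mono_left nhdsWithin_le_nhds
  have L2 : Tendsto (fun η : ℝ => -∫ x, √((f x - t) ^ 2 + η ^ 2) * fderiv ℝ P x e) (𝓝[≠] 0)
      (𝓝 (-∫ x, |f x - t| * fderiv ℝ P x e)) := by
    refine Tendsto.neg ?_
    refine tendsto_integral_filter_of_dominated_convergence
      (fun x => √((f x - t) ^ 2 + 1) * |fderiv ℝ P x e|) ?_ ?_ ?_ ?_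
    · refine .of_forall fun η => Continuous.aestronglyMeasurable ?_
      fun_prop
    · have : ∀ᶠ η : ℝ in 𝓝[≠] 0, |η| < 1 := by
        have := (continuous_abs.tendsto (0 : ℝ)).eventually_lt_const (u := 1) (by simp)
        exact nhdsWithin_le_nhds this
      filter_upwards [this] with η hη
      refine .of_forall fun x => ?_
      rw [Real.norm_eq_abs, abs_mul, abs_of_nonneg (Real.sqrt_nonneg _)]
      have : η ^ 2 ≤ 1 := by rw [← sq_abs]; nlinarith [abs_nonneg η]
      gcongr
    · have hc : Continuous fun x => √((f x - t) ^ 2 + 1) * |fderiv ℝ P x e| := by fun_prop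
      exact hc.integrable_of_hasCompactSupport (hPe.norm.mul_left)
    · refine .of_forall fun x => Tendsto.mul_const _ ?_
      have : ContinuousAt (fun η : ℝ => √((f x - t) ^ 2 + η ^ 2)) 0 := by fun_prop
      have := this.tendsto
      rw [zero_pow two_ne_zero, add_zero, Real.sqrt_sq_eq_abs] at this
      exact this.mono_left nhdsWithin_le_nhds
  refine tendsto_nhds_unique (L1.congr' ?_) L2
  filter_upwards [self_mem_nhdsWithin] with η hη
  have hpos : ∀ y : ℝ, (y - t) ^ 2 + η ^ 2 ≠ 0 := fun y => by
    have : η ≠ 0 := hη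
    positivity
  refine h.integral_comp_mul hP hPc hPs e (ρ := fun y => (y - t) / √((y - t) ^ 2 + η ^ 2))
    (S := fun y => √((y - t) ^ 2 + η ^ 2)) ?_ fun y => ?_
  · exact Continuous.div (by fun_prop) (by fun_prop) fun y => (Real.sqrt_ne_zero
      (by positivity)).2 (hpos y)
  · refine ((((hasDerivAt_id' y).sub_const t).fun_pow 2).add_const (η ^ 2)).sqrt (hpos y)
      |>.congr_deriv ?_
    field_simp
    simp
    ring

/-- Weighted distribution functions with weight `P ∂_e f` are differentiable. -/
theorem exists_hasDerivAt_weighted (h : Slice Ω f M)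
    (hnull : ∀ c > 0, volume {x | f x = c} = 0) {P : Euc N → ℝ} (hP : ContDiff ℝ 1 P)
    (hPc : HasCompactSupport P) (hPs : tsupport P ⊆ Ω) (e : Euc N) {t₀ : ℝ} (ht₀ : 0 < t₀) :
    ∃ d, HasDerivAt (fun t => ∫ x in {x | t < f x}, fderiv ℝ f x e * P x) d t₀ := by
  have hfe : ContinuousOn (fun x => fderiv ℝ f x e) Ω := fun x hx =>
    (((h.smooth x hx).fderiv_right (m := ∞) le_rfl).continuousAt.clm_apply
      continuousAt_const).continuousWithinAt
  have c1 := h.continuous_mul_of_tsupport hfe h.isOpen hP.continuous hPs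
  have i1 : Integrable fun x => fderiv ℝ f x e * P x :=
    c1.integrable_of_hasCompactSupport hPc.mul_left
  have hPe : HasCompactSupport fun x => fderiv ℝ P x e := hPc.fderiv_apply (𝕜 := ℝ) e
  have c2 : Continuous fun x => fderiv ℝ P x e :=
    (hP.continuous_fderiv (by simp)).clm_apply continuous_const
  have hfc := h.cont
  have hinteg : ∀ t, 0 < t → ∫ x in {x | t < f x}, fderiv ℝ f x e * P x =
      (∫ x, fderiv ℝ f x e * P x) / 2 - (∫ x, |f x - t| * fderiv ℝ P x e) / 2 := by
    intro t ht
    have hS : MeasurableSet {x | t < f x} := measurableSet_lt measurable_const h.measurable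
    have h1 := h.integral_sign_mul hnull hP hPc hPs e ht
    have i2 : Integrable fun x => ((f x - t) / |f x - t|) * (fderiv ℝ f x e * P x) := by
      refine i1.bdd_mul (c := 1) ?_ (.of_forall fun x => ?_)
      · have : Measurable fun x => (f x - t) / |f x - t| := by
          have := h.measurable
          fun_prop
        exact this.aestronglyMeasurable
      · rw [Real.norm_eq_abs, abs_div, abs_abs]
        exact div_self_le_one _
    have h2 : ∫ x in {x | t < f x}, fderiv ℝ f x e * P x =
        ∫ x, (1 / 2 * (fderiv ℝ f x e * P x) +
          1 / 2 * (((f x - t) / |f x - t|) * (fderiv ℝ f x e * P x))) := by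
      rw [← integral_indicator hS]
      refine integral_congr_ae ?_
      filter_upwards [h.ae_ne hnull ht] with x hx
      rcases lt_or_gt_of_ne hx with hx | hx
      · rw [indicator_of_notMem (by simpa using hx.le), abs_of_neg (by linarith), div_neg,
          div_self (by linarith)]
        ring
      · rw [indicator_of_mem (by simpa using hx), abs_of_pos (by linarith),
          div_self (by linarith)]
        ring
    rw [h2, integral_add (i1.const_mul _) (i2.const_mul _), integral_const_mul,
      integral_const_mul, h1]
    ring
  have hder := (hasDerivAt_integral_of_dominated_loc_of_lip (μ := volume) (x₀ := t₀)
    (s := univ) (F := fun t x => |f x - t| * fderiv ℝ P x e)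
    (F' := fun x => (-((f x - t₀) / |f x - t₀|)) * fderiv ℝ P x e)
    (bound := fun x => |fderiv ℝ P x e|) univ_mem ?_ ?_ ?_ ?_ ?_ ?_).2
  · refine ⟨_, ((hder.div_const 2).const_sub ((∫ x, fderiv ℝ f x e * P x) / 2)).congr_of_eventuallyEq
      ?_⟩
    filter_upwards [eventually_gt_nhds ht₀] with t ht
    exact hinteg t ht
  · exact .of_forall fun t => Continuous.aestronglyMeasurable (by fun_prop)
  · have hc : Continuous fun x => |f x - t₀| * fderiv ℝ P x e := by fun_prop
    exact hc.integrable_of_hasCompactSupport hPe.mul_left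
  · have : Measurable fun x => (-((f x - t₀) / |f x - t₀|)) * fderiv ℝ P x e := by
      have := h.measurable
      have := c2.measurable
      fun_prop
    exact this.aestronglyMeasurable
  · refine .of_forall fun x => LipschitzOnWith.of_dist_le_mul fun a _ b _ => ?_
    rw [Real.dist_eq, Real.dist_eq, ← sub_mul, abs_mul, mul_comm]
    refine mul_le_mul (by simp) ?_ (abs_nonneg _) (by positivity)
    refine (abs_abs_sub_abs_le_abs_sub _ _).trans_eq ?_
    rw [sub_sub_sub_cancel_left, abs_sub_comm]
  · exact (c2.integrable_of_hasCompactSupport hPe).abs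
  · filter_upwards [h.ae_ne hnull ht₀] with x hx
    refine HasDerivAt.mul_const ?_ _
    have hne : f x - t₀ ≠ 0 := sub_ne_zero.2 hx
    have h1 := (hasDerivAt_abs hne).comp t₀ ((hasDerivAt_id' t₀).const_sub (f x))
    refine h1.congr_deriv ?_
    rcases lt_or_gt_of_ne hne with h2 | h2
    · rw [abs_of_neg h2, sign_neg h2, div_neg, div_self hne]
      simp
    · rw [abs_of_pos h2, sign_pos h2, div_self hne]
      simp

end Slice

/-- A function approximated near `t₀`, to first order with arbitrarily small relative error, by
differentiable functions, is differentiable. -/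
theorem exists_hasDerivAt_of_approx {Q : ℝ → ℝ} {t₀ : ℝ}
    (H : ∀ ε > 0, ∃ (R : ℝ → ℝ) (d : ℝ), HasDerivAt R d t₀ ∧
      ∀ᶠ t in 𝓝 t₀, |(Q t - Q t₀) - (R t - R t₀)| ≤ ε * |t - t₀|) : ∃ d, HasDerivAt Q d t₀ := by
  simp only [hasDerivAt_iff_tendsto_slope] at H ⊢
  rw [← cauchy_map_iff_exists_tendsto, Metric.cauchy_iff]
  refine ⟨inferInstance, fun ε hε => ?_⟩
  obtain ⟨R, d, hR, hclose⟩ := H (ε / 4) (by positivity)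
  refine ⟨Metric.ball d (ε / 2), ?_, fun x hx y hy => ?_⟩
  · rw [mem_map]
    have h1 := hR.eventually (Metric.ball_mem_nhds d (ε := ε / 4) (by positivity))
    filter_upwards [h1, nhdsWithin_le_nhds hclose, self_mem_nhdsWithin] with t ht hc hne
    have hne' : t - t₀ ≠ 0 := sub_ne_zero.2 hne
    have hp : 0 < |t - t₀| := abs_pos.2 hne'
    have hc' : |(Q t - Q t₀) - (R t - R t₀)| ≤ ε / 4 * |t - t₀| := hc
    have ht' : |slope R t₀ t - d| < ε / 4 := ht
    change |slope Q t₀ t - d| < ε / 2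
    have h2 : |slope Q t₀ t - slope R t₀ t| ≤ ε / 4 := by
      rw [slope_def_field, slope_def_field, ← sub_div, abs_div, div_le_iff₀ hp]
      exact hc'
    calc |slope Q t₀ t - d| ≤ |slope Q t₀ t - slope R t₀ t| + |slope R t₀ t - d| :=
          abs_sub_le _ _ _
      _ < ε / 2 := by linarith
  · calc dist x y ≤ dist x d + dist y d := dist_triangle_right _ _ _
      _ < ε := by rw [Metric.mem_ball] at hx hy; linarith

namespace Slice

variable {N : ℕ} {Ω : Set (Euc N)} {f : Euc N → ℝ} {M : ℝ}

theorem measurableSet_superlevel (h : Slice Ω f M) (t : ℝ) : MeasurableSet {x | t < f x} :=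
  measurableSet_lt measurable_const h.measurable

theorem abs_setIntegral_sub_le (h : Slice Ω f M) {g : Euc N → ℝ} {t₁ t₂ ε : ℝ} (h0 : 0 ≤ t₁)
    (h12 : t₁ ≤ t₂) (hg : IntegrableOn g Ω) (hε : ∀ x ∈ Ω, t₁ < f x → f x ≤ t₂ → |g x| ≤ ε) :
    |(∫ x in {x | t₁ < f x}, g x) - ∫ x in {x | t₂ < f x}, g x| ≤
      ε * (distr f t₁ - distr f t₂) := by
  have hsub : {x | t₂ < f x} ⊆ {x | t₁ < f x} := fun x (hx : t₂ < f x) => h12.trans_lt hx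
  rw [← setIntegral_sdiff (f := g) (h.measurableSet_superlevel _)
    (hg.mono_set (h.superlevel_subset h0)) hsub, distr, distr,
    ← measureReal_sdiff hsub (h.measurableSet_superlevel _) (h.volume_superlevel_lt_top h0).ne]
  rw [← Real.norm_eq_abs]
  refine norm_setIntegral_le_of_norm_le_const
    ((measure_mono sdiff_subset).trans_lt (h.volume_superlevel_lt_top h0)) fun x hx => ?_
  exact hε x (h.superlevel_subset h0 hx.1) hx.1 (not_lt.1 hx.2)

/-- Differentiability of weighted distribution functions is stable under approximation of the
weight near the level. -/
theorem exists_hasDerivAt_of_weight_approx (h : Slice Ω f M) {g : Euc N → ℝ} {A t₀ : ℝ}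
    (ht₀ : 0 < t₀) (hA : HasDerivAt (distr f) A t₀) (hg : IntegrableOn g Ω)
    (H : ∀ ε > 0, ∃ Ψ : Euc N → ℝ, IntegrableOn Ψ Ω ∧
      (∃ d, HasDerivAt (fun t => ∫ x in {x | t < f x}, Ψ x) d t₀) ∧
      ∃ δ > 0, ∀ x ∈ Ω, |f x - t₀| ≤ δ → |g x - Ψ x| ≤ ε) :
    ∃ d, HasDerivAt (fun t => ∫ x in {x | t < f x}, g x) d t₀ := by
  refine exists_hasDerivAt_of_approx fun ε hε => ?_
  set K := |A| + 1 with hK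
  have hKpos : 0 < K := by positivity
  obtain ⟨Ψ, hΨ, ⟨d, hd⟩, δ, hδ, hclose⟩ := H (ε / K) (by positivity)
  refine ⟨_, d, hd, ?_⟩
  have e1 : ∀ᶠ t in 𝓝 t₀, |distr f t - distr f t₀| ≤ K * |t - t₀| := by
    have := hA.isLittleO.def (c := 1) one_pos
    filter_upwards [this] with t ht
    simp only [smul_eq_mul, Real.norm_eq_abs, one_mul] at ht
    have h2 : |distr f t - distr f t₀| ≤ |distr f t - distr f t₀ - (t - t₀) * A| +
        |(t - t₀) * A| := by
      have := abs_add_le (distr f t - distr f t₀ - (t - t₀) * A) ((t - t₀) * A)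
      rwa [sub_add_cancel] at this
    rw [abs_mul] at h2
    rw [hK]
    linarith
  have e2 : ∀ᶠ t in 𝓝 t₀, |t - t₀| < δ := Metric.ball_mem_nhds t₀ hδ
  filter_upwards [e1, e2, lt_mem_nhds ht₀] with t h1 h2 h3
  have hsplit : ∀ s, 0 < s → ∫ x in {x | s < f x}, (g x - Ψ x) =
      (∫ x in {x | s < f x}, g x) - ∫ x in {x | s < f x}, Ψ x := fun s hs =>
    integral_sub (hg.mono_set (h.superlevel_subset hs.le)) (hΨ.mono_set (h.superlevel_subset hs.le))
  have hrw : ((∫ x in {x | t < f x}, g x) - ∫ x in {x | t₀ < f x}, g x) -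
      ((∫ x in {x | t < f x}, Ψ x) - ∫ x in {x | t₀ < f x}, Ψ x) =
      (∫ x in {x | t < f x}, (g x - Ψ x)) - ∫ x in {x | t₀ < f x}, (g x - Ψ x) := by
    rw [hsplit t h3, hsplit t₀ ht₀]; ring
  rw [hrw]
  have hgoal : ε / K * |distr f t - distr f t₀| ≤ ε * |t - t₀| := by
    calc ε / K * |distr f t - distr f t₀| ≤ ε / K * (K * |t - t₀|) := by gcongr
      _ = ε * |t - t₀| := by field_simp
  refine le_trans ?_ hgoal
  rw [abs_lt] at h2
  rcases le_total t t₀ with ht | ht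
  · refine (h.abs_setIntegral_sub_le h3.le ht (hg.sub hΨ) fun x hx hx1 hx2 =>
      hclose x hx (abs_le.2 ⟨by linarith, by linarith⟩)).trans ?_
    gcongr
    exact le_abs_self _
  · rw [abs_sub_comm]
    refine (h.abs_setIntegral_sub_le ht₀.le ht (hg.sub hΨ) fun x hx hx1 hx2 =>
      hclose x hx (abs_le.2 ⟨by linarith, by linarith⟩)).trans ?_
    gcongr
    rw [abs_sub_comm]
    exact le_abs_self _

/-- Cutting off a smooth function on `Ω` near the zero level of `f`. -/
theorem contDiff_mul_cutoff (h : Slice Ω f M) {k : Euc N → ℝ} (hk : ContDiffOn ℝ 1 k Ω) {χ : ℝ → ℝ}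
    (hχ : ContDiff ℝ 1 χ) {c : ℝ} (hc : 0 < c) (h0 : ∀ y ≤ c, χ y = 0) :
    ContDiff ℝ 1 (fun x => k x * χ (f x)) ∧ HasCompactSupport (fun x => k x * χ (f x)) ∧
      tsupport (fun x => k x * χ (f x)) ⊆ Ω := by
  have hcp := h.isCompact_superlevel hc
  have hts : tsupport (fun x => k x * χ (f x)) ⊆ {x | c ≤ f x} := by
    refine closure_minimal (fun x hx => ?_) hcp.isClosed
    change c ≤ f x
    by_contra! hlt
    exact hx (by simp [h0 _ hlt.le])
  have hΩ : {x | c ≤ f x} ⊆ Ω := fun x (hx : c ≤ f x) => h.mem_of_pos (hc.trans_le hx)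
  refine ⟨contDiff_iff_contDiffAt.2 fun x => ?_, hcp.of_isClosed_subset (isClosed_tsupport _) hts,
    hts.trans hΩ⟩
  by_cases hx : x ∈ Ω
  · exact (hk.contDiffAt (h.isOpen.mem_nhds hx)).mul
      (hχ.contDiffAt.comp x ((h.smooth x hx).of_le (by norm_cast)))
  · have h1 : ∀ᶠ y in 𝓝 x, f y < c :=
      h.cont.continuousAt.eventually_lt_const (by rw [h.zero x hx]; exact hc)
    refine (contDiffAt_const (c := (0 : ℝ))).congr_of_eventuallyEq ?_
    filter_upwards [h1] with y hy
    rw [h0 _ hy.le, mul_zero]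

/-- A weight vanishing at the critical points of level `t₀` is small at nearly critical points of
nearby levels. -/
theorem exists_small_near_critical (h : Slice Ω f M) {q G : Euc N → ℝ} (hq : ContinuousOn q Ω)
    (hG : ContinuousOn G Ω) (hG0 : ∀ x ∈ Ω, 0 ≤ G x) {t₀ : ℝ} (ht₀ : 0 < t₀)
    (hcrit : ∀ x ∈ Ω, f x = t₀ → G x = 0 → q x = 0) {ε : ℝ} (hε : 0 < ε) :
    ∃ r > 0, ∃ δ > 0, δ ≤ t₀ / 2 ∧ ∀ x ∈ Ω, |f x - t₀| ≤ δ → G x ≤ r → |q x| ≤ ε := by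
  set K := {x | t₀ / 2 ≤ f x}
  have hK : IsCompact K := h.isCompact_superlevel (by positivity)
  have hKΩ : K ⊆ Ω := fun x (hx : t₀ / 2 ≤ f x) => h.mem_of_pos (by linarith)
  have hZ : IsCompact (K ∩ (fun x => |q x|) ⁻¹' Ici ε) :=
    hK.of_isClosed_subset ((hq.mono hKΩ).abs.preimage_isClosed_of_isClosed hK.isClosed isClosed_Ici)
      inter_subset_left
  have hm : ContinuousOn (fun x => max |f x - t₀| (G x)) (K ∩ (fun x => |q x|) ⁻¹' Ici ε) :=
    ContinuousOn.sup (h.cont.sub continuous_const).abs.continuousOn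
      (hG.mono (inter_subset_left.trans hKΩ))
  obtain ⟨m, hmpos, hmle⟩ : ∃ m > 0, ∀ x ∈ K ∩ (fun x => |q x|) ⁻¹' Ici ε,
      m ≤ max |f x - t₀| (G x) := by
    rcases (K ∩ (fun x => |q x|) ⁻¹' Ici ε).eq_empty_or_nonempty with he | hne
    · exact ⟨1, one_pos, by simp [he]⟩
    · obtain ⟨x, hx, hmin⟩ := hZ.exists_isMinOn hne hm
      refine ⟨_, ?_, hmin⟩
      by_contra! hle
      have h1 := (max_le_iff.1 hle).1
      have h2 := (max_le_iff.1 hle).2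
      have h3 : f x = t₀ := sub_eq_zero.1 (abs_nonpos_iff.1 h1)
      have h4 := hcrit x (hKΩ hx.1) h3 (le_antisymm h2 (hG0 x (hKΩ hx.1)))
      have h5 : ε ≤ |q x| := hx.2
      rw [h4, abs_zero] at h5
      linarith
  refine ⟨m / 2, by positivity, min (m / 2) (t₀ / 2), by positivity, min_le_right _ _,
    fun x hx h1 h2 => ?_⟩
  by_contra! hlt
  have h3 := abs_le.1 (h1.trans (min_le_right _ _))
  have h4 := hmle x ⟨by change t₀ / 2 ≤ f x; linarith, hlt.le⟩
  have h5 := max_le (h1.trans (min_le_left _ _)) h2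
  linarith

/-- The squared length of the gradient. -/
def gradSq (f : Euc N → ℝ) (x : Euc N) : ℝ := ∑ i, fderiv ℝ f x (EuclideanSpace.single i 1) ^ 2

theorem contDiffOn_partial (h : Slice Ω f M) (e : Euc N) :
    ContDiffOn ℝ 1 (fun x => fderiv ℝ f x e) Ω := fun x hx =>
  (((h.smooth x hx).fderiv_right (m := 1) (by norm_cast)).clm_apply
    contDiffAt_const).contDiffWithinAt

theorem contDiffOn_gradSq (h : Slice Ω f M) : ContDiffOn ℝ 1 (gradSq f) Ω :=
  ContDiffOn.sum fun _ _ => (h.contDiffOn_partial _).pow 2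

theorem gradSq_nonneg (f : Euc N → ℝ) (x : Euc N) : 0 ≤ gradSq f x :=
  Finset.sum_nonneg fun _ _ => sq_nonneg _

theorem exists_hasDerivAt_of_vanishing (h : Slice Ω f M)
    (hnull : ∀ c > 0, volume {x | f x = c} = 0) {A t₀ B : ℝ} (ht₀ : 0 < t₀)
    (hA : HasDerivAt (distr f) A t₀) {q : Euc N → ℝ} (hq : ContDiffOn ℝ 1 q Ω)
    (hB : ∀ x ∈ Ω, |q x| ≤ B) (hcrit : ∀ x ∈ Ω, f x = t₀ → gradSq f x = 0 → q x = 0) :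
    ∃ d, HasDerivAt (fun t => ∫ x in {x | t < f x}, q x) d t₀ := by
  have hqi : IntegrableOn q Ω := IntegrableOn.of_bound h.volume_lt_top
    (hq.continuousOn.aestronglyMeasurable h.isOpen.measurableSet) B
    ((ae_restrict_iff' h.isOpen.measurableSet).2 (.of_forall hB))
  refine h.exists_hasDerivAt_of_weight_approx ht₀ hA hqi fun ε hε => ?_
  obtain ⟨r, hr, δ, hδ, hδt, hsmall⟩ := h.exists_small_near_critical hq.continuousOn
    h.contDiffOn_gradSq.continuousOn (fun x _ => gradSq_nonneg f x) ht₀ hcrit hε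
  set κ := r * ε / (|B| + 1) with hκ
  have hκpos : 0 < κ := by positivity
  set χ : ℝ → ℝ := fun y => Real.smoothTransition ((y - t₀ / 4) / (t₀ / 4)) with hχdef
  have hχ : ContDiff ℝ 1 χ :=
    (Real.smoothTransition.contDiff (n := 1)).comp ((contDiff_id.sub contDiff_const).div_const _)
  have hχ0 : ∀ y ≤ t₀ / 4, χ y = 0 := fun y hy =>
    Real.smoothTransition.zero_of_nonpos (div_nonpos_of_nonpos_of_nonneg (by linarith)
      (by positivity))
  have hχ1 : ∀ y, t₀ / 2 ≤ y → χ y = 1 := fun y hy =>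
    Real.smoothTransition.one_of_one_le (by rw [le_div_iff₀ (by positivity)]; linarith)
  set k : Fin N → Euc N → ℝ := fun i x =>
    q x * fderiv ℝ f x (EuclideanSpace.single i 1) / (gradSq f x + κ) with hkdef
  have hden : ∀ x, gradSq f x + κ ≠ 0 := fun x => (add_pos_of_nonneg_of_pos
    (gradSq_nonneg f x) hκpos).ne'
  have hk : ∀ i, ContDiffOn ℝ 1 (k i) Ω := fun i =>
    (hq.mul (h.contDiffOn_partial _)).div (h.contDiffOn_gradSq.add contDiffOn_const)
      fun x _ => hden x
  have hP := fun i => h.contDiff_mul_cutoff (hk i) hχ (c := t₀ / 4) (by positivity) hχ0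
  have hinteg : ∀ i, Integrable fun x =>
      fderiv ℝ f x (EuclideanSpace.single i 1) * (k i x * χ (f x)) := fun i =>
    (h.continuous_mul_of_tsupport (h.contDiffOn_partial _).continuousOn h.isOpen
      (hP i).1.continuous (hP i).2.2).integrable_of_hasCompactSupport (hP i).2.1.mul_left
  refine ⟨fun x => ∑ i, fderiv ℝ f x (EuclideanSpace.single i 1) * (k i x * χ (f x)),
    (integrable_finsetSum _ fun i _ => hinteg i).integrableOn, ?_, δ, hδ, fun x hx hfx => ?_⟩
  · choose d hd using fun i => h.exists_hasDerivAt_weighted hnull (hP i).1 (hP i).2.1 (hP i).2.2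
      (EuclideanSpace.single i 1) ht₀
    refine ⟨∑ i, d i, ?_⟩
    have := HasDerivAt.fun_sum (u := Finset.univ) fun i _ => hd i
    refine this.congr_of_eventuallyEq (.of_forall fun t => ?_)
    exact integral_finsetSum _ fun i _ => (hinteg i).integrableOn
  · have hχx : χ (f x) = 1 := hχ1 _ (by have := abs_le.1 hfx; linarith)
    have hsum : ∑ i, fderiv ℝ f x (EuclideanSpace.single i 1) * (k i x * χ (f x)) =
        q x * (gradSq f x / (gradSq f x + κ)) := by
      simp only [hχx, mul_one, hkdef]
      rw [gradSq, Finset.sum_div, Finset.mul_sum]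
      exact Finset.sum_congr rfl fun i _ => by ring
    have hG := gradSq_nonneg f x
    have hpos : 0 < gradSq f x + κ := by positivity
    beta_reduce
    rw [hsum]
    have hdiff : q x - q x * (gradSq f x / (gradSq f x + κ)) = q x * (κ / (gradSq f x + κ)) := by
      field_simp
      ring
    rw [hdiff, abs_mul, abs_of_nonneg (by positivity : 0 ≤ κ / (gradSq f x + κ))]
    rcases le_total (gradSq f x) r with hr' | hr'
    · have h1 := hsmall x hx hfx hr'
      have h2 : κ / (gradSq f x + κ) ≤ 1 := (div_le_one hpos).2 (by linarith)
      exact (mul_le_of_le_one_right (abs_nonneg _) h2).trans h1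
    · have h1 : |q x| ≤ |B| + 1 := (hB x hx).trans ((le_abs_self B).trans (by linarith))
      have h2 : κ / (gradSq f x + κ) ≤ κ / r := by gcongr; linarith
      calc |q x| * (κ / (gradSq f x + κ)) ≤ (|B| + 1) * (κ / r) := by gcongr
        _ = ε := by rw [hκ]; field_simp

/-- Weighted distribution functions with weight `φ ∘ v` are differentiable at a level `t₀` where
the distribution function is, provided `v` is constant on the critical points of level `t₀`. -/
theorem exists_hasDerivAt_comp (h : Slice Ω f M)
    (hnull : ∀ c > 0, volume {x | f x = c} = 0) {A t₀ B b : ℝ} (ht₀ : 0 < t₀)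
    (hA : HasDerivAt (distr f) A t₀) {v : Euc N → ℝ} (hv : ContDiffOn ℝ 1 v Ω)
    (hB : ∀ x ∈ Ω, |v x| ≤ B) (hcrit : ∀ x ∈ Ω, f x = t₀ → gradSq f x = 0 → v x = b)
    {φ : ℝ → ℝ} (hφ : Continuous φ) :
    ∃ d, HasDerivAt (fun t => ∫ x in {x | t < f x}, φ (v x)) d t₀ := by
  have hbdd : ∀ {φ : ℝ → ℝ}, Continuous φ → ∃ C, ∀ x ∈ Ω, |φ (v x)| ≤ C := fun {φ} hφ => by
    obtain ⟨C, hC⟩ := (isCompact_Icc (a := -B) (b := B)).exists_bound_of_continuousOn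
      hφ.continuousOn
    exact ⟨C, fun x hx => hC _ (abs_le.1 (hB x hx))⟩
  have hinteg : ∀ {φ : ℝ → ℝ}, Continuous φ → IntegrableOn (fun x => φ (v x)) Ω := fun {φ} hφ => by
    obtain ⟨C, hC⟩ := hbdd hφ
    exact IntegrableOn.of_bound h.volume_lt_top
      ((hφ.comp_continuousOn hv.continuousOn).aestronglyMeasurable h.isOpen.measurableSet) C
      ((ae_restrict_iff' h.isOpen.measurableSet).2 (.of_forall hC))
  refine h.exists_hasDerivAt_of_weight_approx ht₀ hA (hinteg hφ) fun ε hε => ?_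
  obtain ⟨p, hp⟩ := exists_polynomial_near_of_continuousOn (-B) B φ hφ.continuousOn ε hε
  have hpc : ContDiff ℝ 1 fun y => p.eval y := by
    simpa using p.contDiff_aeval (𝕜 := ℝ) (R := ℝ) 1
  refine ⟨fun x => p.eval (v x), hinteg hpc.continuous, ?_, 1, one_pos, fun x hx _ => ?_⟩
  · obtain ⟨C, hC⟩ := hbdd (φ := fun y => p.eval y - p.eval b)
      (hpc.continuous.sub continuous_const)
    obtain ⟨d, hd⟩ := h.exists_hasDerivAt_of_vanishing hnull ht₀ hA
      (q := fun x => p.eval (v x) - p.eval b) ((hpc.comp_contDiffOn hv).sub contDiffOn_const) hC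
      fun x hx h1 h2 => by rw [hcrit x hx h1 h2, sub_self]
    refine ⟨_, (hd.fun_add (hA.const_mul (p.eval b))).congr_of_eventuallyEq ?_⟩
    filter_upwards [lt_mem_nhds ht₀] with t ht
    have hsub := h.superlevel_subset ht.le
    have hfin := (h.volume_superlevel_lt_top ht.le).ne
    rw [integral_sub ((hinteg hpc.continuous).mono_set hsub) (integrableOn_const hfin),
      setIntegral_const, smul_eq_mul, distr]
    ring
  · have := hp (v x) (abs_le.1 (hB x hx))
    rw [abs_sub_comm]
    exact this.le

end Slice

/-- A fine continuous partition of unity on `[-B, B]`. -/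
theorem exists_fine_partition (B : ℝ) {ε : ℝ} (hε : 0 < ε) :
    ∃ (n : ℕ) (φ : ℕ → ℝ → ℝ) (c : ℕ → ℝ), (∀ i, Continuous (φ i)) ∧ (∀ i y, 0 ≤ φ i y) ∧
      (∀ i y, φ i y ≠ 0 → |y - c i| ≤ ε) ∧
      ∀ y, |y| ≤ B → ∑ i ∈ Finset.range n, φ i y = 1 := by
  set r : ℝ → ℝ := fun y => max 0 (min 1 y) with hr
  have hrc : Continuous r := by fun_prop
  have hmono : Monotone r := fun y y' hy => max_le_max le_rfl (min_le_min le_rfl hy)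
  have hr0 : ∀ y ≤ 0, r y = 0 := fun y hy => max_eq_left ((min_le_right _ _).trans hy)
  have hr1 : ∀ y, 1 ≤ y → r y = 1 := fun y hy => by
    simp [hr, min_eq_left hy]
  obtain ⟨n, hn⟩ := exists_nat_ge ((B + B) / ε + 1)
  refine ⟨n, fun i y => r ((y + B) / ε + 1 - (i : ℝ)) - r ((y + B) / ε + 1 - ((i + 1 : ℕ) : ℝ)),
    fun i => ε * i - B, fun i => by fun_prop, fun i y => sub_nonneg.2 (hmono ?_), ?_, ?_⟩
  · push_cast; linarith
  · intro i y hne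
    beta_reduce at hne
    have h1 : ¬((i : ℝ) + 1 ≤ (y + B) / ε) := fun h => hne (by
      rw [hr1 _ (by linarith), hr1 _ (by push_cast; linarith), sub_self])
    have h2 : ¬((y + B) / ε ≤ i - 1) := fun h => hne (by
      rw [hr0 _ (by linarith), hr0 _ (by push_cast; linarith), sub_self])
    rw [not_le, div_lt_iff₀ hε] at h1
    rw [not_le, lt_div_iff₀ hε] at h2
    exact abs_le.2 ⟨by linarith, by linarith⟩
  · intro y hy
    rw [abs_le] at hy
    rw [Finset.sum_range_sub' (fun i => r ((y + B) / ε + 1 - (i : ℝ)))]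
    have h1 : 0 ≤ (y + B) / ε := div_nonneg (by linarith) hε.le
    have h2 : (y + B) / ε ≤ (B + B) / ε := by gcongr; linarith
    rw [hr1 _ (by push_cast; linarith), hr0 _ (by linarith), sub_zero]

/-- The weighted distribution function of `f` with weight `φ ∘ v`. -/
def wd {N : ℕ} (f v : Euc N → ℝ) (φ : ℝ → ℝ) (t : ℝ) : ℝ := ∫ x in {x | t < f x}, φ (v x)

/-- The limiting weight of the level set of `f` of height `t₀`, as a functional of `φ`. -/
def lam {N : ℕ} (f v : Euc N → ℝ) (t₀ : ℝ) (φ : ℝ → ℝ) : ℝ := -deriv (wd f v φ) t₀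

/-- A slice all of whose distribution functions weighted by functions of `v` are differentiable at
the level `t₀`. -/
structure Regular {N : ℕ} (Ω : Set (Euc N)) (f v : Euc N → ℝ) (M B t₀ : ℝ) : Prop where
  slice : Slice Ω f M
  cont : ContinuousOn v Ω
  bound : ∀ x ∈ Ω, |v x| ≤ B
  pos : 0 < t₀
  diff : ∀ φ, Continuous φ → DifferentiableAt ℝ (wd f v φ) t₀

namespace Regular

variable {N : ℕ} {Ω : Set (Euc N)} {f v : Euc N → ℝ} {M B t₀ : ℝ}

theorem hasDerivAt (h : Regular Ω f v M B t₀) {φ : ℝ → ℝ} (hφ : Continuous φ) :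
    HasDerivAt (wd f v φ) (-lam f v t₀ φ) t₀ := by
  rw [lam, neg_neg]
  exact (h.diff φ hφ).hasDerivAt

theorem integrableOn (h : Regular Ω f v M B t₀) {φ : ℝ → ℝ} (hφ : Continuous φ) :
    IntegrableOn (fun x => φ (v x)) Ω := by
  obtain ⟨C, hC⟩ := (isCompact_Icc (a := -B) (b := B)).exists_bound_of_continuousOn
    hφ.continuousOn
  exact IntegrableOn.of_bound h.slice.volume_lt_top
    ((hφ.comp_continuousOn h.cont).aestronglyMeasurable h.slice.isOpen.measurableSet) C
    ((ae_restrict_iff' h.slice.isOpen.measurableSet).2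
      (.of_forall fun x hx => hC _ (abs_le.1 (h.bound x hx))))

theorem lam_sum (h : Regular Ω f v M B t₀) {ι : Type} (s : Finset ι) {g : ι → ℝ → ℝ} {ψ : ℝ → ℝ}
    (hg : ∀ i, Continuous (g i)) (hψ : ∀ y, |y| ≤ B → ψ y = ∑ i ∈ s, g i y) :
    lam f v t₀ ψ = ∑ i ∈ s, lam f v t₀ (g i) := by
  have h1 := HasDerivAt.fun_sum (u := s) fun i _ => h.hasDerivAt (hg i)
  have h2 : wd f v ψ =ᶠ[𝓝 t₀] fun t => ∑ i ∈ s, wd f v (g i) t := by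
    filter_upwards [lt_mem_nhds h.pos] with t ht
    have hsub := h.slice.superlevel_subset ht.le
    simp only [wd]
    rw [← integral_finsetSum _ fun i _ => (h.integrableOn (hg i)).mono_set hsub]
    exact setIntegral_congr_fun (h.slice.measurableSet_superlevel _)
      fun x hx => hψ _ (h.bound x (hsub hx))
  rw [lam, (h1.congr_of_eventuallyEq h2).deriv, Finset.sum_neg_distrib, neg_neg]

theorem lam_const_mul (h : Regular Ω f v M B t₀) (c : ℝ) {φ : ℝ → ℝ} (hφ : Continuous φ) :
    lam f v t₀ (fun y => c * φ y) = c * lam f v t₀ φ := by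
  have h1 := (h.hasDerivAt hφ).const_mul c
  have h2 : wd f v (fun y => c * φ y) = fun t => c * wd f v φ t := by
    funext t
    simp only [wd]
    exact integral_const_mul _ _
  rw [lam, h2, h1.deriv]
  ring

theorem lam_sub (h : Regular Ω f v M B t₀) {φ ψ : ℝ → ℝ} (hφ : Continuous φ)
    (hψ : Continuous ψ) : lam f v t₀ (fun y => φ y - ψ y) = lam f v t₀ φ - lam f v t₀ ψ := by
  have h1 := (h.hasDerivAt hφ).fun_sub (h.hasDerivAt hψ)
  have h2 : wd f v (fun y => φ y - ψ y) =ᶠ[𝓝 t₀] fun t => wd f v φ t - wd f v ψ t := by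
    filter_upwards [lt_mem_nhds h.pos] with t ht
    have hsub := h.slice.superlevel_subset ht.le
    exact integral_sub ((h.integrableOn hφ).mono_set hsub) ((h.integrableOn hψ).mono_set hsub)
  rw [lam, (h1.congr_of_eventuallyEq h2).deriv]
  ring

theorem lam_nonneg (h : Regular Ω f v M B t₀) {φ : ℝ → ℝ} (hφ : Continuous φ)
    (h0 : ∀ y, |y| ≤ B → 0 ≤ φ y) : 0 ≤ lam f v t₀ φ := by
  have hd := h.hasDerivAt hφ
  have hle : ∀ᶠ t in 𝓝[>] t₀, slope (wd f v φ) t₀ t ≤ 0 := by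
    filter_upwards [self_mem_nhdsWithin] with t ht
    have ht' : t₀ < t := ht
    have hsub : {x | t < f x} ⊆ {x | t₀ < f x} := fun x (hx : t < f x) => ht'.trans hx
    have h1 : wd f v φ t ≤ wd f v φ t₀ := by
      refine setIntegral_mono_set
        ((h.integrableOn hφ).mono_set (h.slice.superlevel_subset h.pos.le)) ?_
        hsub.eventuallyLE
      refine (ae_restrict_iff' (h.slice.measurableSet_superlevel _)).2 (.of_forall fun x hx => ?_)
      exact h0 _ (h.bound x (h.slice.superlevel_subset h.pos.le hx))
    rw [slope_def_field]
    exact div_nonpos_of_nonpos_of_nonneg (by linarith) (by linarith)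
  have hn : 𝓝[>] t₀ ≤ 𝓝[≠] t₀ := nhdsWithin_mono t₀ fun _ ht => ne_of_gt ht
  have ht := (hasDerivAt_iff_tendsto_slope.1 hd).mono_left hn
  have := le_of_tendsto ht hle
  linarith

theorem lam_mono (h : Regular Ω f v M B t₀) {φ ψ : ℝ → ℝ} (hφ : Continuous φ) (hψ : Continuous ψ)
    (hle : ∀ y, |y| ≤ B → φ y ≤ ψ y) : lam f v t₀ φ ≤ lam f v t₀ ψ := by
  have := h.lam_nonneg (φ := fun y => ψ y - φ y) (hψ.sub hφ) fun y hy => sub_nonneg.2 (hle y hy)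
  rw [h.lam_sub hψ hφ] at this
  linarith

theorem abs_lam_le (h : Regular Ω f v M B t₀) {φ ψ : ℝ → ℝ} (hφ : Continuous φ)
    (hψ : Continuous ψ) (hle : ∀ y, |y| ≤ B → |φ y| ≤ ψ y) :
    |lam f v t₀ φ| ≤ lam f v t₀ ψ := by
  refine abs_le.2 ⟨?_, h.lam_mono hφ hψ fun y hy => (le_abs_self _).trans (hle y hy)⟩
  have := h.lam_mono (φ := fun y => (-1) * φ y) (continuous_const.mul hφ) hψ
    fun y hy => by rw [neg_one_mul]; exact (neg_le_abs _).trans (hle y hy)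
  rw [h.lam_const_mul _ hφ] at this
  linarith

/-- Expansion of the weight of a moving superlevel set, for weights supported near one value of
`v`. -/
theorem eventually_abs_piece_le (h : Regular Ω f v M B t₀) {E : ℝ → Set (Euc N)} {m : ℝ → ℝ}
    {L C : ℝ} (hEm : ∀ᶠ s in 𝓝 0, MeasurableSet (E s)) (hE : ∀ᶠ s in 𝓝 0, E s ⊆ Ω)
    (hm : ∀ᶠ s in 𝓝 0, |m s| ≤ L * |s|)
    (hin : ∀ᶠ s in 𝓝 0, ∀ x ∈ Ω, t₀ + m s - s * v x + C * s ^ 2 < f x → x ∈ E s)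
    (hout : ∀ᶠ s in 𝓝 0, ∀ x ∈ E s, t₀ + m s - s * v x - C * s ^ 2 < f x)
    {φ : ℝ → ℝ} (hφ : Continuous φ) (h0 : ∀ y, 0 ≤ φ y) {c ε ρ : ℝ} (hε : 0 < ε) (hρ : 0 < ρ)
    (hc : ∀ y, φ y ≠ 0 → |y - c| ≤ ε) :
    ∀ᶠ s in 𝓝 0, |(∫ x in E s, φ (v x)) - wd f v φ t₀ + (m s - s * c) * lam f v t₀ φ| ≤
      (2 * ε * lam f v t₀ φ + ρ) * |s| := by
  set lm := lam f v t₀ φ with hlm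
  have hlm0 : 0 ≤ lm := h.lam_nonneg hφ fun y _ => h0 y
  have hd := h.hasDerivAt hφ
  set K := L + |c| + 2 * ε with hK
  set K' := |K| + 1 with hK'
  have hK'0 : 0 < K' := by positivity
  have hQ : ∀ᶠ r in 𝓝 (0 : ℝ), |wd f v φ (t₀ + r) - wd f v φ t₀ + r * lm| ≤ ρ / K' * |r| := by
    have h1 := (hasDerivAt_iff_isLittleO_nhds_zero.1 hd).def (c := ρ / K') (by positivity)
    filter_upwards [h1] with r hr
    simp only [smul_eq_mul, Real.norm_eq_abs] at hr
    rw [show wd f v φ (t₀ + r) - wd f v φ t₀ + r * lm =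
      wd f v φ (t₀ + r) - wd f v φ t₀ - r * -lm by ring]
    exact hr
  have hpos : ∀ᶠ r in 𝓝 (0 : ℝ), 0 < t₀ + r := by
    have : Tendsto (fun r => t₀ + r) (𝓝 0) (𝓝 t₀) :=
      (continuous_const.add continuous_id).tendsto' _ _ (by simp)
    exact this.eventually_const_lt h.pos
  obtain ⟨δ, hδ, hQδ⟩ := Metric.eventually_nhds_iff.1 (hQ.and hpos)
  have hsmall : ∀ᶠ s in 𝓝 (0 : ℝ), K' * |s| < δ := by
    have : Tendsto (fun s : ℝ => K' * |s|) (𝓝 0) (𝓝 0) :=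
      (continuous_const.mul continuous_abs).tendsto' _ _ (by simp)
    exact this.eventually_lt_const hδ
  have hCs : ∀ᶠ s in 𝓝 (0 : ℝ), |C| * |s| < ε := by
    have : Tendsto (fun s : ℝ => |C| * |s|) (𝓝 0) (𝓝 0) :=
      (continuous_const.mul continuous_abs).tendsto' _ _ (by simp)
    exact this.eventually_lt_const hε
  filter_upwards [hEm, hE, hm, hin, hout, hsmall, hCs] with s hEm hE hm hin hout hs hC
  have hCs2 : |C * s ^ 2| ≤ ε * |s| := by
    rw [abs_mul, abs_pow, pow_two, ← mul_assoc]
    gcongr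
  rw [abs_le] at hCs2
  have hsc : |s * c| = |s| * |c| := abs_mul _ _
  have hshift : ∀ η, |η| ≤ 2 * ε * |s| → |m s - s * c + η| ≤ K' * |s| := fun η hη => by
    have h1 : |m s - s * c + η| ≤ |m s| + |s * c| + |η| :=
      (abs_add_le _ _).trans (add_le_add_left (abs_sub _ _) _)
    have h2 : K ≤ |K| := le_abs_self K
    have h3 : K * |s| ≤ |K| * |s| := by gcongr
    have h4 : K * |s| = L * |s| + |s| * |c| + 2 * ε * |s| := by rw [hK]; ring
    have h5 : K' * |s| = |K| * |s| + |s| := by rw [hK']; ring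
    have h6 := abs_nonneg s
    linarith
  have key : ∀ η, |η| ≤ 2 * ε * |s| → 0 < t₀ + (m s - s * c + η) ∧
      |wd f v φ (t₀ + (m s - s * c + η)) - wd f v φ t₀ + (m s - s * c + η) * lm| ≤ ρ * |s| := by
    intro η hη
    have h1 := hshift η hη
    have h2 := @hQδ (m s - s * c + η) (by rw [dist_zero_right]; exact h1.trans_lt hs)
    refine ⟨h2.2, h2.1.trans ?_⟩
    calc ρ / K' * |m s - s * c + η| ≤ ρ / K' * (K' * |s|) := by gcongr
      _ = ρ * |s| := by field_simp
  have hsv : ∀ x, φ (v x) ≠ 0 → |s * v x - s * c| ≤ ε * |s| := fun x hx => by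
    rw [← mul_sub, abs_mul, mul_comm]
    gcongr
    exact hc _ hx
  have hcompare : ∀ {S T : Set (Euc N)}, MeasurableSet S → MeasurableSet T → S ⊆ Ω → T ⊆ Ω →
      (∀ x ∈ S, φ (v x) ≠ 0 → x ∈ T) → ∫ x in S, φ (v x) ≤ ∫ x in T, φ (v x) := by
    intro S T hS hT hSΩ hTΩ hST
    rw [← integral_indicator hS, ← integral_indicator hT]
    refine integral_mono (((h.integrableOn hφ).mono_set hSΩ).integrable_indicator hS)
      (((h.integrableOn hφ).mono_set hTΩ).integrable_indicator hT) fun x => ?_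
    refine indicator_apply_le' (fun hx => ?_) fun _ => indicator_nonneg (fun x _ => h0 _) x
    by_cases hz : φ (v x) = 0
    · rw [hz]; exact indicator_nonneg (fun x _ => h0 _) x
    · rw [indicator_of_mem (hST x hx hz)]
  have hη : abs (2 * ε * |s|) ≤ 2 * ε * |s| := by rw [abs_of_nonneg (by positivity)]
  obtain ⟨hp1, hk1⟩ := key (2 * ε * |s|) hη
  obtain ⟨hp2, hk2⟩ := key (-(2 * ε * |s|)) (by rwa [abs_neg])
  have hlow : wd f v φ (t₀ + (m s - s * c + 2 * ε * |s|)) ≤ ∫ x in E s, φ (v x) := by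
    refine hcompare (h.slice.measurableSet_superlevel _) hEm (h.slice.superlevel_subset hp1.le) hE
      fun x hx hne => hin x (h.slice.superlevel_subset hp1.le hx) ?_
    have h1 : t₀ + (m s - s * c + 2 * ε * |s|) < f x := hx
    have h2 := abs_le.1 (hsv x hne)
    linarith
  have hupp : ∫ x in E s, φ (v x) ≤ wd f v φ (t₀ + (m s - s * c + -(2 * ε * |s|))) := by
    refine hcompare hEm (h.slice.measurableSet_superlevel _) hE (h.slice.superlevel_subset hp2.le)
      fun x hx hne => ?_
    have h1 := hout x hx
    have h2 := abs_le.1 (hsv x hne)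
    change t₀ + (m s - s * c + -(2 * ε * |s|)) < f x
    linarith
  have e1 : (m s - s * c + 2 * ε * |s|) * lm = (m s - s * c) * lm + 2 * ε * lm * |s| := by ring
  have e2 : (m s - s * c + -(2 * ε * |s|)) * lm = (m s - s * c) * lm - 2 * ε * lm * |s| := by ring
  rw [e1, abs_le] at hk1
  rw [e2, abs_le] at hk2
  rw [abs_le, add_mul]
  exact ⟨by linarith, by linarith⟩

/-- First order expansion of the weight of a moving superlevel set. -/
theorem isLittleO_moving (h : Regular Ω f v M B t₀) {E : ℝ → Set (Euc N)} {m : ℝ → ℝ}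
    {L C : ℝ} (hEm : ∀ᶠ s in 𝓝 0, MeasurableSet (E s)) (hE : ∀ᶠ s in 𝓝 0, E s ⊆ Ω)
    (hm : ∀ᶠ s in 𝓝 0, |m s| ≤ L * |s|)
    (hin : ∀ᶠ s in 𝓝 0, ∀ x ∈ Ω, t₀ + m s - s * v x + C * s ^ 2 < f x → x ∈ E s)
    (hout : ∀ᶠ s in 𝓝 0, ∀ x ∈ E s, t₀ + m s - s * v x - C * s ^ 2 < f x)
    {ψ : ℝ → ℝ} (hψ : Continuous ψ) (h0 : ∀ y, 0 ≤ ψ y) :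
    (fun s => (∫ x in E s, ψ (v x)) - wd f v ψ t₀ + m s * lam f v t₀ ψ -
      s * lam f v t₀ fun y => y * ψ y) =o[𝓝 0] fun s => s := by
  refine Asymptotics.isLittleO_iff.2 fun η hη => ?_
  set lm := lam f v t₀ ψ with hlm
  have hlm0 : 0 ≤ lm := h.lam_nonneg hψ fun y _ => h0 y
  set ε := η / (6 * (lm + 1)) with hεdef
  have hε : 0 < ε := by positivity
  obtain ⟨n, φ, c, hφ, hφ0, hφc, hφs⟩ := exists_fine_partition B hε
  set ρ := η / (2 * ((n : ℝ) + 1)) with hρdef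
  have hρ : 0 < ρ := by positivity
  have hg : ∀ i, Continuous fun y => ψ y * φ i y := fun i => hψ.mul (hφ i)
  have hpieces : ∀ i ∈ Finset.range n, ∀ᶠ s in 𝓝 0, |(∫ x in E s, ψ (v x) * φ i (v x)) -
      wd f v (fun y => ψ y * φ i y) t₀ + (m s - s * c i) * lam f v t₀ (fun y => ψ y * φ i y)| ≤
      (2 * ε * lam f v t₀ (fun y => ψ y * φ i y) + ρ) * |s| := fun i _ =>
    h.eventually_abs_piece_le hEm hE hm hin hout (hg i) (fun y => mul_nonneg (h0 y) (hφ0 i y)) hε hρ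
      fun y hy => hφc i y (right_ne_zero_of_mul hy)
  have hsumψ : ∀ y, |y| ≤ B → ψ y = ∑ i ∈ Finset.range n, ψ y * φ i y := fun y hy => by
    rw [← Finset.mul_sum, hφs y hy, mul_one]
  have hlsum : lm = ∑ i ∈ Finset.range n, lam f v t₀ (fun y => ψ y * φ i y) :=
    h.lam_sum _ hg hsumψ
  have hinteg : ∀ S ⊆ Ω, MeasurableSet S → ∫ x in S, ψ (v x) =
      ∑ i ∈ Finset.range n, ∫ x in S, ψ (v x) * φ i (v x) := fun S hS hSm => by
    rw [← integral_finsetSum _ fun i _ => (h.integrableOn (hg i)).mono_set hS]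
    exact setIntegral_congr_fun hSm fun x hx => hsumψ _ (h.bound x (hS hx))
  have hident : |(lam f v t₀ fun y => y * ψ y) -
      ∑ i ∈ Finset.range n, c i * lam f v t₀ (fun y => ψ y * φ i y)| ≤ ε * lm := by
    have h1 : (lam f v t₀ fun y => y * ψ y) =
        ∑ i ∈ Finset.range n, lam f v t₀ (fun y => y * (ψ y * φ i y)) :=
      h.lam_sum _ (fun i => continuous_id.mul (hg i)) fun y hy => by
        rw [← Finset.mul_sum, ← hsumψ y hy]
    rw [h1, ← Finset.sum_sub_distrib, hlsum, Finset.mul_sum]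
    refine (Finset.abs_sum_le_sum_abs _ _).trans (Finset.sum_le_sum fun i _ => ?_)
    have c1 : Continuous fun y => y * (ψ y * φ i y) := continuous_id.mul (hg i)
    have c2 : Continuous fun y => c i * (ψ y * φ i y) := continuous_const.mul (hg i)
    rw [← h.lam_const_mul _ (hg i), ← h.lam_const_mul _ (hg i), ← h.lam_sub c1 c2]
    refine h.abs_lam_le (c1.sub c2) (continuous_const.mul (hg i)) fun y _ => ?_
    have hn : 0 ≤ ψ y * φ i y := mul_nonneg (h0 y) (hφ0 i y)
    change |y * (ψ y * φ i y) - c i * (ψ y * φ i y)| ≤ _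
    rw [← sub_mul, abs_mul, abs_of_nonneg hn]
    rcases eq_or_ne (φ i y) 0 with hz | hz
    · simp [hz]
    · exact mul_le_mul_of_nonneg_right (hφc i y hz) hn
  filter_upwards [hEm, hE, (Finset.eventually_all _).2 hpieces] with s hEm hE hp
  rw [Real.norm_eq_abs, Real.norm_eq_abs]
  have hw : wd f v ψ t₀ = ∑ i ∈ Finset.range n, wd f v (fun y => ψ y * φ i y) t₀ :=
    hinteg _ (h.slice.superlevel_subset h.pos.le) (h.slice.measurableSet_superlevel _)
  have hdecomp : (∫ x in E s, ψ (v x)) - wd f v ψ t₀ + m s * lm -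
      s * (lam f v t₀ fun y => y * ψ y) =
      (∑ i ∈ Finset.range n, ((∫ x in E s, ψ (v x) * φ i (v x)) -
      wd f v (fun y => ψ y * φ i y) t₀ + (m s - s * c i) * lam f v t₀ (fun y => ψ y * φ i y))) -
      s * ((lam f v t₀ fun y => y * ψ y) -
      ∑ i ∈ Finset.range n, c i * lam f v t₀ (fun y => ψ y * φ i y)) := by
    rw [Finset.sum_add_distrib, Finset.sum_sub_distrib, ← hinteg _ hE hEm, ← hw, mul_sub,
      Finset.mul_sum, hlsum, Finset.mul_sum]
    have : ∑ i ∈ Finset.range n, (m s - s * c i) * lam f v t₀ (fun y => ψ y * φ i y) =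
        ∑ i ∈ Finset.range n, m s * lam f v t₀ (fun y => ψ y * φ i y) -
        ∑ i ∈ Finset.range n, s * (c i * lam f v t₀ (fun y => ψ y * φ i y)) := by
      rw [← Finset.sum_sub_distrib]
      exact Finset.sum_congr rfl fun i _ => by ring
    rw [this]
    ring
  rw [hdecomp]
  refine (abs_sub _ _).trans ?_
  have hA := (Finset.abs_sum_le_sum_abs _ _).trans (Finset.sum_le_sum hp)
  have hB : ∑ i ∈ Finset.range n, (2 * ε * lam f v t₀ (fun y => ψ y * φ i y) + ρ) * |s| =
      (2 * ε * lm + n * ρ) * |s| := by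
    rw [← Finset.sum_mul, Finset.sum_add_distrib, ← Finset.mul_sum, ← hlsum]
    simp
  rw [hB] at hA
  rw [abs_mul]
  have hC : |s| * |(lam f v t₀ fun y => y * ψ y) -
      ∑ i ∈ Finset.range n, c i * lam f v t₀ (fun y => ψ y * φ i y)| ≤ |s| * (ε * lm) := by gcongr
  have h3 : 3 * ε * lm ≤ η / 2 := by
    have : 3 * ε * (lm + 1) = η / 2 := by rw [hεdef]; field_simp; ring
    nlinarith
  have h4 : n * ρ ≤ η / 2 := by
    have : (n + 1) * ρ = η / 2 := by rw [hρdef]; field_simp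
    nlinarith
  have h5 : (3 * ε * lm + n * ρ) * |s| ≤ η * |s| :=
    mul_le_mul_of_nonneg_right (by linarith) (abs_nonneg s)
  linarith

end Regular

namespace CylSol

variable {N : ℕ} {a : ℝ → ℝ} {Ω : Set (Euc N)} {u : Euc N × ℝ → ℝ} {M : ℝ}

theorem dre_slc_le (h : CylSol a Ω u M) (hM : 0 ≤ M) {s z z' : ℝ} (hs : 0 ≤ s) (hz : 0 < z)
    (hz' : 0 < z') : dre (slc Ω u z') s ≤ dre (slc Ω u z) s + M * |z' - z| := by
  by_contra! hlt
  have hd0 : 0 ≤ dre (slc Ω u z) s := Slice.dre_nonneg s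
  have hη : 0 ≤ M * |z' - z| := by positivity
  have h1 := ((h.slice hM hz').lt_dre_iff hs (add_nonneg hd0 hη)).1 hlt
  have hsub : {x | dre (slc Ω u z) s + M * |z' - z| < slc Ω u z' x} ⊆
      {x | dre (slc Ω u z) s < slc Ω u z x} := fun x hx => by
    have hx1 : dre (slc Ω u z) s + M * |z' - z| < slc Ω u z' x := hx
    have hxΩ : x ∈ Ω := (h.slice hM hz').mem_of_pos ((add_nonneg hd0 hη).trans_lt hx1)
    have h2 := abs_le.1 (h.abs_u_sub_le hxΩ hz hz')
    change dre (slc Ω u z) s < slc Ω u z x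
    rw [slc_apply hxΩ] at hx1 ⊢
    linarith
  have h2 : distr (slc Ω u z') (dre (slc Ω u z) s + M * |z' - z|) ≤
      distr (slc Ω u z) (dre (slc Ω u z) s) :=
    measureReal_mono hsub ((h.slice hM hz).volume_superlevel_lt_top hd0).ne
  exact absurd (h1.trans_le h2) (not_lt.2 ((h.slice hM hz).distr_dre_le hs))

theorem abs_dre_slc_sub_le (h : CylSol a Ω u M) (hM : 0 ≤ M) {s z z' : ℝ} (hs : 0 ≤ s) (hz : 0 < z)
    (hz' : 0 < z') : |dre (slc Ω u z') s - dre (slc Ω u z) s| ≤ M * |z' - z| := by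
  have h1 := h.dre_slc_le hM hs hz hz'
  have h2 := h.dre_slc_le hM hs hz' hz
  rw [abs_sub_comm] at h2
  exact abs_le.2 ⟨by linarith, by linarith⟩

theorem continuousAt_dre_slc (h : CylSol a Ω u M) (hM : 0 ≤ M) {s z : ℝ} (hs : 0 ≤ s)
    (hz : 0 < z) : ContinuousAt (fun z => dre (slc Ω u z) s) z := by
  have hb : Tendsto (fun z' : ℝ => M * |z' - z|) (𝓝 z) (𝓝 0) := by
    have : Continuous fun z' : ℝ => M * |z' - z| := by fun_prop
    exact this.tendsto' _ _ (by simp)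
  refine tendsto_iff_norm_sub_tendsto_zero.2 (squeeze_zero' (.of_forall fun _ => norm_nonneg _) ?_ hb)
  filter_upwards [Ioi_mem_nhds hz] with z' hz'
  exact h.abs_dre_slc_sub_le hM hs hz hz'

/-- The width of the collar of levels swept by the superlevel sets between the times `z` and `z'`. -/
theorem abs_setIntegral_sup_sub_le (h : CylSol a Ω u M) (hM : 0 ≤ M) {s z z' : ℝ} (hs : 0 ≤ s)
    (hz : 0 < z) (hz' : 0 < z') (hη : 0 ≤ dre (slc Ω u z) s - 2 * M * |z' - z|) {g : Euc N → ℝ}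
    {C : ℝ} (hg : IntegrableOn g Ω) (hC : ∀ x ∈ Ω, |g x| ≤ C) (hC0 : 0 ≤ C) :
    |(∫ x in sup Ω u s z', g x) - ∫ x in sup Ω u s z, g x| ≤
      2 * C * (distr (slc Ω u z) (dre (slc Ω u z) s - 2 * M * |z' - z|) -
        distr (slc Ω u z) (dre (slc Ω u z) s + 2 * M * |z' - z|)) := by
  set τ := dre (slc Ω u z) s with hτ
  set η := 2 * M * |z' - z| with hηdef
  have hη0 : 0 ≤ η := by positivity
  have hS := h.slice hM hz
  have hτ' := abs_le.1 (h.abs_dre_slc_sub_le hM hs hz hz')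
  rw [← hτ] at hτ'
  set T₁ := {x | τ + η < slc Ω u z x} with hT₁
  set T₂ := {x | τ - η < slc Ω u z x} with hT₂
  have hη1 : η = M * |z' - z| + M * |z' - z| := by rw [hηdef]; ring
  have hMz : 0 ≤ M * |z' - z| := by positivity
  have hT₁Ω : T₁ ⊆ Ω := hS.superlevel_subset (by linarith)
  have hT₂Ω : T₂ ⊆ Ω := hS.superlevel_subset hη
  have hmem : ∀ x ∈ Ω, |slc Ω u z' x - slc Ω u z x| ≤ M * |z' - z| := fun x hx => by
    rw [slc_apply hx, slc_apply hx]
    exact h.abs_u_sub_le hx hz hz'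
  have h1 : T₁ ⊆ sup Ω u s z' := fun x hx => by
    have hx1 : τ + η < slc Ω u z x := hx
    have := abs_le.1 (hmem x (hT₁Ω hx))
    change dre (slc Ω u z') s < slc Ω u z' x
    linarith
  have h2 : sup Ω u s z' ⊆ T₂ := fun x hx => by
    have hx1 : dre (slc Ω u z') s < slc Ω u z' x := hx
    have := abs_le.1 (hmem x (h.sup_subset hM hz' hx))
    change τ - η < slc Ω u z x
    linarith
  have h3 : T₁ ⊆ sup Ω u s z := fun x hx => by
    have hx1 : τ + η < slc Ω u z x := hx
    change τ < slc Ω u z x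
    linarith
  have h4 : sup Ω u s z ⊆ T₂ := fun x hx => by
    have hx1 : τ < slc Ω u z x := hx
    change τ - η < slc Ω u z x
    linarith
  have key : ∀ S : Set (Euc N), MeasurableSet S → T₁ ⊆ S → S ⊆ T₂ →
      |(∫ x in S, g x) - ∫ x in T₁, g x| ≤ C * (distr (slc Ω u z) (τ - η) -
        distr (slc Ω u z) (τ + η)) := fun S hSm hS1 hS2 => by
    rw [← setIntegral_sdiff (f := g) (hS.measurableSet_superlevel _)
      (hg.mono_set (hS2.trans hT₂Ω)) hS1, ← Real.norm_eq_abs]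
    have hfin : volume T₂ < ⊤ := hS.volume_superlevel_lt_top hη
    refine (norm_setIntegral_le_of_norm_le_const
      ((measure_mono (sdiff_subset.trans hS2)).trans_lt hfin)
      fun x hx => hC x (hT₂Ω (hS2 hx.1))).trans ?_
    rw [measureReal_sdiff hS1 (hS.measurableSet_superlevel _)
      ((measure_mono hS2).trans_lt hfin).ne]
    refine mul_le_mul_of_nonneg_left (sub_le_sub_right ?_ _) hC0
    exact measureReal_mono hS2 hfin.ne
  have k1 := key _ (h.measurableSet_sup hM hz') h1 h2
  have k2 := key _ (h.measurableSet_sup hM hz) h3 h4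
  rw [abs_le] at k1 k2 ⊢
  exact ⟨by linarith, by linarith⟩

theorem tendsto_collar (h : CylSol a Ω u M) (hM : 0 ≤ M) (hN : 0 < N) {s z : ℝ}
    (hz : 0 < z) (hτ : 0 < dre (slc Ω u z) s) :
    Tendsto (fun z' => distr (slc Ω u z) (dre (slc Ω u z) s - 2 * M * |z' - z|) -
        distr (slc Ω u z) (dre (slc Ω u z) s + 2 * M * |z' - z|)) (𝓝 z) (𝓝 0) := by
  have hc := (h.slice hM hz).continuousAt_distr (h.null_slc hN hz) hτ
  have t1 : Tendsto (fun z' => dre (slc Ω u z) s - 2 * M * |z' - z|) (𝓝 z)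
      (𝓝 (dre (slc Ω u z) s)) := by
    have : Continuous fun z' : ℝ => dre (slc Ω u z) s - 2 * M * |z' - z| := by fun_prop
    exact this.tendsto' _ _ (by simp)
  have t2 : Tendsto (fun z' => dre (slc Ω u z) s + 2 * M * |z' - z|) (𝓝 z)
      (𝓝 (dre (slc Ω u z) s)) := by
    have : Continuous fun z' : ℝ => dre (slc Ω u z) s + 2 * M * |z' - z| := by fun_prop
    exact this.tendsto' _ _ (by simp)
  have := (hc.tendsto.comp t1).sub (hc.tendsto.comp t2)
  rw [sub_self] at this
  exact this

theorem eventually_collar_nonneg {τ : ℝ} (hτ : 0 < τ) (M z : ℝ) :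
    ∀ᶠ z' in 𝓝 z, 0 ≤ τ - 2 * M * |z' - z| := by
  have : Continuous fun z' : ℝ => τ - 2 * M * |z' - z| := by fun_prop
  have := this.tendsto' z τ (by simp)
  exact (this.eventually_const_lt hτ).mono fun _ h => h.le

/-- The rate of change of the concentration function. -/
def rate {N : ℕ} (Ω : Set (Euc N)) (u : Euc N × ℝ → ℝ) (s z : ℝ) : ℝ :=
  ∫ x in sup Ω u s z, pd ez u (x, z)

theorem continuousAt_rate (h : CylSol a Ω u M) (hM : 0 ≤ M) (hN : 0 < N) {s z : ℝ} (hs : 0 ≤ s)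
    (hz : 0 < z) (hτ : 0 < dre (slc Ω u z) s) : ContinuousAt (rate Ω u s) z := by
  have hb : Tendsto (fun z' => M * |z' - z| * volume.real Ω + 2 * M *
      (distr (slc Ω u z) (dre (slc Ω u z) s - 2 * M * |z' - z|) -
        distr (slc Ω u z) (dre (slc Ω u z) s + 2 * M * |z' - z|))) (𝓝 z) (𝓝 0) := by
    have t1 : Tendsto (fun z' : ℝ => M * |z' - z| * volume.real Ω) (𝓝 z) (𝓝 0) := by
      have : Continuous fun z' : ℝ => M * |z' - z| * volume.real Ω := by fun_prop
      exact this.tendsto' _ _ (by simp)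
    have t2 := (h.tendsto_collar hM hN hz hτ).const_mul (2 * M)
    rw [mul_zero] at t2
    simpa using t1.add t2
  refine tendsto_iff_norm_sub_tendsto_zero.2
    (squeeze_zero' (.of_forall fun _ => norm_nonneg _) ?_ hb)
  filter_upwards [Ioi_mem_nhds hz, eventually_collar_nonneg hτ M z] with z' hz' hη
  have hE := h.sup_subset hM (s := s) hz'
  have hEm := h.measurableSet_sup hM (s := s) hz'
  have h1 : |∫ x in sup Ω u s z', (pd ez u (x, z') - pd ez u (x, z))| ≤
      M * |z' - z| * volume.real Ω := by
    rw [← Real.norm_eq_abs]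
    refine (norm_setIntegral_le_of_norm_le_const
      ((measure_mono hE).trans_lt h.volume_ne_top.lt_top) fun x hx =>
        h.abs_vel_sub_le (hE hx) hz hz').trans ?_
    exact mul_le_mul_of_nonneg_left (measureReal_mono hE h.volume_ne_top) (by positivity)
  have h2 := h.abs_setIntegral_sup_sub_le hM hs hz hz' hη (h.integrableOn_vel hz)
    (fun x hx => h.abs_vel_le hx hz) hM
  have h3 : rate Ω u s z' - rate Ω u s z =
      (∫ x in sup Ω u s z', (pd ez u (x, z') - pd ez u (x, z))) +
      ((∫ x in sup Ω u s z', pd ez u (x, z)) - ∫ x in sup Ω u s z, pd ez u (x, z)) := by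
    rw [integral_sub ((h.integrableOn_vel hz').mono_set hE) ((h.integrableOn_vel hz).mono_set hE),
      rate, rate]
    ring
  rw [h3]
  exact (norm_add_le _ _).trans (add_le_add h1 h2)

theorem hasDerivAt_conc_slc (h : CylSol a Ω u M) (hM : 0 ≤ M) (hN : 0 < N) {s z : ℝ} (hs : 0 ≤ s)
    (hz : 0 < z) (hτ : 0 < dre (slc Ω u z) s) :
    HasDerivAt (fun z => conc (slc Ω u z) s) (rate Ω u s z) z := by
  have hc := h.continuousAt_rate hM hN hs hz hτ
  rw [hasDerivAt_iff_isLittleO]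
  refine Asymptotics.isLittleO_iff.2 fun ε hε => ?_
  have e1 : ∀ᶠ z' in 𝓝 z, |rate Ω u s z' - rate Ω u s z| < ε / 2 :=
    Metric.tendsto_nhds.1 hc.tendsto (ε / 2) (by positivity)
  have e2 : ∀ᶠ z' in 𝓝 z, M * |z' - z| * volume.real Ω < ε / 2 := by
    have : Continuous fun z' : ℝ => M * |z' - z| * volume.real Ω := by fun_prop
    exact (this.tendsto' z 0 (by simp)).eventually_lt_const (by positivity)
  filter_upwards [e1, e2, Ioi_mem_nhds hz] with z' h1 h2 hz'
  have k1 := h.le_conc_sub hM hN hs hz hz'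
  have k2 := h.le_conc_sub hM hN hs hz' hz
  rw [← rate] at k1 k2
  have hsq : M * (z' - z) ^ 2 * volume.real Ω ≤ ε / 2 * |z' - z| := by
    rw [← sq_abs]
    nlinarith [abs_nonneg (z' - z)]
  have hsq' : M * (z - z') ^ 2 * volume.real Ω ≤ ε / 2 * |z' - z| := by
    rwa [show (z - z') ^ 2 = (z' - z) ^ 2 by ring]
  have hr : |(z' - z) * (rate Ω u s z' - rate Ω u s z)| ≤ ε / 2 * |z' - z| := by
    rw [abs_mul, mul_comm]
    gcongr
  rw [smul_eq_mul, Real.norm_eq_abs, Real.norm_eq_abs]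
  rw [abs_le] at hr ⊢
  have hnn : 0 ≤ ε / 2 * |z' - z| := by positivity
  constructor
  · linarith
  · have : (z - z') * rate Ω u s z' = -((z' - z) * (rate Ω u s z' - rate Ω u s z)) -
      (z' - z) * rate Ω u s z := by ring
    linarith

theorem hasDerivAt_moving_increment (h : CylSol a Ω u M) (hM : 0 ≤ M) (hN : 0 < N) {s z : ℝ}
    (hs : 0 ≤ s) (hz : 0 < z) (hτ : 0 < dre (slc Ω u z) s) :
    HasDerivAt (fun z' => ∫ x in sup Ω u s z', (pd ez u (x, z') - pd ez u (x, z)))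
      (∫ x in sup Ω u s z, pd ez (pd ez u) (x, z)) z := by
  have h0 : HasDerivAt (fun z' => ∫ x in sup Ω u s z, (pd ez u (x, z') - pd ez u (x, z)))
      (∫ x in sup Ω u s z, pd ez (pd ez u) (x, z)) z := by
    have h1 := (h.hasDerivAt_integral_vel (h.sup_subset hM (s := s) hz)
      (h.measurableSet_sup hM (s := s) hz) hz).sub_const (∫ x in sup Ω u s z, pd ez u (x, z))
    refine h1.congr_of_eventuallyEq ?_
    filter_upwards [Ioi_mem_nhds hz] with z' hz'
    exact integral_sub ((h.integrableOn_vel hz').mono_set (h.sup_subset hM hz))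
      ((h.integrableOn_vel hz).mono_set (h.sup_subset hM hz))
  have h1 : HasDerivAt (fun z' => (∫ x in sup Ω u s z', (pd ez u (x, z') - pd ez u (x, z))) -
      ∫ x in sup Ω u s z, (pd ez u (x, z') - pd ez u (x, z))) 0 z := by
    rw [hasDerivAt_iff_isLittleO]
    refine Asymptotics.isLittleO_iff.2 fun ε hε => ?_
    have hcol := (h.tendsto_collar hM hN hz hτ).const_mul (2 * M)
    rw [mul_zero] at hcol
    filter_upwards [hcol.eventually_lt_const hε, eventually_collar_nonneg hτ M z,
      Ioi_mem_nhds hz] with z' hlt hη hz'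
    have h2 := h.abs_setIntegral_sup_sub_le hM hs hz hz' hη
      ((h.integrableOn_vel hz').sub (h.integrableOn_vel hz)) (C := M * |z' - z|)
      (fun x hx => h.abs_vel_sub_le hx hz hz') (by positivity)
    simp only [Pi.sub_apply] at h2
    simp only [sub_self, integral_zero, smul_zero, sub_zero, Real.norm_eq_abs]
    refine h2.trans ?_
    calc _ = (2 * M * (distr (slc Ω u z) (dre (slc Ω u z) s - 2 * M * |z' - z|) -
        distr (slc Ω u z) (dre (slc Ω u z) s + 2 * M * |z' - z|))) * |z' - z| := by ring
      _ ≤ ε * |z' - z| := by gcongr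
  have := h1.fun_add h0
  simp only [sub_add_cancel, zero_add] at this
  exact this

theorem volume_sup (h : CylSol a Ω u M) (hM : 0 ≤ M) (hN : 0 < N) {s z : ℝ}
    (hs : 0 ≤ s) (hz : 0 < z) (hτ : 0 < dre (slc Ω u z) s) : volume.real (sup Ω u s z) = s :=
  (h.slice hM hz).distr_dre_eq (h.null_slc hN hz) hs hτ

theorem exists_hasDerivAt_integral_sup (h : CylSol a Ω u M) (hM : 0 ≤ M) (hN : 0 < N) {s z : ℝ}
    (hs : 0 ≤ s) (hz : 0 < z)
    (hR : Regular Ω (slc Ω u z) (fun x => pd ez u (x, z)) M M (dre (slc Ω u z) s))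
    (hA : lam (slc Ω u z) (fun x => pd ez u (x, z)) (dre (slc Ω u z) s) (fun _ => 1) ≠ 0) :
    ∃ d, HasDerivAt (fun z' => ∫ x in sup Ω u s z', pd ez u (x, z)) d z := by
  set f := slc Ω u z with hf
  set v : Euc N → ℝ := fun x => pd ez u (x, z) with hv
  set t₀ := dre f s with ht₀
  have hτ : 0 < t₀ := hR.pos
  set m : ℝ → ℝ := fun r => dre (slc Ω u (z + r)) s - t₀ with hm
  have htend : Tendsto (fun r => z + r) (𝓝 0) (𝓝 z) :=
    (continuous_const.add continuous_id).tendsto' _ _ (by simp)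
  have hpos : ∀ᶠ r in 𝓝 0, 0 < z + r := htend.eventually_const_lt hz
  have hτpos : ∀ᶠ r in 𝓝 0, 0 < dre (slc Ω u (z + r)) s :=
    ((h.continuousAt_dre_slc hM hs hz).tendsto.comp htend).eventually_const_lt hτ
  have hEm : ∀ᶠ r in 𝓝 0, MeasurableSet (sup Ω u s (z + r)) :=
    hpos.mono fun r hr => h.measurableSet_sup hM hr
  have hE : ∀ᶠ r in 𝓝 0, sup Ω u s (z + r) ⊆ Ω := hpos.mono fun r hr => h.sup_subset hM hr
  have hml : ∀ᶠ r in 𝓝 0, |m r| ≤ M * |r| := hpos.mono fun r hr => by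
    have := h.abs_dre_slc_sub_le hM hs hz hr
    rwa [add_sub_cancel_left] at this
  have htaylor : ∀ {r : ℝ}, 0 < z + r → ∀ x ∈ Ω,
      |slc Ω u (z + r) x - f x - r * v x| ≤ M * r ^ 2 := fun {r} hr x hx => by
    have := h.abs_taylor_le hx hz hr
    rw [add_sub_cancel_left] at this
    rw [hf, slc_apply hx, slc_apply hx]
    exact this
  have hin : ∀ᶠ r in 𝓝 0, ∀ x ∈ Ω, t₀ + m r - r * v x + M * r ^ 2 < f x → x ∈ sup Ω u s (z + r) :=
    hpos.mono fun r hr x hx hlt => by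
      have := abs_le.1 (htaylor hr x hx)
      change dre (slc Ω u (z + r)) s < slc Ω u (z + r) x
      have hmr : m r = dre (slc Ω u (z + r)) s - t₀ := rfl
      linarith
  have hout : ∀ᶠ r in 𝓝 0, ∀ x ∈ sup Ω u s (z + r), t₀ + m r - r * v x - M * r ^ 2 < f x :=
    hpos.mono fun r hr x hx => by
      have := abs_le.1 (htaylor hr x (h.sup_subset hM hr hx))
      have hx' : dre (slc Ω u (z + r)) s < slc Ω u (z + r) x := hx
      have hmr : m r = dre (slc Ω u (z + r)) s - t₀ := rfl
      linarith
  set ψ : ℝ → ℝ := fun y => |y + M| with hψ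
  have e1 := hR.isLittleO_moving hEm hE hml hin hout (ψ := fun _ => 1) continuous_const
    fun _ => zero_le_one
  have e2 := hR.isLittleO_moving hEm hE hml hin hout (ψ := ψ) (by fun_prop) fun y => abs_nonneg _
  set A := lam f v t₀ (fun _ => 1) with hAdef
  set P := lam f v t₀ ψ
  set L₁ := lam f v t₀ (fun y => y * 1)
  set L₂ := lam f v t₀ (fun y => y * ψ y)
  have hvol : ∀ {r : ℝ}, 0 < z + r → 0 < dre (slc Ω u (z + r)) s →
      ∫ x in sup Ω u s (z + r), ψ (v x) = (∫ x in sup Ω u s (z + r), v x) + M * s := by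
    intro r hr hτr
    have hsub := h.sup_subset hM (s := s) hr
    have hfin : volume (sup Ω u s (z + r)) ≠ ⊤ :=
      ((measure_mono hsub).trans_lt h.volume_ne_top.lt_top).ne
    have h1 : ∫ x in sup Ω u s (z + r), ψ (v x) = ∫ x in sup Ω u s (z + r), (v x + M) :=
      setIntegral_congr_fun (h.measurableSet_sup hM hr) fun x hx => by
        have := abs_le.1 (h.abs_vel_le (hsub hx) hz)
        exact abs_of_nonneg (by change 0 ≤ pd ez u (x, z) + M; linarith)
    rw [h1, integral_add ((h.integrableOn_vel hz).mono_set hsub) (integrableOn_const hfin),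
      setIntegral_const, h.volume_sup hM hN hs hr hτr, smul_eq_mul, mul_comm]
  have hz0 : z + 0 = z := add_zero z
  have hw1 : wd f v (fun _ => 1) t₀ = s := by
    rw [wd, setIntegral_const, smul_eq_mul, mul_one]
    exact h.volume_sup hM hN hs hz hτ
  have hw2 : wd f v ψ t₀ = (∫ x in sup Ω u s z, v x) + M * s := by
    have := hvol (r := 0) (by rwa [hz0]) (by rwa [hz0])
    rw [hz0] at this
    exact this
  refine ⟨L₂ - P / A * L₁, ?_⟩
  rw [hasDerivAt_iff_isLittleO_nhds_zero]
  refine (e2.sub (e1.const_mul_left (P / A))).congr' ?_ EventuallyEq.rfl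
  filter_upwards [hpos, hτpos] with r hr hτr
  rw [hvol hr hτr, hw1, hw2, setIntegral_const, h.volume_sup hM hN hs hr hτr, smul_eq_mul,
    smul_eq_mul]
  field_simp
  ring

/-- The concentration inequality at a point where the rearrangement is differentiable with nonzero
slope, if `∂_z u` is constant on the critical points of the corresponding level. -/
theorem concentration_of_regular_level (h : CylSol a Ω u M) (hM : 0 ≤ M) (hN : 2 ≤ N) {s z d : ℝ}
    (hs : 0 < s) (hz : 0 < z) (hd : HasDerivAt (dre (slc Ω u z)) d s) (hd0 : d ≠ 0)
    (hcrit : ∃ b, ∀ x ∈ Ω, slc Ω u z x = dre (slc Ω u z) s → Slice.gradSq (slc Ω u z) x = 0 →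
      pd ez u (x, z) = b) :
    0 ≤ a z * deriv (deriv fun z => conc (slc Ω u z) s) z + isoProfile N s ^ 2 * d := by
  have hN0 : 0 < N := by omega
  obtain ⟨b, hb⟩ := hcrit
  have hS := h.slice hM hz
  have hnull := h.null_slc hN0 hz
  obtain ⟨hτ, hdneg, hdist⟩ := hS.hasDerivAt_distr hnull hN0 hs hd hd0
  have hv : ContDiffOn ℝ 1 (fun x => pd ez u (x, z)) Ω :=
    (h.contDiffOn_vel.of_le (by norm_cast)).comp (contDiff_prodMk_left z).contDiffOn
      fun x hx => mk_mem_prod hx hz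
  have hR : Regular Ω (slc Ω u z) (fun x => pd ez u (x, z)) M M (dre (slc Ω u z) s) :=
    ⟨hS, hv.continuousOn, fun x hx => h.abs_vel_le hx hz, hτ, fun φ hφ => by
      obtain ⟨d', hd'⟩ := hS.exists_hasDerivAt_comp hnull hτ hdist hv
        (fun x hx => h.abs_vel_le hx hz) hb hφ
      exact hd'.differentiableAt⟩
  have hwd : wd (slc Ω u z) (fun x => pd ez u (x, z)) (fun _ => 1) = distr (slc Ω u z) := by
    funext t
    rw [wd, setIntegral_const, smul_eq_mul, mul_one, distr]
  have hA : lam (slc Ω u z) (fun x => pd ez u (x, z)) (dre (slc Ω u z) s) (fun _ => 1) ≠ 0 := by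
    rw [lam, hwd, hdist.deriv]
    exact neg_ne_zero.2 (inv_ne_zero hd0)
  obtain ⟨D, hD⟩ := h.exists_hasDerivAt_integral_sup hM hN0 hs.le hz hR hA
  have hrate : HasDerivAt (rate Ω u s) ((∫ x in sup Ω u s z, pd ez (pd ez u) (x, z)) + D) z := by
    refine ((h.hasDerivAt_moving_increment hM hN0 hs.le hz hτ).fun_add hD).congr_of_eventuallyEq ?_
    filter_upwards [Ioi_mem_nhds hz] with z' hz'
    rw [integral_sub ((h.integrableOn_vel hz').mono_set (h.sup_subset hM hz'))
      ((h.integrableOn_vel hz).mono_set (h.sup_subset hM hz')), sub_add_cancel, rate]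
  have hev : ∀ᶠ z' in 𝓝 z, HasDerivAt (fun z => conc (slc Ω u z) s) (rate Ω u s z') z' := by
    filter_upwards [Ioi_mem_nhds hz,
      (h.continuousAt_dre_slc hM hs.le hz).tendsto.eventually_const_lt hτ] with z' hz' hτ'
    exact h.hasDerivAt_conc_slc hM hN0 hs.le hz' hτ'
  have hderiv : HasDerivAt (deriv fun z => conc (slc Ω u z) s)
      ((∫ x in sup Ω u s z, pd ez (pd ez u) (x, z)) + D) z :=
    hrate.congr_of_eventuallyEq (hev.mono fun z' hz' => hz'.deriv)
  have htouch : ∫ x in sup Ω u s z, pd ez (pd ez u) (x, z) ≤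
      deriv (deriv fun z => conc (slc Ω u z) s) z := by
    rw [hderiv.deriv]
    refine le_deriv_deriv_of_touching (F := fun z' => ∫ x in sup Ω u s z, u (x, z'))
      (hev.mono fun z' hz' => hz'.differentiableAt.hasDerivAt) hderiv ?_
      (h.hasDerivAt_integral_vel (h.sup_subset hM hz) (h.measurableSet_sup hM hz) hz) ?_
      (h.integral_sup hM hN0 hs.le hz)
    · filter_upwards [Ioi_mem_nhds hz] with r hr
      exact h.hasDerivAt_integral (h.sup_subset hM hz) (h.measurableSet_sup hM hz) hr
    · filter_upwards [Ioi_mem_nhds hz] with r hr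
      exact h.integral_sup_le hM hs.le hz hr
  have hiso := hS.isoProfile_sq_le hN hτ (A := -d⁻¹) (by
    have := inv_lt_zero.2 hdneg
    linarith) (by rwa [neg_neg])
  rw [hS.distr_dre_eq hnull hs.le hτ] at hiso
  have hlap : ∫ x in {x | dre (slc Ω u z) s < slc Ω u z x}, -lapl (slc Ω u z) x =
      a z * ∫ x in sup Ω u s z, pd ez (pd ez u) (x, z) := by
    rw [← integral_const_mul]
    exact setIntegral_congr_fun (h.measurableSet_sup hM hz)
      fun x hx => h.lapl_slc (h.sup_subset hM hz hx) hz
  rw [hlap] at hiso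
  have h1 := mul_le_mul_of_nonneg_right hiso (neg_nonneg.2 hdneg.le)
  have h2 : -d⁻¹ * (a z * ∫ x in sup Ω u s z, pd ez (pd ez u) (x, z)) * -d =
      a z * ∫ x in sup Ω u s z, pd ez (pd ez u) (x, z) := by
    field_simp
  have h3 := mul_le_mul_of_nonneg_left htouch (h.pos z hz).le
  rw [h2] at h1
  linarith

end CylSol

theorem dimH_image_eq_zero_of_pointwise_lipschitz {X : Type*} [MetricSpace X]
    [SecondCountableTopology X] {f : X → ℝ} {A : Set X} (hA : dimH A = 0)
    (hf : ∀ p ∈ A, ∃ K : ℝ, ∀ᶠ q in 𝓝 p, |f q - f p| ≤ K * dist q p) : dimH (f '' A) = 0 := by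
  let T : ℕ → Set X := fun n =>
    {p | p ∈ A ∧ ∀ q, dist q p < 1 / ((n : ℝ) + 1) → |f q - f p| ≤ n * dist q p}
  have hcover : f '' A ⊆ ⋃ n, f '' T n := by
    rintro _ ⟨p, hp, rfl⟩
    obtain ⟨K, hK⟩ := hf p hp
    obtain ⟨ε, hε, hball⟩ := Metric.eventually_nhds_iff.1 hK
    obtain ⟨n₁, hn₁⟩ := exists_nat_ge K
    obtain ⟨n₂, hn₂⟩ := exists_nat_one_div_lt hε
    refine mem_iUnion.2 ⟨max n₁ n₂, p, ⟨hp, fun q hq => ?_⟩, rfl⟩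
    have h1 : (1 : ℝ) / (((max n₁ n₂ : ℕ) : ℝ) + 1) ≤ 1 / ((n₂ : ℝ) + 1) := by
      gcongr
      exact le_max_right _ _
    refine (hball (hq.trans (h1.trans_lt hn₂))).trans ?_
    gcongr
    exact hn₁.trans (by exact_mod_cast le_max_left _ _)
  refine le_antisymm ((dimH_mono hcover).trans ?_) bot_le
  rw [dimH_iUnion]
  refine iSup_le fun n => ?_
  refine (dimH_image_le_of_locally_lipschitzOn fun p _ => ?_).trans
    ((dimH_mono fun q (hq : q ∈ T n) => hq.1).trans hA.le)
  have hr : (0 : ℝ) < 1 / ((n : ℝ) + 1) / 2 := by positivity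
  refine ⟨n, T n ∩ Metric.ball p (1 / ((n : ℝ) + 1) / 2),
    inter_mem self_mem_nhdsWithin (mem_nhdsWithin_of_mem_nhds (Metric.ball_mem_nhds p hr)), ?_⟩
  refine LipschitzOnWith.of_dist_le_mul fun q hq q' hq' => ?_
  rw [Real.dist_eq]
  refine hq'.1.2 q ?_
  have h1 := Metric.mem_ball.1 hq.2
  have h2 := Metric.mem_ball.1 hq'.2
  have h3 := dist_triangle_right q q' p
  linarith

namespace CylSol

variable {N : ℕ} {a : ℝ → ℝ} {Ω : Set (Euc N)} {u : Euc N × ℝ → ℝ} {M : ℝ}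

theorem abs_slc_sub_le (h : CylSol a Ω u M) (hM : 0 ≤ M) (x : Euc N) {z z' : ℝ} (hz : 0 < z)
    (hz' : 0 < z') : |slc Ω u z' x - slc Ω u z x| ≤ M * |z' - z| := by
  by_cases hx : x ∈ Ω
  · rw [slc_apply hx, slc_apply hx]
    exact h.abs_u_sub_le hx hz hz'
  · rw [slc, slc, indicator_of_notMem hx, indicator_of_notMem hx, sub_zero, abs_zero]
    positivity

theorem distr_slc_le (h : CylSol a Ω u M) (hM : 0 ≤ M) {z z' t : ℝ} (hz : 0 < z)
    (hz' : 0 < z') (ht : 0 ≤ t - M * |z' - z|) :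
    distr (slc Ω u z') t ≤ distr (slc Ω u z) (t - M * |z' - z|) := by
  refine measureReal_mono (fun x hx => ?_) ((h.slice hM hz).volume_superlevel_lt_top ht).ne
  have h1 := (abs_le.1 (h.abs_slc_sub_le hM x hz hz')).2
  have hx' : t < slc Ω u z' x := hx
  change t - M * |z' - z| < slc Ω u z x
  linarith

/-- The distribution function of the slices, as a function of height and level, is pointwise
Lipschitz wherever it is differentiable in the level. -/
theorem exists_distr_slc_lipschitz (h : CylSol a Ω u M) (hM : 0 ≤ M) {z t D : ℝ} (hz : 0 < z)
    (ht : 0 < t) (hD : HasDerivAt (distr (slc Ω u z)) D t) :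
    ∃ K : ℝ, ∀ᶠ q : ℝ × ℝ in 𝓝 (z, t),
      |distr (slc Ω u q.1) q.2 - distr (slc Ω u z) t| ≤ K * dist q (z, t) := by
  obtain ⟨C, hC⟩ := hD.isBigO_sub.bound
  have hpos : ∀ᶠ r in 𝓝 t, 0 < r := eventually_gt_nhds ht
  have key : ∀ κ : ℝ, Tendsto (fun q : ℝ × ℝ => q.2 + κ * (M * |q.1 - z|)) (𝓝 (z, t)) (𝓝 t) := by
    intro κ
    have : ContinuousAt (fun q : ℝ × ℝ => q.2 + κ * (M * |q.1 - z|)) (z, t) := by fun_prop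
    simpa [ContinuousAt] using this
  have hz1 : ∀ᶠ q : ℝ × ℝ in 𝓝 (z, t), 0 < q.1 :=
    continuousAt_fst.eventually (eventually_gt_nhds hz)
  refine ⟨|C| * (1 + M), ?_⟩
  filter_upwards [hz1, (key (-1)).eventually hpos, (key 1).eventually hpos,
    (key (-1)).eventually hC, (key 1).eventually hC] with q hq hp1 hp2 hb1 hb2
  set Δ := M * |q.1 - z| with hΔ
  rw [neg_one_mul, ← sub_eq_add_neg] at hp1 hb1
  rw [one_mul] at hp2 hb2
  have hd1 : |q.1 - z| ≤ dist q (z, t) := le_max_left (dist q.1 z) (dist q.2 t)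
  have hd2 : |q.2 - t| ≤ dist q (z, t) := le_max_right (dist q.1 z) (dist q.2 t)
  have hd3 : Δ ≤ M * dist q (z, t) := by rw [hΔ]; gcongr
  have hΔ0 : 0 ≤ Δ := by positivity
  have bd : ∀ r : ℝ, |r - t| ≤ |q.2 - t| + Δ → C * |r - t| ≤ |C| * (1 + M) * dist q (z, t) := by
    intro r hr
    calc C * |r - t| ≤ |C| * |r - t| := by gcongr; exact le_abs_self C
      _ ≤ |C| * ((1 + M) * dist q (z, t)) := by gcongr; linarith
      _ = _ := by ring
  rw [Real.norm_eq_abs, Real.norm_eq_abs] at hb1 hb2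
  have e1 := h.distr_slc_le hM hz hq hp1.le
  have e2 := h.distr_slc_le hM (t := q.2 + Δ) hq hz (by
    rw [abs_sub_comm, ← hΔ]; linarith [hp1, hp2])
  rw [abs_sub_comm z, ← hΔ, add_sub_cancel_right] at e2
  have f1 := bd (q.2 - Δ) (by
    rw [show q.2 - Δ - t = (q.2 - t) - Δ by ring]
    exact (abs_sub _ _).trans_eq (by rw [abs_of_nonneg hΔ0]))
  have f2 := bd (q.2 + Δ) (by
    rw [show q.2 + Δ - t = (q.2 - t) + Δ by ring]
    exact (abs_add_le _ _).trans_eq (by rw [abs_of_nonneg hΔ0]))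
  rw [abs_le] at hb1 hb2 ⊢
  constructor <;> linarith [hb1.1, hb1.2, hb2.1, hb2.2]

theorem fderiv_eq_of_gradSq_eq_zero (h : CylSol a Ω u M) {x : Euc N} (hx : x ∈ Ω) {z : ℝ}
    (hz : 0 < z) (hc : Slice.gradSq (slc Ω u z) x = 0) (v : Euc N) (r : ℝ) :
    fderiv ℝ u (x, z) (v, r) = r * pd ez u (x, z) := by
  have h0 : fderiv ℝ (slc Ω u z) x = 0 := by
    have h1 := (Finset.sum_eq_zero_iff_of_nonneg fun i _ => sq_nonneg _).1 hc
    ext v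
    rw [← (EuclideanSpace.basisFun (Fin N) ℝ).sum_repr v, map_sum]
    refine Finset.sum_eq_zero fun i _ => ?_
    have h2 := pow_eq_zero_iff (two_ne_zero) |>.1 (h1 i (Finset.mem_univ i))
    rw [map_smul, EuclideanSpace.basisFun_apply, h2, smul_zero]
  have h3 : fderiv ℝ u (x, z) (v, 0) = 0 := by
    have := congrArg (fun L => L v) h0
    rwa [h.fderiv_slc hx hz] at this
  have h4 : ((v, r) : Euc N × ℝ) = (v, 0) + r • ez := by simp [ez]
  rw [h4, map_add, h3, map_smul, zero_add, smul_eq_mul]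
  rfl

/-- Pairs of critical points of a slice on a common level at which the vertical velocities
differ. -/
def clash {N : ℕ} (Ω : Set (Euc N)) (u : Euc N × ℝ → ℝ) : Set (Euc N × Euc N × ℝ) :=
  {q | q.1 ∈ Ω ∧ q.2.1 ∈ Ω ∧ 0 < q.2.2 ∧ u (q.1, q.2.2) = u (q.2.1, q.2.2) ∧
    Slice.gradSq (slc Ω u q.2.2) q.1 = 0 ∧ Slice.gradSq (slc Ω u q.2.2) q.2.1 = 0 ∧
    pd ez u (q.1, q.2.2) ≠ pd ez u (q.2.1, q.2.2)}

theorem dimH_clash_levels (h : CylSol a Ω u M) :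
    dimH ((fun q : Euc N × Euc N × ℝ => (q.2.2, u (q.1, q.2.2))) '' clash Ω u) = 0 := by
  set V : Set (Euc N × Euc N × ℝ) := Ω ×ˢ (Ω ×ˢ Ioi 0) with hV
  have hVo : IsOpen V := h.isOpen.prod h.isOpen_cyl
  let π₁ : Euc N × Euc N × ℝ →L[ℝ] Euc N × ℝ :=
    (ContinuousLinearMap.fst ℝ _ _).prod
      ((ContinuousLinearMap.snd ℝ _ _).comp (ContinuousLinearMap.snd ℝ _ _))
  let π₂ : Euc N × Euc N × ℝ →L[ℝ] Euc N × ℝ := ContinuousLinearMap.snd ℝ _ _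
  have hu1 : ContDiffOn ℝ ∞ (fun q : Euc N × Euc N × ℝ => u (π₁ q)) V :=
    h.contDiffOn_infty.comp π₁.contDiff.contDiffOn fun q hq => ⟨hq.1, hq.2.2⟩
  have hu2 : ContDiffOn ℝ ∞ (fun q : Euc N × Euc N × ℝ => u (π₂ q)) V :=
    h.contDiffOn_infty.comp π₂.contDiff.contDiffOn fun q hq => hq.2
  have hd1 : ∀ q ∈ V, HasFDerivAt (fun q : Euc N × Euc N × ℝ => u (π₁ q))
      ((fderiv ℝ u (π₁ q)).comp π₁) q := fun q hq =>
    ((h.contDiffAt hq.1 hq.2.2).differentiableAt (by simp)).hasFDerivAt.comp q π₁.hasFDerivAt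
  have hd2 : ∀ q ∈ V, HasFDerivAt (fun q : Euc N × Euc N × ℝ => u (π₂ q))
      ((fderiv ℝ u (π₂ q)).comp π₂) q := fun q hq =>
    ((h.contDiffAt hq.2.1 hq.2.2).differentiableAt (by simp)).hasFDerivAt.comp q π₂.hasFDerivAt
  have hPV : ∀ q ∈ clash Ω u, q ∈ V := fun q hq => ⟨hq.1, hq.2.1, hq.2.2.1⟩
  have hD : ∀ q ∈ clash Ω u, ∀ v, fderiv ℝ (fun q => u (π₁ q) - u (π₂ q)) q v =
      v.2.2 * (pd ez u (q.1, q.2.2) - pd ez u (q.2.1, q.2.2)) := by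
    intro q hq v
    rw [((hd1 q (hPV q hq)).fun_sub (hd2 q (hPV q hq))).fderiv]
    change fderiv ℝ u (q.1, q.2.2) (v.1, v.2.2) - fderiv ℝ u (q.2.1, q.2.2) (v.2.1, v.2.2) = _
    rw [h.fderiv_eq_of_gradSq_eq_zero hq.1 hq.2.2.1 hq.2.2.2.2.1,
      h.fderiv_eq_of_gradSq_eq_zero hq.2.1 hq.2.2.1 hq.2.2.2.2.2.1]
    ring
  have hne : ∀ q ∈ clash Ω u, pd ez u (q.1, q.2.2) - pd ez u (q.2.1, q.2.2) ≠ 0 := fun q hq =>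
    sub_ne_zero.2 hq.2.2.2.2.2.2
  refine dimH_image_eq_zero_of_locally fun q hq => ?_
  refine dimH_image_hypersurface (sard_rank_zero (ℝ × ℝ) (N + N)) ?_ hVo
    (h := fun q => u (π₁ q) - u (π₂ q)) ?_ (hu1.sub hu2) ?_ ?_ (hPV q hq) ?_
  · simp [Module.finrank_prod, add_assoc]
  · exact (contDiff_snd.comp contDiff_snd).contDiffOn.prodMk hu1
  · exact fun q hq => sub_eq_zero.2 hq.2.2.2.1
  · intro q hq v hv
    rw [hD q hq v] at hv
    have hv0 : v.2.2 = 0 := (mul_eq_zero.1 hv).resolve_right (hne q hq)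
    have h1 : HasFDerivAt (fun q : Euc N × Euc N × ℝ => q.2.2)
        ((ContinuousLinearMap.snd ℝ (Euc N) ℝ).comp (ContinuousLinearMap.snd ℝ _ _)) q :=
      ((ContinuousLinearMap.snd ℝ (Euc N) ℝ).comp
        (ContinuousLinearMap.snd ℝ (Euc N) (Euc N × ℝ))).hasFDerivAt
    have h2 := (h1.prodMk (hd1 q (hPV q hq))).fderiv
    have h3 : fderiv ℝ u (q.1, q.2.2) (v.1, v.2.2) = 0 := by
      rw [h.fderiv_eq_of_gradSq_eq_zero hq.1 hq.2.2.1 hq.2.2.2.2.1, hv0, zero_mul]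
    refine (congrArg (fun L => L v) h2).trans ?_
    exact Prod.ext hv0 h3
  · intro h0
    have h1 := hD q hq (0, 0, 1)
    rw [h0] at h1
    exact hne q hq (by simpa using h1.symm)

/-- The mass levels at which some slice is regular but has two critical points with different
vertical velocities form a null set. -/
theorem volume_clash (h : CylSol a Ω u M) (hM : 0 ≤ M) (hN : 0 < N) :
    volume {s : ℝ | 0 < s ∧ ∃ z d : ℝ, 0 < z ∧ d ≠ 0 ∧ HasDerivAt (dre (slc Ω u z)) d s ∧
      ¬ ∃ b, ∀ x ∈ Ω, slc Ω u z x = dre (slc Ω u z) s → Slice.gradSq (slc Ω u z) x = 0 →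
        pd ez u (x, z) = b} = 0 := by
  set L := (fun q : Euc N × Euc N × ℝ => (q.2.2, u (q.1, q.2.2))) '' clash Ω u with hL
  set A := {p : ℝ × ℝ | p ∈ L ∧ ∃ K : ℝ, ∀ᶠ q : ℝ × ℝ in 𝓝 p,
    |distr (slc Ω u q.1) q.2 - distr (slc Ω u p.1) p.2| ≤ K * dist q p} with hA
  have hA0 : dimH A = 0 :=
    le_antisymm ((dimH_mono fun p (hp : p ∈ A) => hp.1).trans h.dimH_clash_levels.le) bot_le
  have h1 : dimH ((fun p : ℝ × ℝ => distr (slc Ω u p.1) p.2) '' A) = 0 :=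
    dimH_image_eq_zero_of_pointwise_lipschitz hA0 fun p hp => hp.2
  have h2 : volume ((fun p : ℝ × ℝ => distr (slc Ω u p.1) p.2) '' A) = 0 := by
    refine measure_zero_of_dimH_lt (d := 1) ?_ (by rw [h1]; simp)
    rw [NNReal.coe_one, hausdorffMeasure_real]
  refine measure_mono_null ?_ h2
  rintro s ⟨hs, z, d, hz, hd0, hd, hb⟩
  have hS := h.slice hM hz
  have hnull := h.null_slc hN hz
  obtain ⟨hτ, -, hdist⟩ := hS.hasDerivAt_distr hnull hN hs hd hd0
  refine ⟨(z, dre (slc Ω u z) s), ⟨?_, h.exists_distr_slc_lipschitz hM hz hτ hdist⟩,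
    hS.distr_dre_eq hnull hs.le hτ⟩
  by_contra hc
  refine hb ?_
  by_cases hx : ∃ x ∈ Ω, slc Ω u z x = dre (slc Ω u z) s ∧ Slice.gradSq (slc Ω u z) x = 0
  · obtain ⟨x, hx, hxl, hxg⟩ := hx
    refine ⟨pd ez u (x, z), fun y hy hyl hyg => ?_⟩
    by_contra hne
    rw [slc_apply hx] at hxl
    rw [slc_apply hy] at hyl
    exact hc ⟨(x, y, z), ⟨hx, hy, hz, hxl.trans hyl.symm, hxg, hyg, Ne.symm hne⟩,
      Prod.ext rfl hxl⟩
  · exact ⟨0, fun y hy hyl hyg => (hx ⟨y, hy, hyl, hyg⟩).elim⟩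

end CylSol

theorem deriv_deriv_line {E : Type} [NormedAddCommGroup E] [NormedSpace ℝ E]
    {u : E → ℝ} {V : Set E} (hV : IsOpen V) (hu : ContDiffOn ℝ 2 u V) {q e : E} (hq : q ∈ V) :
    deriv (deriv fun t : ℝ => u (q + t • e)) 0 = pd e (pd e u) q := by
  obtain ⟨h1, h2⟩ := eventually_hasDerivAt_line hV hu (e := e) hq
  rw [Filter.EventuallyEq.deriv_eq (h1.mono fun s hs => hs.deriv)]
  exact h2.deriv

theorem deriv_deriv_vertical {N : ℕ} {u : Euc N × ℝ → ℝ} {V : Set (Euc N × ℝ)} (hV : IsOpen V)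
    (hu : ContDiffOn ℝ 2 u V) {x : Euc N} {z : ℝ} (hq : (x, z) ∈ V) :
    deriv (deriv fun r => u (x, r)) z = pd ez (pd ez u) (x, z) := by
  rw [← deriv_deriv_line hV hu hq]
  have h1 : (fun t : ℝ => u ((x, z) + t • ez)) = fun t => (fun r => u (x, r)) (z + t) := by
    funext t
    simp [ez]
  have h2 : deriv (fun t => (fun r => u (x, r)) (z + t)) =
      fun t => deriv (fun r => u (x, r)) (z + t) := funext fun t =>
    deriv_comp_const_add (fun r => u (x, r)) z t
  rw [h1, h2, deriv_comp_const_add, add_zero]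

theorem isoProfile_sq (N : ℕ) {s : ℝ} (hs : 0 ≤ s) : isoProfile N s ^ 2 =
    (N : ℝ) ^ 2 * omegaN N ^ (2 / (N : ℝ)) * s ^ (2 - 2 / (N : ℝ)) := by
  have hω : 0 ≤ omegaN N := ENNReal.toReal_nonneg
  rw [isoProfile, mul_pow, mul_pow, ← Real.rpow_mul_natCast hω, ← Real.rpow_mul_natCast hs]
  congr 2
  · congr 1
    push_cast
    ring
  · push_cast
    ring

namespace CylSol

variable {N : ℕ} {a : ℝ → ℝ} {Ω : Set (Euc N)} {u : Euc N × ℝ → ℝ} {M : ℝ}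

theorem integral_rearr (h : CylSol a Ω u M) (hM : 0 ≤ M) {z s : ℝ} (hz : 0 < z) (hs : 0 ≤ s) :
    ∫ σ in (0 : ℝ)..s, rearr Ω (fun x => u (x, z)) σ = conc (slc Ω u z) s := by
  refine intervalIntegral.integral_congr fun σ hσ => ?_
  rw [uIcc_of_le hs] at hσ
  exact (h.slice hM hz).rearr_eq_dre (fun x hx => (slc_apply hx z).symm) hσ.1

theorem concentration (h : CylSol a Ω u M) (hM : 0 ≤ M) (hN : 2 ≤ N) :
    ∀ᵐ s : ℝ, 0 < s → ∀ z, 0 < z →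
      0 ≤ a z * deriv (deriv fun z => conc (slc Ω u z) s) z +
        isoProfile N s ^ 2 * deriv (deriv (conc (slc Ω u z))) s := by
  have hN0 : 0 < N := by omega
  filter_upwards [measure_eq_zero_iff_ae_notMem.1 (h.volume_clash hM hN0)] with s hs hs0 z hz
  rw [(h.slice hM hz).deriv_deriv_conc hN0 hs0]
  by_cases hd0 : deriv (dre (slc Ω u z)) s = 0
  · rw [hd0, mul_zero, add_zero]
    exact mul_nonneg (h.pos z hz).le (h.deriv_deriv_conc_nonneg hM hN0 hs0.le hz)
  · have hd := (differentiableAt_of_deriv_ne_zero hd0).hasDerivAt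
    refine h.concentration_of_regular_level hM hN hs0 hz hd hd0 ?_
    by_contra hb
    exact hs ⟨hs0, z, _, hz, hd0, hd, hb⟩

end CylSol

end

/-- the concentration function `U(s,z) = ∫_0^s w*(σ,z) dσ` of a nonnegative
solution of `z^β ∂²_z w + Δ_x w = 0` vanishing on the lateral boundary satisfies
`z^β ∂²U/∂z² + N² ω_N^{2/N} s^{2-2/N} ∂²U/∂s² ≥ 0` for a.e. `s ∈ (0,|Ω|)` and all `z > 0`. -/
theorem concentration_differential_inequality
    {N : ℕ} (hN : 2 ≤ N) (α : ℝ) (hα : α ∈ Ioo (0 : ℝ) 2)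
    (Ω : Set (Euc N)) (hΩo : IsOpen Ω) (hΩb : Bornology.IsBounded Ω)
    (w : Euc N → ℝ → ℝ)
    (hpos : ∀ x ∈ Ω, ∀ z ∈ Ioi (0 : ℝ), 0 ≤ w x z)
    (hcont : ContinuousOn (fun p : Euc N × ℝ => w p.1 p.2) (closure (Ω ×ˢ Ioi (0 : ℝ))))
    (hbdd : ∃ M : ℝ, ∀ p ∈ closure (Ω ×ˢ Ioi (0 : ℝ)), |w (Prod.fst p) p.2| ≤ M)
    (hC2 : ContDiffOn ℝ 2 (fun p : Euc N × ℝ => w p.1 p.2) (Ω ×ˢ Ioi (0 : ℝ)))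
    (hderivBdd : ∃ M : ℝ, ∀ p ∈ Ω ×ˢ Ioi (0 : ℝ),
      ‖fderiv ℝ (fun q : Euc N × ℝ => w q.1 q.2) p‖ ≤ M ∧
      ‖fderiv ℝ (fderiv ℝ fun q : Euc N × ℝ => w q.1 q.2) p‖ ≤ M)
    (hpde : ∀ x ∈ Ω, ∀ z ∈ Ioi (0 : ℝ),
      z ^ (2 * (α - 1) / α) * deriv (deriv (w x)) z + lapx w x z = 0)
    (hlateral : ∀ x ∈ frontier Ω, ∀ z ∈ Ici (0 : ℝ), w x z = 0)
    (hlevel : ∀ᵐ p : ℝ × ℝ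
        ∂(volume.restrict (Ioo (0 : ℝ) (volume Ω).toReal ×ˢ Ioi (0 : ℝ))),
      volume {x | x ∈ Ω ∧ w x p.2 = rearr Ω (fun x' => w x' p.2) p.1} = 0) :
    ∀ᵐ s ∂(volume.restrict (Ioo (0 : ℝ) (volume Ω).toReal)),
      ∀ z ∈ Ioi (0 : ℝ),
        0 ≤ z ^ (2 * (α - 1) / α) *
            deriv (deriv fun z' : ℝ => ∫ σ in (0 : ℝ)..s, rearr Ω (fun x => w x z') σ) z +
          (N : ℝ) ^ 2 * omegaN N ^ (2 / (N : ℝ)) * s ^ (2 - 2 / (N : ℝ)) *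
            deriv (deriv fun s' : ℝ => ∫ σ in (0 : ℝ)..s', rearr Ω (fun x => w x z) σ) s := by
  obtain ⟨M₀, hM₀⟩ := hbdd
  obtain ⟨M₁, hM₁⟩ := hderivBdd
  set u : Euc N × ℝ → ℝ := fun p => w p.1 p.2 with hu
  have hVo : IsOpen (Ω ×ˢ Ioi (0 : ℝ)) := hΩo.prod isOpen_Ioi
  have hM : 0 ≤ max 0 (max M₀ M₁) := le_max_left _ _
  have hle₀ : M₀ ≤ max 0 (max M₀ M₁) := (le_max_left _ _).trans (le_max_right _ _)
  have hle₁ : M₁ ≤ max 0 (max M₀ M₁) := (le_max_right _ _).trans (le_max_right _ _)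
  have h : CylSol (fun z => z ^ (2 * (α - 1) / α)) Ω u (max 0 (max M₀ M₁)) :=
    { isOpen := hΩo
      isBounded := hΩb
      pos := fun z hz => Real.rpow_pos_of_pos hz _
      smooth := fun z hz => Real.contDiffAt_rpow_const_of_ne hz.ne'
      sol := ⟨hC2, fun p hp => by
        rw [← hpde p.1 hp.1 p.2 hp.2]
        congr 1
        · rw [← deriv_deriv_vertical hVo hC2 hp]
        · refine Finset.sum_congr rfl fun i _ => ?_
          rw [← deriv_deriv_line hVo hC2 hp]
          simp [eb, hu]⟩
      cont := fun x hx z hz => by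
        rw [closure_prod_eq, closure_Ioi] at hcont
        exact (hcont (x, z) ⟨hx, le_of_lt hz⟩).mono (prod_mono_right Ioi_subset_Ici_self)
      nonneg := fun x hx z hz => hpos x hx z hz
      lateral := fun x hx z hz => hlateral x hx z (le_of_lt hz)
      bound := fun x hx z hz =>
        (le_abs_self _).trans ((hM₀ (x, z) (subset_closure ⟨hx, hz⟩)).trans hle₀)
      bound₁ := fun x hx z hz => (hM₁ (x, z) ⟨hx, hz⟩).1.trans hle₁
      bound₂ := fun x hx z hz => (hM₁ (x, z) ⟨hx, hz⟩).2.trans hle₁ }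
  rw [ae_restrict_iff' measurableSet_Ioo]
  filter_upwards [h.concentration hM hN] with s hs hsI z hz
  have hs0 : 0 < s := hsI.1
  have hz0 : 0 < z := hz
  have e1 : (fun z' : ℝ => ∫ σ in (0 : ℝ)..s, rearr Ω (fun x => w x z') σ) =ᶠ[nhds z]
      fun z' => conc (slc Ω u z') s := by
    filter_upwards [eventually_gt_nhds hz0] with z' hz'
    exact h.integral_rearr hM hz' hs0.le
  have e2 : (fun s' : ℝ => ∫ σ in (0 : ℝ)..s', rearr Ω (fun x => w x z) σ) =ᶠ[nhds s]
      conc (slc Ω u z) := by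
    filter_upwards [eventually_gt_nhds hs0] with s' hs'
    exact h.integral_rearr hM hz0 hs'.le
  rw [e1.deriv.deriv_eq, e2.deriv.deriv_eq, ← isoProfile_sq N hs0.le]
  exact hs hs0 z hz0
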